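/- arXiv:2312.04130 — 2 statements merged into one kernel-verified Lean document; each statement's English description precedes it below -/
import Mathlib

section
/- Let d = 4 and let u(·,t) = G(·,t) * f. Suppose 1 ≤ p ≤ q ≤ ∞ are such that the point (1/p, 1/q) lies on the line segment in the plane with endpoints (3/4, 1/2) and (1, 0), i.e. 1/q = −2(1/p) + 2 with 3/4 ≤ 1/p ≤ 1. Then for every ε > 0 there exists C = C(p,q,ε) > 0 such that ‖u(·,t)‖_{l^q(ℤ^4)} ≤ C (1+|t|)^{-(3/2−ε)(1 − 2/q)} ‖f‖_{l^p(ℤ^4)} for all t ∈ ℝ and all f ∈ l^p(ℤ^4). -/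
open MeasureTheory Complex ENNReal

/-- `ω(ξ) = (∑ (2 - 2cos ξ_j))^{1/2}` -/
noncomputable def discOmega (d : ℕ) (ξ : Fin d → ℝ) : ℝ :=
  Real.sqrt (∑ j, (2 - 2 * Real.cos (ξ j)))

/-- the cube `[-π,π]^d` -/
def torusBox (d : ℕ) : Set (Fin d → ℝ) :=
  Set.univ.pi fun _ => Set.Icc (-Real.pi) Real.pi

/-- Green's function of the discrete wave equation on `ℤ^d`. -/
noncomputable def greenG (d : ℕ) (x : Fin d → ℤ) (t : ℝ) : ℂ :=
  ((2 * Real.pi : ℂ) ^ d)⁻¹ *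
    ∫ ξ in torusBox d,
      Complex.exp (Complex.I * ((∑ j, (x j : ℝ) * ξ j : ℝ) : ℂ)) *
        ((Real.sin (t * discOmega d ξ) / discOmega d ξ : ℝ) : ℂ)

/-- the `l^p` norm on `ℤ^d` (with respect to counting measure). -/
noncomputable def lpNorm (d : ℕ) (p : ℝ≥0∞) (f : (Fin d → ℤ) → ℂ) : ℝ≥0∞ :=
  eLpNorm f p Measure.count

section VanDerCorput

variable {φ φ' φ'' : ℝ → ℝ}

/-- Van der Corput's first derivative test, for a phase with increasing derivative. -/
theorem norm_integral_exp_le_of_le_deriv (hφ : ∀ x, HasDerivAt φ (φ' x) x)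
    (hφ' : ∀ x, HasDerivAt φ' (φ'' x) x) (hc : Continuous φ'') {a b l : ℝ} (hab : a ≤ b)
    (hl : 0 < l) (hpos : ∀ x ∈ Set.Icc a b, 0 ≤ φ'' x) (hle : ∀ x ∈ Set.Icc a b, l ≤ φ' x) :
    ‖∫ x in a..b, cexp (I * φ x)‖ ≤ 3 / l := by
  have hcφ : Continuous φ := continuous_iff_continuousAt.2 fun x => (hφ x).continuousAt
  have hcφ' : Continuous φ' := continuous_iff_continuousAt.2 fun x => (hφ' x).continuousAt
  have hne : ∀ x ∈ Set.uIcc a b, φ' x ≠ 0 := fun x hx => by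
    rw [Set.uIcc_of_le hab] at hx
    exact (hl.trans_le (hle x hx)).ne'
  have hneC : ∀ x ∈ Set.uIcc a b, (φ' x : ℂ) ≠ 0 := fun x hx => by
    exact_mod_cast hne x hx
  have hR : ContinuousOn (fun x => cexp (I * φ x) * (φ'' x / (I * (φ' x) ^ 2))) (Set.uIcc a b) := by
    refine ContinuousOn.mul (by fun_prop) (ContinuousOn.div (by fun_prop) (by fun_prop) ?_)
    intro x hx
    simp [hne x hx]
  have hE : ContinuousOn (fun x => cexp (I * φ x)) (Set.uIcc a b) := by fun_prop
  have key : ∫ x in a..b, (cexp (I * φ x) - cexp (I * φ x) * (φ'' x / (I * (φ' x) ^ 2))) =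
      cexp (I * φ b) / (I * φ' b) - cexp (I * φ a) / (I * φ' a) := by
    refine intervalIntegral.integral_eq_sub_of_hasDerivAt
      (f := fun x => cexp (I * φ x) / (I * φ' x)) (fun x hx => ?_) (hE.sub hR).intervalIntegrable
    have h1 : HasDerivAt (fun x => cexp (I * φ x)) (cexp (I * φ x) * (I * φ' x)) x :=
      (((hφ x).ofReal_comp).const_mul I).cexp
    have h2 : HasDerivAt (fun x => I * (φ' x : ℂ)) (I * φ'' x) x :=
      ((hφ' x).ofReal_comp).const_mul I
    refine (h1.div h2 (mul_ne_zero I_ne_zero (hneC x hx))).congr_deriv ?_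
    have := hneC x hx
    field_simp
  have hreal : ∫ x in a..b, φ'' x / (φ' x) ^ 2 = -(φ' b)⁻¹ - -(φ' a)⁻¹ := by
    refine intervalIntegral.integral_eq_sub_of_hasDerivAt (f := fun x => -(φ' x)⁻¹)
      (fun x hx => ?_) ?_
    · exact ((hφ' x).inv (hne x hx)).neg.congr_deriv (by ring)
    · exact (ContinuousOn.div (by fun_prop) (by fun_prop)
        (fun x hx => pow_ne_zero _ (hne x hx))).intervalIntegrable
  have hb : ‖∫ x in a..b, cexp (I * φ x) * (φ'' x / (I * (φ' x) ^ 2))‖ ≤ 1 / l := by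
    calc _ ≤ ∫ x in a..b, φ'' x / (φ' x) ^ 2 := by
          refine intervalIntegral.norm_integral_le_of_norm_le hab ?_ ?_
          · refine Filter.Eventually.of_forall fun x hx => ?_
            have := hpos x ⟨hx.1.le, hx.2⟩
            simp [abs_of_nonneg this]
          · exact (ContinuousOn.div (by fun_prop) (by fun_prop)
              (fun x hx => pow_ne_zero _ (hne x hx))).intervalIntegrable
      _ ≤ 1 / l := by
          rw [hreal]
          have h1 : 0 < φ' b := hl.trans_le (hle b ⟨hab, le_rfl⟩)
          have h2 : (φ' a)⁻¹ ≤ 1 / l := by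
            rw [one_div]; exact inv_anti₀ hl (hle a ⟨le_rfl, hab⟩)
          have := inv_pos.2 h1
          linarith
  have hbd : ∀ x ∈ Set.Icc a b, ‖cexp (I * φ x) / (I * φ' x)‖ ≤ 1 / l := fun x hx => by
    have h := hle x hx
    simp only [norm_div, norm_exp_I_mul_ofReal, norm_mul, norm_I, one_mul, norm_real,
      Real.norm_eq_abs, abs_of_pos (hl.trans_le h)]
    exact one_div_le_one_div_of_le hl h
  rw [intervalIntegral.integral_sub hE.intervalIntegrable hR.intervalIntegrable] at key
  have h1 := hbd a ⟨le_rfl, hab⟩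
  have h2 := hbd b ⟨hab, le_rfl⟩
  rw [sub_eq_iff_eq_add] at key
  rw [key]
  calc _ ≤ 1 / l + 1 / l + 1 / l :=
        (norm_add_le _ _).trans (add_le_add ((norm_sub_le _ _).trans (add_le_add h2 h1)) hb)
    _ = 3 / l := by ring

theorem norm_integral_exp_neg (a b : ℝ) :
    ‖∫ x in a..b, cexp (I * ((-φ x : ℝ) : ℂ))‖ = ‖∫ x in a..b, cexp (I * φ x)‖ := by
  have : ∀ x, cexp (I * ((-φ x : ℝ) : ℂ)) = (starRingEnd ℂ) (cexp (I * φ x)) := fun x => by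
    rw [← Complex.exp_conj]; simp
  simp_rw [this]
  rw [← Complex.norm_conj (∫ x in a..b, cexp (I * φ x))]
  congr 1
  simp only [intervalIntegral, map_sub, integral_conj]

theorem norm_integral_exp_le_of_deriv_le (hφ : ∀ x, HasDerivAt φ (φ' x) x)
    (hφ' : ∀ x, HasDerivAt φ' (φ'' x) x) (hc : Continuous φ'') {a b l : ℝ} (hab : a ≤ b)
    (hl : 0 < l) (hpos : ∀ x ∈ Set.Icc a b, 0 ≤ φ'' x) (hle : ∀ x ∈ Set.Icc a b, φ' x ≤ -l) :
    ‖∫ x in a..b, cexp (I * φ x)‖ ≤ 3 / l := by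
  -- reflect the interval
  have h := norm_integral_exp_le_of_le_deriv (φ := fun x => φ (-x)) (φ' := fun x => -φ' (-x))
    (φ'' := fun x => φ'' (-x)) (a := -b) (b := -a) (l := l)
    (fun x => ((hφ (-x)).comp x (hasDerivAt_neg x)).congr_deriv (by ring))
    (fun x => ((hφ' (-x)).comp x (hasDerivAt_neg x)).neg.congr_deriv (by ring))
    (by fun_prop) (by linarith) hl
    (fun x hx => hpos _ ⟨by linarith [hx.2], by linarith [hx.1]⟩)
    (fun x hx => by
      have := hle (-x) ⟨by linarith [hx.2], by linarith [hx.1]⟩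
      linarith)
  rwa [intervalIntegral.integral_comp_neg (fun x => cexp (I * φ x)), neg_neg, neg_neg] at h

/-- If the phase has increasing derivative and `|φ'| ≤ l` only on a set of diameter at most `δ`,
the oscillatory integral is at most `δ + 6 / l`. -/
theorem norm_integral_exp_le_of_sublevel (hφ : ∀ x, HasDerivAt φ (φ' x) x)
    (hφ' : ∀ x, HasDerivAt φ' (φ'' x) x) (hc : Continuous φ'') {a b l δ : ℝ} (hab : a ≤ b)
    (hl : 0 < l) (hδ0 : 0 ≤ δ) (hpos : ∀ x ∈ Set.Icc a b, 0 ≤ φ'' x)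
    (hδ : ∀ c d, a ≤ c → c ≤ d → d ≤ b → |φ' c| ≤ l → |φ' d| ≤ l → d - c ≤ δ) :
    ‖∫ x in a..b, cexp (I * φ x)‖ ≤ δ + 6 / l := by
  have hcφ : Continuous φ := continuous_iff_continuousAt.2 fun x => (hφ x).continuousAt
  have hcφ' : Continuous φ' := continuous_iff_continuousAt.2 fun x => (hφ' x).continuousAt
  have h_int : ∀ u v, IntervalIntegrable (fun x => cexp (I * φ x)) volume u v := fun u v =>
    Continuous.intervalIntegrable (by fun_prop) _ _
  have hmono : MonotoneOn φ' (Set.Icc a b) := by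
    refine monotoneOn_of_deriv_nonneg (convex_Icc a b) hcφ'.continuousOn
      (fun x _ => (hφ' x).differentiableAt.differentiableWithinAt) fun x hx => ?_
    rw [(hφ' x).deriv]
    exact hpos x (interior_subset hx)
  have h3l : 0 < 3 / l := by positivity
  have h6 : 6 / l = 3 / l + 3 / l := by ring
  have right : ∀ c, a ≤ c → c ≤ b → -l ≤ φ' c →
      ‖∫ x in c..b, cexp (I * φ x)‖ ≤ δ + 3 / l := by
    intro c hac hcb hcl
    have htriv : ∀ d, c ≤ d → d ≤ b → |φ' c| ≤ l → |φ' d| ≤ l →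
        ‖∫ x in c..d, cexp (I * φ x)‖ ≤ δ := fun d hcd hdb h1 h2 => by
      have := intervalIntegral.norm_integral_le_of_norm_le_const (a := c) (b := d) (C := 1)
        (f := fun x => cexp (I * φ x)) (fun x _ => (norm_exp_I_mul_ofReal _).le)
      rw [one_mul, abs_of_nonneg (sub_nonneg.2 hcd)] at this
      exact this.trans (hδ c d hac hcd hdb h1 h2)
    by_cases h1 : l ≤ φ' c
    · refine (norm_integral_exp_le_of_le_deriv hφ hφ' hc hcb hl
        (fun x hx => hpos x ⟨hac.trans hx.1, hx.2⟩) (fun x hx => h1.trans ?_)).trans (by linarith)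
      exact hmono ⟨hac, hcb⟩ ⟨hac.trans hx.1, hx.2⟩ hx.1
    · have hcabs : |φ' c| ≤ l := abs_le.2 ⟨hcl, (not_le.1 h1).le⟩
      by_cases h2 : φ' b ≤ l
      · have := htriv b hcb le_rfl hcabs
          (abs_le.2 ⟨hcl.trans (hmono ⟨hac, hcb⟩ ⟨hab, le_rfl⟩ hcb), h2⟩)
        linarith
      · obtain ⟨d, hd, hdl⟩ := intermediate_value_Icc hcb hcφ'.continuousOn
          (show l ∈ Set.Icc (φ' c) (φ' b) from ⟨(not_le.1 h1).le, (not_le.1 h2).le⟩)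
        rw [← intervalIntegral.integral_add_adjacent_intervals (h_int c d) (h_int d b)]
        refine (norm_add_le _ _).trans (add_le_add ?_ ?_)
        · exact htriv d hd.1 hd.2 hcabs (by rw [hdl, abs_of_pos hl])
        · exact norm_integral_exp_le_of_le_deriv hφ hφ' hc hd.2 hl
            (fun x hx => hpos x ⟨(hac.trans hd.1).trans hx.1, hx.2⟩)
            (fun x hx => hdl ▸ hmono ⟨hac.trans hd.1, hd.2⟩
              ⟨(hac.trans hd.1).trans hx.1, hx.2⟩ hx.1)
  by_cases h1 : -l ≤ φ' a
  · have := right a le_rfl hab h1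
    linarith
  · by_cases h2 : φ' b ≤ -l
    · refine (norm_integral_exp_le_of_deriv_le hφ hφ' hc hab hl hpos
        (fun x hx => le_trans ?_ h2)).trans (by linarith)
      exact hmono hx ⟨hab, le_rfl⟩ hx.2
    · obtain ⟨c, hcm, hcl⟩ := intermediate_value_Icc hab hcφ'.continuousOn
          (show -l ∈ Set.Icc (φ' a) (φ' b) from ⟨(not_le.1 h1).le, (not_le.1 h2).le⟩)
      rw [← intervalIntegral.integral_add_adjacent_intervals (h_int a c) (h_int c b)]
      have e1 := norm_integral_exp_le_of_deriv_le hφ hφ' hc hcm.1 hl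
        (fun x hx => hpos x ⟨hx.1, hx.2.trans hcm.2⟩)
        (fun x hx => hcl ▸ hmono ⟨hx.1, hx.2.trans hcm.2⟩ hcm hx.2)
      have e2 := right c hcm.1 hcm.2 hcl.ge
      have := norm_add_le (∫ x in a..c, cexp (I * φ x)) (∫ x in c..b, cexp (I * φ x))
      linarith

end VanDerCorput

theorem sin_sub_sin_lower {c d : ℝ} (hc : 0 ≤ c) (hcd : c ≤ d) (hd : d ≤ Real.pi / 2) :
    2 * (d - c) ^ 2 / Real.pi ^ 2 ≤ Real.sin d - Real.sin c ∧
      (d - c) * Real.cos c / Real.pi ≤ Real.sin d - Real.sin c := by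
  have hpi := Real.pi_pos
  have h1 : 2 / Real.pi * ((d - c) / 2) ≤ Real.sin ((d - c) / 2) :=
    Real.mul_le_sin (by linarith) (by linarith)
  have h2 : 2 / Real.pi * (Real.pi / 2 - (d + c) / 2) ≤ Real.cos ((d + c) / 2) := by
    rw [← Real.sin_pi_div_two_sub]
    exact Real.mul_le_sin (by linarith) (by linarith)
  have h3 : Real.cos c / 2 ≤ Real.cos ((d + c) / 2) := by
    have hm : Real.cos d + Real.cos c =
        2 * Real.cos ((d + c) / 2) * Real.cos ((d - c) / 2) := Real.cos_add_cos d c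
    have p1 : 0 ≤ Real.cos d := Real.cos_nonneg_of_mem_Icc ⟨by linarith, by linarith⟩
    have p2 : 0 ≤ Real.cos ((d + c) / 2) := Real.cos_nonneg_of_mem_Icc ⟨by linarith, by linarith⟩
    nlinarith [Real.cos_le_one ((d - c) / 2)]
  have h4 : (d - c) / Real.pi ≤ Real.cos ((d + c) / 2) := by
    refine le_trans ?_ h2
    rw [div_mul_eq_mul_div]
    gcongr
    linarith
  have h1' : (d - c) / Real.pi ≤ Real.sin ((d - c) / 2) := by
    refine le_trans (le_of_eq ?_) h1
    ring
  have hD : 0 ≤ (d - c) / Real.pi := div_nonneg (by linarith) hpi.le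
  have hcc : 0 ≤ Real.cos c := Real.cos_nonneg_of_mem_Icc ⟨by linarith, by linarith⟩
  have hsin : 0 ≤ 2 * Real.sin ((d - c) / 2) := by linarith
  rw [Real.sin_sub_sin]
  constructor
  · calc _ = 2 * ((d - c) / Real.pi) * ((d - c) / Real.pi) := by ring
      _ ≤ 2 * Real.sin ((d - c) / 2) * Real.cos ((d + c) / 2) := by gcongr
  · calc _ = 2 * ((d - c) / Real.pi) * (Real.cos c / 2) := by ring
      _ ≤ 2 * Real.sin ((d - c) / 2) * Real.cos ((d + c) / 2) := by gcongr

theorem sublevel_diam_le {s y w : ℝ} (hs : 0 < s) (hw : 0 < w) (hw4 : w ^ 4 = s * |s - |y| / 2|)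
    {c d : ℝ} (hc : 0 ≤ c) (hcd : c ≤ d) (hd : d ≤ Real.pi / 2)
    (h1 : |y + 2 * s * Real.sin c| ≤ 2 * w) (h2 : |y + 2 * s * Real.sin d| ≤ 2 * w) :
    d - c ≤ 9 / w := by
  have hpi := Real.pi_pos
  have hpi4 : Real.pi < 3.15 := Real.pi_lt_d2
  obtain ⟨l1, l2⟩ := sin_sub_sin_lower hc hcd hd
  rw [abs_le] at h1 h2
  have hdiff : s * (Real.sin d - Real.sin c) ≤ 2 * w := by nlinarith
  have hD : 0 ≤ d - c := by linarith
  rw [le_div_iff₀ hw]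
  by_cases hcase : w ^ 3 < 2 * s
  · have e1 : s * (d - c) ^ 2 ≤ Real.pi ^ 2 * w := by
      rw [div_le_iff₀ (by positivity)] at l1
      nlinarith [mul_le_mul_of_nonneg_left l1 hs.le,
        mul_le_mul_of_nonneg_right hdiff (sq_nonneg Real.pi)]
    have e2 : ((d - c) * w) ^ 2 ≤ 2 * Real.pi ^ 2 := by
      have : s * ((d - c) * w) ^ 2 ≤ s * (2 * Real.pi ^ 2) := by
        calc s * ((d - c) * w) ^ 2 = (s * (d - c) ^ 2) * w ^ 2 := by ring
          _ ≤ (Real.pi ^ 2 * w) * w ^ 2 := by gcongr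
          _ = Real.pi ^ 2 * w ^ 3 := by ring
          _ ≤ Real.pi ^ 2 * (2 * s) := by gcongr
          _ = _ := by ring
      exact le_of_mul_le_mul_left this hs
    exact abs_le_of_sq_le_sq' (by nlinarith) (by norm_num) |>.2
  · push Not at hcase
    have hsc : 0 ≤ Real.sin c := Real.sin_nonneg_of_nonneg_of_le_pi hc (by linarith)
    have hsc1 := Real.sin_le_one c
    have hw34 : 2 * s * w ≤ w ^ 4 := by nlinarith
    have key : w ^ 4 / (2 * s) ≤ s * (1 - Real.sin c) := by
      rw [div_le_iff₀ (by positivity)]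
      have hmul : 2 * s * w ≤ s * |s - |y| / 2| := hw4 ▸ hw34
      have hr : 2 * w ≤ |s - |y| / 2| := by
        refine le_of_mul_le_mul_left ?_ hs
        linarith
      have : |s - |y| / 2| ≤ 2 * (s * (1 - Real.sin c)) := by
        rcases abs_cases y with ⟨e, hy⟩ | ⟨e, hy⟩ <;>
        rcases abs_cases (s - |y| / 2) with ⟨e', hy'⟩ | ⟨e', hy'⟩ <;>
        rw [e'] at hr ⊢ <;> rw [e] at hr hy' ⊢ <;> nlinarith
      rw [hw4]
      nlinarith
    have hcc : 0 ≤ Real.cos c := Real.cos_nonneg_of_mem_Icc ⟨by linarith, by linarith⟩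
    have hcos : 0.7 * w ^ 2 ≤ s * Real.cos c := by
      refine abs_le_of_sq_le_sq' ?_ (by positivity) |>.2
      rw [div_le_iff₀ (by positivity)] at key
      have : Real.cos c ^ 2 = (1 - Real.sin c) * (1 + Real.sin c) := by
        rw [Real.cos_sq']; ring
      have h3 : s ^ 2 * (1 - Real.sin c) ≤ (s * Real.cos c) ^ 2 := by
        rw [mul_pow, this]
        have : 0 ≤ s ^ 2 * (1 - Real.sin c) := mul_nonneg (sq_nonneg s) (by linarith)
        nlinarith
      have : (0.7 * w ^ 2) ^ 2 = 0.49 * w ^ 4 := by ring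
      nlinarith [pow_pos hw 4]
    rw [div_le_iff₀ hpi] at l2
    have e1 : (d - c) * (0.7 * w ^ 2) ≤ 2 * w * Real.pi := by
      calc (d - c) * (0.7 * w ^ 2) ≤ (d - c) * (s * Real.cos c) := by gcongr
        _ = s * ((d - c) * Real.cos c) := by ring
        _ ≤ s * ((Real.sin d - Real.sin c) * Real.pi) := by gcongr
        _ = s * (Real.sin d - Real.sin c) * Real.pi := by ring
        _ ≤ 2 * w * Real.pi := by gcongr
    have e2 : (d - c) * w * (0.7 * w) ≤ 9 * (0.7 * w) := by nlinarith
    exact le_of_mul_le_mul_right e2 (by positivity)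

/-- The oscillatory integral on a quarter period. -/
theorem norm_integral_bessel_quarter {s y w : ℝ} (hs : 0 < s) (hw : 0 < w)
    (hw4 : w ^ 4 = s * |s - |y| / 2|) {a b : ℝ} (ha : 0 ≤ a) (hab : a ≤ b)
    (hb : b ≤ Real.pi / 2) :
    ‖∫ x in a..b, cexp (I * ((y * x - 2 * s * Real.cos x : ℝ) : ℂ))‖ ≤ 12 / w := by
  have h := norm_integral_exp_le_of_sublevel (φ := fun x => y * x - 2 * s * Real.cos x)
    (φ' := fun x => y + 2 * s * Real.sin x) (φ'' := fun x => 2 * s * Real.cos x)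
    (a := a) (b := b) (l := 2 * w) (δ := 9 / w)
    (fun x => (((hasDerivAt_id x).const_mul y).sub
      ((Real.hasDerivAt_cos x).const_mul (2 * s))).congr_deriv (by simp))
    (fun x => (((Real.hasDerivAt_sin x).const_mul (2 * s)).const_add y))
    (by fun_prop) hab (by positivity) (by positivity)
    (fun x hx => mul_nonneg (by positivity)
      (Real.cos_nonneg_of_mem_Icc ⟨by linarith [hx.1, Real.pi_pos], by linarith [hx.2]⟩))
    (fun c d hac hcd hdb h1 h2 =>
      sublevel_diam_le hs hw hw4 (ha.trans hac) hcd (hdb.trans hb) h1 h2)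
  refine h.trans (le_of_eq ?_)
  field_simp
  norm_num

theorem norm_integral_bessel_half {s y w : ℝ} (hs : 0 < s) (hw : 0 < w)
    (hw4 : w ^ 4 = s * |s - |y| / 2|) {c : ℝ} (hc : 0 ≤ c) (hcpi : c ≤ Real.pi) :
    ‖∫ x in (0 : ℝ)..c, cexp (I * ((y * x - 2 * s * Real.cos x : ℝ) : ℂ))‖ ≤ 24 / w := by
  have hpi := Real.pi_pos
  have h12 : 24 / w = 12 / w + 12 / w := by ring
  have hp : 0 < 12 / w := by positivity
  rcases le_total c (Real.pi / 2) with h | h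
  · have := norm_integral_bessel_quarter hs hw hw4 le_rfl hc h
    linarith
  have h_int : ∀ u v, IntervalIntegrable
      (fun x : ℝ => cexp (I * ((y * x - 2 * s * Real.cos x : ℝ) : ℂ))) volume u v := fun u v =>
    Continuous.intervalIntegrable (by fun_prop) _ _
  rw [← intervalIntegral.integral_add_adjacent_intervals (h_int 0 (Real.pi / 2)) (h_int _ c), h12]
  refine (norm_add_le _ _).trans (add_le_add
    (norm_integral_bessel_quarter hs hw hw4 le_rfl (by linarith) le_rfl) ?_)
  have e := norm_integral_bessel_quarter hs hw hw4 (a := Real.pi - c) (b := Real.pi / 2)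
    (by linarith) (by linarith) le_rfl
  rw [← norm_integral_exp_neg] at e
  have e2 : ∀ x : ℝ, cexp (I * ((y * x - 2 * s * Real.cos x : ℝ) : ℂ)) =
      cexp (I * (y * Real.pi : ℝ)) *
        cexp (I * ((-(y * (Real.pi - x) - 2 * s * Real.cos (Real.pi - x)) : ℝ) : ℂ)) := fun x => by
    rw [← Complex.exp_add, Real.cos_pi_sub]
    congr 1
    push_cast
    ring
  simp_rw [e2]
  rw [intervalIntegral.integral_const_mul, norm_mul, norm_exp_I_mul_ofReal, one_mul,
    intervalIntegral.integral_comp_sub_left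
      (fun x => cexp (I * ((-(y * x - 2 * s * Real.cos x) : ℝ) : ℂ))),
    show Real.pi - Real.pi / 2 = Real.pi / 2 by ring]
  exact e

/-- Integration against a decreasing amplitude does not increase bounds on primitives. -/
theorem norm_integral_mul_antitone_le {ψ ψ' : ℝ → ℝ} {f : ℝ → ℂ} {a b B : ℝ} (hab : a ≤ b)
    (hψ : ∀ x, HasDerivAt ψ (ψ' x) x) (hψ' : Continuous ψ') (hf : Continuous f)
    (hpos : 0 ≤ ψ b) (hneg : ∀ x ∈ Set.Icc a b, ψ' x ≤ 0)
    (hB : ∀ c ∈ Set.Icc a b, ‖∫ x in a..c, f x‖ ≤ B) :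
    ‖∫ x in a..b, (ψ x : ℂ) * f x‖ ≤ B * ψ a := by
  have hcψ : Continuous ψ := continuous_iff_continuousAt.2 fun x => (hψ x).continuousAt
  have hF : ∀ x, HasDerivAt (fun c => ∫ x in a..c, f x) (f x) x := fun x =>
    intervalIntegral.integral_hasDerivAt_right (hf.intervalIntegrable _ _)
      (hf.stronglyMeasurableAtFilter _ _) hf.continuousAt
  have hcF : Continuous (fun c => ∫ x in a..c, f x) :=
    continuous_iff_continuousAt.2 fun x => (hF x).continuousAt
  have parts := intervalIntegral.integral_mul_deriv_eq_deriv_mul (a := a) (b := b)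
    (u := fun x => (ψ x : ℂ)) (u' := fun x => (ψ' x : ℂ)) (v := fun c => ∫ x in a..c, f x) (v' := f)
    (fun x _ => (hψ x).ofReal_comp) (fun x _ => hF x)
    (Continuous.intervalIntegrable (by fun_prop) _ _) (hf.intervalIntegrable _ _)
  rw [parts]
  simp only [intervalIntegral.integral_same, mul_zero, sub_zero]
  have h1 : ‖(ψ b : ℂ) * ∫ x in a..b, f x‖ ≤ ψ b * B := by
    rw [norm_mul, norm_real, Real.norm_of_nonneg hpos]
    exact mul_le_mul_of_nonneg_left (hB b ⟨hab, le_rfl⟩) hpos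
  have h2 : ‖∫ x in a..b, (ψ' x : ℂ) * ∫ y in a..x, f y‖ ≤ ∫ x in a..b, -ψ' x * B := by
    refine intervalIntegral.norm_integral_le_of_norm_le hab
      (Filter.Eventually.of_forall fun x hx => ?_)
      (Continuous.intervalIntegrable (by fun_prop) _ _)
    have hx' : x ∈ Set.Icc a b := ⟨hx.1.le, hx.2⟩
    rw [norm_mul, norm_real, Real.norm_of_nonpos (hneg x hx')]
    exact mul_le_mul_of_nonneg_left (hB x hx') (neg_nonneg.2 (hneg x hx'))
  rw [intervalIntegral.integral_mul_const, intervalIntegral.integral_neg,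
    intervalIntegral.integral_eq_sub_of_hasDerivAt (fun x _ => hψ x)
      (hψ'.intervalIntegrable _ _)] at h2
  calc _ ≤ ψ b * B + -(ψ b - ψ a) * B := (norm_sub_le _ _).trans (add_le_add h1 h2)
    _ = B * ψ a := by ring

/-- The one-dimensional factor of the damped Schrödinger kernel on the lattice. -/
noncomputable def schrKernel (κ : ℂ) (n : ℤ) (s : ℝ) : ℂ :=
  ∫ θ in Set.Icc (-Real.pi) Real.pi,
    cexp (I * (n * θ : ℝ)) * cexp (-(κ * s * (2 - 2 * Real.cos θ : ℝ)))

theorem norm_integral_damped_half {η s y w : ℝ} (hη : 0 ≤ η) (hs : 0 < s) (hw : 0 < w)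
    (hw4 : w ^ 4 = s * |s - |y| / 2|) :
    ‖∫ θ in (0 : ℝ)..Real.pi,
      cexp (I * (y * θ : ℝ)) * cexp (-((η - I) * s * (2 - 2 * Real.cos θ : ℝ)))‖ ≤ 24 / w := by
  have h := norm_integral_mul_antitone_le (a := 0) (b := Real.pi) (B := 24 / w)
    (ψ := fun θ => Real.exp (-(η * s * (2 - 2 * Real.cos θ))))
    (ψ' := fun θ => Real.exp (-(η * s * (2 - 2 * Real.cos θ))) * -(η * s * (2 * Real.sin θ)))
    (f := fun x => cexp (I * ((y * x - 2 * s * Real.cos x : ℝ) : ℂ)))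
    Real.pi_pos.le
    (fun x => (((((Real.hasDerivAt_cos x).const_mul 2).const_sub 2).const_mul
      (η * s)).neg.exp).congr_deriv (by simp only [Pi.neg_apply]; ring))
    (by fun_prop) (by fun_prop) (Real.exp_pos _).le
    (fun x hx => mul_nonpos_of_nonneg_of_nonpos (Real.exp_pos _).le (neg_nonpos.2 (by
      have := Real.sin_nonneg_of_nonneg_of_le_pi hx.1 hx.2
      positivity)))
    (fun c hc => norm_integral_bessel_half hs hw hw4 hc.1 hc.2)
  have e : ∀ θ : ℝ, cexp (I * (y * θ : ℝ)) * cexp (-((η - I) * s * (2 - 2 * Real.cos θ : ℝ))) =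
      cexp (I * (2 * s : ℝ)) * (((Real.exp (-(η * s * (2 - 2 * Real.cos θ))) : ℝ) : ℂ) *
        cexp (I * ((y * θ - 2 * s * Real.cos θ : ℝ) : ℂ))) := fun θ => by
    rw [Complex.ofReal_exp, ← Complex.exp_add, ← Complex.exp_add, ← Complex.exp_add]
    congr 1
    push_cast
    ring
  simp_rw [e]
  rw [intervalIntegral.integral_const_mul, norm_mul, norm_exp_I_mul_ofReal, one_mul]
  simpa using h

theorem norm_schrKernel_le {η s w : ℝ} {n : ℤ} (hη : 0 ≤ η) (hs : 0 < s) (hw : 0 < w)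
    (hw4 : w ^ 4 = s * |s - |(n : ℝ)| / 2|) :
    ‖schrKernel (η - I) n s‖ ≤ 48 / w := by
  have hpi := Real.pi_pos
  rw [schrKernel, integral_Icc_eq_integral_Ioc, ← intervalIntegral.integral_of_le (by linarith)]
  have h_int : ∀ u v, IntervalIntegrable (fun θ : ℝ => cexp (I * (n * θ : ℝ)) *
      cexp (-((η - I) * s * (2 - 2 * Real.cos θ : ℝ)))) volume u v := fun u v =>
    Continuous.intervalIntegrable (by fun_prop) _ _
  rw [← intervalIntegral.integral_add_adjacent_intervals (h_int _ 0) (h_int 0 _),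
    show 48 / w = 24 / w + 24 / w by ring]
  refine (norm_add_le _ _).trans (add_le_add ?_ (norm_integral_damped_half hη hs hw hw4))
  have h := norm_integral_damped_half (y := -(n : ℝ)) hη hs hw (by rwa [abs_neg])
  rw [← neg_zero, ← intervalIntegral.integral_comp_neg]
  simpa using h

theorem norm_schrKernel_le_two_pi {η s : ℝ} {n : ℤ} (hη : 0 ≤ η) (hs : 0 ≤ s) :
    ‖schrKernel (η - I) n s‖ ≤ 2 * Real.pi := by
  have hpi := Real.pi_pos
  have h := norm_setIntegral_le_of_norm_le_const (μ := volume) (C := 1)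
    (s := Set.Icc (-Real.pi) Real.pi)
    (f := fun θ : ℝ => cexp (I * (n * θ : ℝ)) * cexp (-((η - I) * s * (2 - 2 * Real.cos θ : ℝ))))
    (by simp) (fun θ _ => by
      rw [norm_mul, norm_exp_I_mul_ofReal, one_mul, Complex.norm_exp]
      refine Real.exp_le_one_iff.2 ?_
      have h1 : (-((η - I) * s * ((2 - 2 * Real.cos θ : ℝ) : ℂ))).re =
        -(η * s * (2 - 2 * Real.cos θ)) := by
        rw [neg_re, re_mul_ofReal, re_mul_ofReal]; simp
      rw [h1]
      have := Real.cos_le_one θ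
      have : 0 ≤ η * s * (2 - 2 * Real.cos θ) := mul_nonneg (by positivity) (by linarith)
      linarith)
  refine h.trans (le_of_eq ?_)
  rw [Measure.real, Real.volume_Icc, ENNReal.toReal_ofReal (by linarith)]
  ring

/-- The bound used for averaging the kernel over time. -/
theorem norm_schrKernel_pow_four_le {η s δ : ℝ} {n : ℤ} (hη : 0 ≤ η) (hs : 0 < s)
    (hne : s ≠ |(n : ℝ)| / 2) (hδ : 0 ≤ δ) (hδ1 : δ ≤ 1) :
    ‖schrKernel (η - I) n s‖ ^ 4 ≤ 48 ^ 4 * (s * |s - |(n : ℝ)| / 2|) ^ (-(1 - δ)) := by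
  set X := s * |s - |(n : ℝ)| / 2| with hX
  have hXpos : 0 < X := mul_pos hs (abs_pos.2 (sub_ne_zero.2 hne))
  have hw4 : (X ^ (1 / 4 : ℝ)) ^ 4 = X := by
    rw [← Real.rpow_natCast, ← Real.rpow_mul hXpos.le]; norm_num
  rcases le_total X 1 with h | h
  · have h1 : ‖schrKernel (η - I) n s‖ ^ 4 ≤ 48 ^ 4 := by
      refine pow_le_pow_left₀ (norm_nonneg _) ((norm_schrKernel_le_two_pi hη hs.le).trans ?_) 4
      linarith [Real.pi_lt_four]
    refine h1.trans (le_mul_of_one_le_right (by positivity) ?_)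
    exact Real.one_le_rpow_of_pos_of_le_one_of_nonpos hXpos h (by linarith)
  · have h1 := pow_le_pow_left₀ (norm_nonneg _)
      (norm_schrKernel_le hη hs (Real.rpow_pos_of_pos hXpos _) (hw4.trans hX)) 4
    rw [div_pow, hw4] at h1
    refine h1.trans ?_
    rw [div_eq_mul_inv, ← Real.rpow_neg_one]
    gcongr
    linarith

/-- The time weight in the subordination formula. -/
noncomputable def timeWeight (t s : ℝ) : ℝ := (s ^ (1 / 2 : ℝ) + s ^ (3 / 2 : ℝ)) / (s ^ 2 + t ^ 2)

theorem timeWeight_nonneg {t s : ℝ} (hs : 0 ≤ s) : 0 ≤ timeWeight t s := by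
  unfold timeWeight; positivity

theorem continuous_schrKernel (κ : ℂ) (n : ℤ) : Continuous (schrKernel κ n) := by
  unfold schrKernel
  exact continuous_parametric_integral_of_continuous (by fun_prop) isCompact_Icc

theorem integral_indicator_rpow {r t : ℝ} (hr : -1 < r) (ht : 0 ≤ t) :
    Integrable ((Set.Ioc 0 t).indicator fun u : ℝ => u ^ r) ∧
      ∫ u, (Set.Ioc 0 t).indicator (fun u : ℝ => u ^ r) u = t ^ (r + 1) / (r + 1) := by
  have h := intervalIntegral.intervalIntegrable_rpow' (a := 0) (b := t) hr
  rw [intervalIntegrable_iff_integrableOn_Ioc_of_le ht] at h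
  refine ⟨(integrable_indicator_iff measurableSet_Ioc).2 h, ?_⟩
  rw [integral_indicator measurableSet_Ioc, ← intervalIntegral.integral_of_le ht,
    integral_rpow (Or.inl hr), Real.zero_rpow (by linarith), sub_zero]

theorem timeWeight_mul_le {η δ t s : ℝ} {n : ℤ} (hη : 0 ≤ η) (hδ : 0 < δ) (hδ1 : δ < 1 / 2)
    (ht : 1 ≤ t) (hs : 0 < s) (hne : s ≠ |(n : ℝ)| / 2) :
    timeWeight t s * ‖schrKernel (η - I) n s‖ ^ 4 ≤
      2 * 48 ^ 4 * (t ^ (-2 : ℝ) * (Set.Ioc (0 : ℝ) 1).indicator (fun u => u ^ (0 : ℝ)) s +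
        t ^ (-(3 / 2) + δ) * ((Set.Ioc 0 t).indicator (fun u => u ^ (-(1 - δ))) (s - |(n : ℝ)| / 2) +
          (Set.Ioc 0 t).indicator (fun u => u ^ (-(1 - δ))) (|(n : ℝ)| / 2 - s)) +
        t ^ (-(1 - δ)) * (t ^ (-(3 / 2) + δ) * (Set.Ioc 0 t).indicator (fun u => u ^ (0 : ℝ)) s +
          (Set.Ioi t).indicator (fun u => u ^ (-(3 / 2) + δ)) s)) := by
  have ht0 : 0 < t := by linarith
  set ν := |(n : ℝ)| / 2
  have g1 : ∀ (r : ℝ) (a b u : ℝ), 0 ≤ a → 0 ≤ (Set.Ioc a b).indicator (fun u => u ^ r) u :=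
    fun r a b u ha => Set.indicator_nonneg (fun x hx => Real.rpow_nonneg (ha.trans hx.1.le) _) _
  have g2 : ∀ (r u : ℝ), 0 ≤ (Set.Ioi t).indicator (fun u => u ^ r) u :=
    fun r u => Set.indicator_nonneg (fun x hx => Real.rpow_nonneg (ht0.trans hx).le _) _
  have n1 := g1 0 0 1 s le_rfl
  have n2 := g1 (-(1 - δ)) 0 t (s - ν) le_rfl
  have n3 := g1 (-(1 - δ)) 0 t (ν - s) le_rfl
  have n4 := g1 0 0 t s le_rfl
  have n5 := g2 (-(3 / 2) + δ) s
  have p1 : 0 < t ^ (-(3 / 2) + δ) := by positivity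
  have p2 : 0 < t ^ (-(1 - δ)) := by positivity
  have p3 : 0 < t ^ (-2 : ℝ) := by positivity
  rcases le_or_gt s 1 with h | h
  · have e1 : timeWeight t s ≤ 2 * t ^ (-2 : ℝ) := by
      rw [timeWeight, div_le_iff₀ (by positivity), Real.rpow_neg ht0.le]
      have : s ^ (1 / 2 : ℝ) ≤ 1 := Real.rpow_le_one hs.le h (by norm_num)
      have : s ^ (3 / 2 : ℝ) ≤ 1 := Real.rpow_le_one hs.le h (by norm_num)
      have e : (t ^ (2 : ℝ))⁻¹ * t ^ 2 = 1 := by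
        rw [Real.rpow_two]; exact inv_mul_cancel₀ (by positivity)
      have : 0 ≤ (t ^ (2 : ℝ))⁻¹ * s ^ 2 := by positivity
      nlinarith
    have e2 : ‖schrKernel (η - I) n s‖ ^ 4 ≤ 48 ^ 4 := by
      refine pow_le_pow_left₀ (norm_nonneg _) ((norm_schrKernel_le_two_pi hη hs.le).trans ?_) 4
      linarith [Real.pi_lt_four]
    have e3 : (Set.Ioc (0 : ℝ) 1).indicator (fun u => u ^ (0 : ℝ)) s = 1 := by
      rw [Set.indicator_of_mem (show s ∈ Set.Ioc (0 : ℝ) 1 from ⟨hs, h⟩), Real.rpow_zero]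
    calc _ ≤ 2 * t ^ (-2 : ℝ) * 48 ^ 4 := by gcongr
      _ = 2 * 48 ^ 4 * (t ^ (-2 : ℝ) * 1 + 0 + 0) := by ring
      _ ≤ _ := by
        rw [e3]
        gcongr <;> positivity
  · set V := t ^ (-(3 / 2) + δ) * (Set.Ioc 0 t).indicator (fun u => u ^ (0 : ℝ)) s +
          (Set.Ioi t).indicator (fun u => u ^ (-(3 / 2) + δ)) s with hV
    have hsub : 0 < |s - ν| := abs_pos.2 (sub_ne_zero.2 hne)
    have e1 : timeWeight t s ≤ 2 * (s ^ (3 / 2 : ℝ) / (s ^ 2 + t ^ 2)) := by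
      rw [timeWeight, mul_div_assoc']
      gcongr
      have : s ^ (1 / 2 : ℝ) ≤ s ^ (3 / 2 : ℝ) :=
        Real.rpow_le_rpow_of_exponent_le h.le (by norm_num)
      linarith
    have e2 := norm_schrKernel_pow_four_le (η := η) (n := n) hη hs hne hδ.le (by linarith)
    rw [Real.mul_rpow hs.le hsub.le] at e2
    have e3 : s ^ (3 / 2 : ℝ) / (s ^ 2 + t ^ 2) * s ^ (-(1 - δ)) ≤ V := by
      have e : s ^ (3 / 2 : ℝ) / (s ^ 2 + t ^ 2) * s ^ (-(1 - δ)) =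
          s ^ (1 / 2 + δ) / (s ^ 2 + t ^ 2) := by
        rw [div_mul_eq_mul_div, ← Real.rpow_add hs]; ring_nf
      rw [e, div_le_iff₀ (by positivity)]
      rcases le_or_gt s t with hst | hst
      · rw [hV, Set.indicator_of_mem (show s ∈ Set.Ioc 0 t from ⟨hs, hst⟩), Set.indicator_of_notMem (by simpa using hst),
          Real.rpow_zero, mul_one, add_zero]
        have : t ^ (-(3 / 2) + δ) * t ^ 2 = t ^ (1 / 2 + δ) := by
          rw [← Real.rpow_two, ← Real.rpow_add ht0]; ring_nf
        have h3 : s ^ (1 / 2 + δ) ≤ t ^ (1 / 2 + δ) := by gcongr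
        have : 0 ≤ t ^ (-(3 / 2) + δ) * s ^ 2 := by positivity
        nlinarith
      · rw [hV, Set.indicator_of_notMem (by simp [hst]), Set.indicator_of_mem (by simpa using hst),
          mul_zero, zero_add]
        have : s ^ (-(3 / 2) + δ) * s ^ 2 = s ^ (1 / 2 + δ) := by
          rw [← Real.rpow_two, ← Real.rpow_add hs]; ring_nf
        have : 0 ≤ s ^ (-(3 / 2) + δ) * t ^ 2 := by positivity
        nlinarith
    have e4 : V ≤ t ^ (-(3 / 2) + δ) := by
      rcases le_or_gt s t with hst | hst
      · rw [hV, Set.indicator_of_mem (show s ∈ Set.Ioc 0 t from ⟨hs, hst⟩), Set.indicator_of_notMem (by simpa using hst),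
          Real.rpow_zero, mul_one, add_zero]
      · rw [hV, Set.indicator_of_notMem (by simp [hst]), Set.indicator_of_mem (by simpa using hst),
          mul_zero, zero_add]
        exact Real.rpow_le_rpow_of_nonpos ht0 hst.le (by linarith)
    have hVn : 0 ≤ V := by positivity
    have e5 : V * |s - ν| ^ (-(1 - δ)) ≤ t ^ (-(3 / 2) + δ) *
        ((Set.Ioc 0 t).indicator (fun u => u ^ (-(1 - δ))) (s - ν) +
          (Set.Ioc 0 t).indicator (fun u => u ^ (-(1 - δ))) (ν - s)) + t ^ (-(1 - δ)) * V := by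
      rcases le_or_gt |s - ν| t with hst | hst
      · have : |s - ν| ^ (-(1 - δ)) ≤
            (Set.Ioc 0 t).indicator (fun u => u ^ (-(1 - δ))) (s - ν) +
          (Set.Ioc 0 t).indicator (fun u => u ^ (-(1 - δ))) (ν - s) := by
          rcases abs_cases (s - ν) with ⟨e, hy⟩ | ⟨e, hy⟩ <;> rw [e] at hst hsub ⊢
          · rw [Set.indicator_of_mem (show s - ν ∈ Set.Ioc 0 t from ⟨hsub, hst⟩)]
            linarith
          · rw [neg_sub] at hst hsub ⊢
            rw [Set.indicator_of_mem (show ν - s ∈ Set.Ioc 0 t from ⟨hsub, hst⟩)]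
            linarith
        refine le_add_of_le_of_nonneg ?_ (by positivity)
        gcongr
      · refine le_add_of_nonneg_of_le (by positivity) ?_
        rw [mul_comm]
        gcongr ?_ * _
        exact Real.rpow_le_rpow_of_nonpos ht0 hst.le (by linarith)
    calc _ ≤ 2 * (s ^ (3 / 2 : ℝ) / (s ^ 2 + t ^ 2)) *
          (48 ^ 4 * (s ^ (-(1 - δ)) * |s - ν| ^ (-(1 - δ)))) := by gcongr
      _ = 2 * 48 ^ 4 * ((s ^ (3 / 2 : ℝ) / (s ^ 2 + t ^ 2) * s ^ (-(1 - δ))) *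
          |s - ν| ^ (-(1 - δ))) := by ring
      _ ≤ 2 * 48 ^ 4 * (V * |s - ν| ^ (-(1 - δ))) := by gcongr
      _ ≤ _ := by
        gcongr
        refine e5.trans ?_
        have : 0 ≤ t ^ (-2 : ℝ) * (Set.Ioc (0 : ℝ) 1).indicator (fun u => u ^ (0 : ℝ)) s := by
          positivity
        linarith

/-- The weighted fourth moment of the kernel in time is `O(t^{-3/2+2δ})`, uniformly in the
lattice point and the damping. -/
theorem integral_timeWeight_mul_le {η δ t : ℝ} (hη : 0 ≤ η) (hδ : 0 < δ) (hδ1 : δ < 1 / 2)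
    (ht : 1 ≤ t) (n : ℤ) :
    IntegrableOn (fun s => timeWeight t s * ‖schrKernel (η - I) n s‖ ^ 4) (Set.Ioi 0) ∧
    ∫ s in Set.Ioi 0, timeWeight t s * ‖schrKernel (η - I) n s‖ ^ 4 ≤
      2 * 48 ^ 4 * (2 + 2 / δ + 1 / (1 / 2 - δ)) * t ^ (-(3 / 2) + 2 * δ) := by
  have ht0 : 0 < t := by linarith
  set ν := |(n : ℝ)| / 2 with hν
  obtain ⟨i1, v1⟩ := integral_indicator_rpow (r := 0) (t := 1) (by norm_num) zero_le_one
  obtain ⟨i2, v2⟩ := integral_indicator_rpow (r := -(1 - δ)) (t := t) (by linarith) ht0.le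
  obtain ⟨i3, v3⟩ := integral_indicator_rpow (r := 0) (t := t) (by norm_num) ht0.le
  have i4 : Integrable ((Set.Ioi t).indicator fun u : ℝ => u ^ (-(3 / 2) + δ)) :=
    (integrable_indicator_iff measurableSet_Ioi).2 (integrableOn_Ioi_rpow_of_lt (by linarith) ht0)
  have v4 : ∫ u, (Set.Ioi t).indicator (fun u : ℝ => u ^ (-(3 / 2) + δ)) u =
      t ^ (-(1 / 2) + δ) / (1 / 2 - δ) := by
    rw [integral_indicator measurableSet_Ioi, integral_Ioi_rpow_of_lt (by linarith) ht0,
      show -(3 / 2) + δ + 1 = -(1 / 2 - δ) by ring, div_neg, neg_div, neg_neg]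
    ring_nf
  set D : ℝ → ℝ := fun s => 2 * 48 ^ 4 *
    (t ^ (-2 : ℝ) * (Set.Ioc (0 : ℝ) 1).indicator (fun u => u ^ (0 : ℝ)) s +
        t ^ (-(3 / 2) + δ) * ((Set.Ioc 0 t).indicator (fun u => u ^ (-(1 - δ))) (s - ν) +
          (Set.Ioc 0 t).indicator (fun u => u ^ (-(1 - δ))) (ν - s)) +
        t ^ (-(1 - δ)) * (t ^ (-(3 / 2) + δ) * (Set.Ioc 0 t).indicator (fun u => u ^ (0 : ℝ)) s +
          (Set.Ioi t).indicator (fun u => u ^ (-(3 / 2) + δ)) s)) with hD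
  have i2s : Integrable fun s => (Set.Ioc 0 t).indicator (fun u : ℝ => u ^ (-(1 - δ))) (s - ν) :=
    i2.comp_sub_right ν
  have i2r : Integrable fun s => (Set.Ioc 0 t).indicator (fun u : ℝ => u ^ (-(1 - δ))) (ν - s) :=
    i2.comp_sub_left ν
  have i3c : Integrable fun s => t ^ (-(3 / 2) + δ) *
      (Set.Ioc 0 t).indicator (fun u : ℝ => u ^ (0 : ℝ)) s := i3.const_mul _
  have j1 : Integrable fun s => t ^ (-2 : ℝ) *
      (Set.Ioc (0 : ℝ) 1).indicator (fun u : ℝ => u ^ (0 : ℝ)) s := i1.const_mul _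
  have j2 : Integrable fun s => t ^ (-(3 / 2) + δ) *
      ((Set.Ioc 0 t).indicator (fun u => u ^ (-(1 - δ))) (s - ν) +
        (Set.Ioc 0 t).indicator (fun u => u ^ (-(1 - δ))) (ν - s)) := (i2s.add i2r).const_mul _
  have j3 : Integrable fun s => t ^ (-(1 - δ)) * (t ^ (-(3 / 2) + δ) *
      (Set.Ioc 0 t).indicator (fun u => u ^ (0 : ℝ)) s +
        (Set.Ioi t).indicator (fun u => u ^ (-(3 / 2) + δ)) s) := (i3c.add i4).const_mul _
  have j12 : Integrable fun s => t ^ (-2 : ℝ) *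
      (Set.Ioc (0 : ℝ) 1).indicator (fun u : ℝ => u ^ (0 : ℝ)) s +
      t ^ (-(3 / 2) + δ) *
      ((Set.Ioc 0 t).indicator (fun u => u ^ (-(1 - δ))) (s - ν) +
        (Set.Ioc 0 t).indicator (fun u => u ^ (-(1 - δ))) (ν - s)) := j1.add j2
  have hDi : Integrable D := (j12.add j3).const_mul _
  have hDv : ∫ s, D s = 2 * 48 ^ 4 * (t ^ (-2 : ℝ) * 1 +
      t ^ (-(3 / 2) + δ) * (t ^ δ / δ + t ^ δ / δ) + t ^ (-(1 - δ)) *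
        (t ^ (-(3 / 2) + δ) * t + t ^ (-(1 / 2) + δ) / (1 / 2 - δ))) := by
    rw [hD, integral_const_mul, integral_add j12 j3, integral_add j1 j2,
      integral_const_mul, integral_const_mul, integral_const_mul,
      integral_add i2s i2r, integral_add i3c i4, integral_const_mul,
      integral_sub_right_eq_self (fun s => (Set.Ioc 0 t).indicator (fun u => u ^ (-(1 - δ))) s),
      integral_sub_left_eq_self (fun s => (Set.Ioc 0 t).indicator (fun u => u ^ (-(1 - δ))) s),
      v1, v2, v3, v4]
    simp
  have hae : ∀ᵐ s ∂volume.restrict (Set.Ioi (0 : ℝ)),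
      timeWeight t s * ‖schrKernel (η - I) n s‖ ^ 4 ≤ D s := by
    have h1 : ∀ᵐ s ∂volume.restrict (Set.Ioi (0 : ℝ)), s ≠ ν :=
      ae_restrict_of_ae (Measure.ae_ne volume ν)
    filter_upwards [h1, ae_restrict_mem measurableSet_Ioi] with s hs1 hs2
    exact timeWeight_mul_le hη hδ hδ1 ht hs2 hs1
  have hD0 : 0 ≤ᵐ[volume] D := by
    refine Filter.Eventually.of_forall fun s => ?_
    have g1 : ∀ (r : ℝ) (b u : ℝ), 0 ≤ (Set.Ioc 0 b).indicator (fun u => u ^ r) u :=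
      fun r b u => Set.indicator_nonneg (fun x hx => Real.rpow_nonneg hx.1.le _) _
    have g2 : ∀ (r u : ℝ), 0 ≤ (Set.Ioi t).indicator (fun u => u ^ r) u :=
      fun r u => Set.indicator_nonneg (fun x hx => Real.rpow_nonneg (ht0.trans hx).le _) _
    have := g1 0 1 s
    have := g1 (-(1 - δ)) t (s - ν)
    have := g1 (-(1 - δ)) t (ν - s)
    have := g1 0 t s
    have := g2 (-(3 / 2) + δ) s
    simp only [hD, Pi.zero_apply]
    positivity
  have h_int : IntegrableOn (fun s => timeWeight t s * ‖schrKernel (η - I) n s‖ ^ 4)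
      (Set.Ioi 0) := by
    refine hDi.integrableOn.mono' ?_ ?_
    · refine AEStronglyMeasurable.mul ?_
        ((continuous_schrKernel _ n).norm.pow 4).aestronglyMeasurable
      unfold timeWeight
      exact Measurable.aestronglyMeasurable (by fun_prop)
    · filter_upwards [hae, ae_restrict_mem measurableSet_Ioi] with s hs1 hs2
      rwa [Real.norm_of_nonneg
        (mul_nonneg (timeWeight_nonneg (le_of_lt hs2)) (by positivity))]
  refine ⟨h_int, ?_⟩
  calc _ ≤ ∫ s in Set.Ioi 0, D s := integral_mono_ae h_int hDi.integrableOn hae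
    _ ≤ ∫ s, D s := setIntegral_le_integral hDi hD0
    _ ≤ _ := by
      rw [hDv, mul_assoc (2 * 48 ^ 4)]
      refine mul_le_mul_of_nonneg_left ?_ (by norm_num)
      have q1 : t ^ (-2 : ℝ) ≤ t ^ (-(3 / 2) + 2 * δ) :=
        Real.rpow_le_rpow_of_exponent_le ht (by linarith)
      have q2 : t ^ (-(3 / 2) + δ) * t ^ δ = t ^ (-(3 / 2) + 2 * δ) := by
        rw [← Real.rpow_add ht0]; ring_nf
      have q3 : t ^ (-(1 - δ)) * (t ^ (-(3 / 2) + δ) * t) = t ^ (-(3 / 2) + 2 * δ) := by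
        nth_rw 3 [← Real.rpow_one t]
        rw [← Real.rpow_add ht0, ← Real.rpow_add ht0]; ring_nf
      have q4 : t ^ (-(1 - δ)) * t ^ (-(1 / 2) + δ) = t ^ (-(3 / 2) + 2 * δ) := by
        rw [← Real.rpow_add ht0]; ring_nf
      have : t ^ (-2 : ℝ) * 1 +
          t ^ (-(3 / 2) + δ) * (t ^ δ / δ + t ^ δ / δ) + t ^ (-(1 - δ)) *
          (t ^ (-(3 / 2) + δ) * t + t ^ (-(1 / 2) + δ) / (1 / 2 - δ)) =
          t ^ (-2 : ℝ) + 2 / δ * (t ^ (-(3 / 2) + δ) * t ^ δ) +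
          t ^ (-(1 - δ)) * (t ^ (-(3 / 2) + δ) * t) +
          1 / (1 / 2 - δ) * (t ^ (-(1 - δ)) * t ^ (-(1 / 2) + δ)) := by ring
      rw [this, q2, q3, q4]
      nlinarith

theorem hasDerivAt_schrKernel (κ : ℂ) (n : ℤ) (s : ℝ) :
    HasDerivAt (schrKernel κ n)
      (-κ * (2 * schrKernel κ n s - schrKernel κ (n + 1) s - schrKernel κ (n - 1) s)) s := by
  have hc : ∀ m : ℤ, IntegrableOn (fun θ : ℝ => cexp (I * (m * θ : ℝ)) *
      cexp (-(κ * s * (2 - 2 * Real.cos θ : ℝ)))) (Set.Icc (-Real.pi) Real.pi) := fun m =>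
    Continuous.integrableOn_Icc (by fun_prop)
  have h := (hasDerivAt_integral_of_dominated_loc_of_deriv_le (𝕜 := ℝ)
    (μ := volume.restrict (Set.Icc (-Real.pi) Real.pi))
    (F := fun (s : ℝ) (θ : ℝ) => cexp (I * (n * θ : ℝ)) *
      cexp (-(κ * s * (2 - 2 * Real.cos θ : ℝ))))
    (F' := fun (s : ℝ) (θ : ℝ) => cexp (I * (n * θ : ℝ)) *
      (cexp (-(κ * s * (2 - 2 * Real.cos θ : ℝ))) * (-(κ * (2 - 2 * Real.cos θ : ℝ)))))
    (x₀ := s) (s := Metric.ball s 1)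
    (bound := fun _ => Real.exp (‖κ‖ * (|s| + 1) * 4) * (‖κ‖ * 4))
    (Metric.ball_mem_nhds s one_pos)
    (Filter.Eventually.of_forall fun u => Continuous.aestronglyMeasurable (by fun_prop))
    (hc n) (Continuous.aestronglyMeasurable (by fun_prop)) ?_ (integrable_const _) ?_).2
  · refine h.congr_deriv ?_
    have e : ∀ θ : ℝ, cexp (I * (n * θ : ℝ)) *
      (cexp (-(κ * s * (2 - 2 * Real.cos θ : ℝ))) * (-(κ * (2 - 2 * Real.cos θ : ℝ)))) =
      -κ * (2 * (cexp (I * (n * θ : ℝ)) * cexp (-(κ * s * (2 - 2 * Real.cos θ : ℝ)))) -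
        cexp (I * ((n + 1 : ℤ) * θ : ℝ)) * cexp (-(κ * s * (2 - 2 * Real.cos θ : ℝ))) -
        cexp (I * ((n - 1 : ℤ) * θ : ℝ)) * cexp (-(κ * s * (2 - 2 * Real.cos θ : ℝ)))) := by
      intro θ
      have e1 : cexp (I * ((n + 1 : ℤ) * θ : ℝ)) = cexp (I * (n * θ : ℝ)) * cexp (θ * I) := by
        rw [← Complex.exp_add]; push_cast; ring_nf
      have e2 : cexp (I * ((n - 1 : ℤ) * θ : ℝ)) = cexp (I * (n * θ : ℝ)) * cexp (-θ * I) := by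
        rw [← Complex.exp_add]; push_cast; ring_nf
      have e3 := Complex.two_cos (θ : ℂ)
      rw [e1, e2]
      push_cast
      rw [e3]; ring
    rw [integral_congr_ae (Filter.Eventually.of_forall e)]
    have hc2 : IntegrableOn (fun θ : ℝ => 2 * (cexp (I * (n * θ : ℝ)) *
        cexp (-(κ * s * (2 - 2 * Real.cos θ : ℝ)))) - cexp (I * ((n + 1 : ℤ) * θ : ℝ)) *
        cexp (-(κ * s * (2 - 2 * Real.cos θ : ℝ)))) (Set.Icc (-Real.pi) Real.pi) :=
      ((hc n).const_mul 2).sub (hc (n + 1))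
    rw [integral_const_mul, integral_sub hc2 (hc (n - 1)),
      integral_sub ((hc n).const_mul 2) (hc (n + 1)), integral_const_mul]
    rfl
  · refine Filter.Eventually.of_forall fun θ u hu => ?_
    have h4 : |2 - 2 * Real.cos θ| ≤ 4 := by
      rw [abs_le]; constructor <;> linarith [Real.cos_le_one θ, Real.neg_one_le_cos θ]
    have hu' : |u| ≤ |s| + 1 := by
      rw [Metric.mem_ball, Real.dist_eq] at hu
      have := abs_sub_abs_le_abs_sub u s
      linarith
    rw [norm_mul, norm_mul, mul_comm I, norm_exp_ofReal_mul_I, one_mul, norm_neg, norm_mul]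
    have : ‖cexp (-(κ * u * (2 - 2 * Real.cos θ : ℝ)))‖ ≤ Real.exp (‖κ‖ * (|s| + 1) * 4) := by
      refine (norm_exp_le_exp_norm _).trans (Real.exp_le_exp.2 ?_)
      rw [norm_neg, norm_mul, norm_mul, norm_real, norm_real, Real.norm_eq_abs, Real.norm_eq_abs]
      gcongr
    have h5 : ‖((2 - 2 * Real.cos θ : ℝ) : ℂ)‖ ≤ 4 := by rwa [norm_real, Real.norm_eq_abs]
    gcongr
  · refine Filter.Eventually.of_forall fun θ u hu => ?_
    have h1 : HasDerivAt (fun u : ℝ => -(κ * u * (2 - 2 * Real.cos θ : ℝ)))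
        (-(κ * (2 - 2 * Real.cos θ : ℝ))) u := by
      have := (((hasDerivAt_id u).ofReal_comp.const_mul κ).mul_const
        ((2 - 2 * Real.cos θ : ℝ) : ℂ)).neg
      exact this.congr_deriv (by simp)
    exact (h1.cexp).const_mul _

theorem norm_prod_four_le (a : Fin 4 → ℂ) : ‖∏ j, a j‖ ≤ (∑ j, ‖a j‖ ^ 4) / 4 := by
  rw [norm_prod]
  simp only [Fin.prod_univ_four, Fin.sum_univ_four]
  have h1 := sq_nonneg (‖a 0‖ * ‖a 1‖ - ‖a 2‖ * ‖a 3‖)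
  have h2 := sq_nonneg (‖a 0‖ ^ 2 - ‖a 1‖ ^ 2)
  have h3 := sq_nonneg (‖a 2‖ ^ 2 - ‖a 3‖ ^ 2)
  nlinarith

theorem integral_timeWeight_prod_le {t B : ℝ} {F : Fin 4 → ℝ → ℂ} (hF : ∀ j, Continuous (F j))
    (h : ∀ j, IntegrableOn (fun s => timeWeight t s * ‖F j s‖ ^ 4) (Set.Ioi 0) ∧
      ∫ s in Set.Ioi 0, timeWeight t s * ‖F j s‖ ^ 4 ≤ B) :
    IntegrableOn (fun s => timeWeight t s * ‖∏ j, F j s‖) (Set.Ioi 0) ∧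
      ∫ s in Set.Ioi 0, timeWeight t s * ‖∏ j, F j s‖ ≤ B := by
  have hD : IntegrableOn (fun s => ∑ j, timeWeight t s * ‖F j s‖ ^ 4) (Set.Ioi 0) :=
    integrable_finsetSum _ fun j _ => (h j).1
  have hD4 : IntegrableOn (fun s => (∑ j, timeWeight t s * ‖F j s‖ ^ 4) / 4) (Set.Ioi 0) :=
    Integrable.div_const hD 4
  have hle : ∀ s ∈ Set.Ioi (0 : ℝ), timeWeight t s * ‖∏ j, F j s‖ ≤
      (∑ j, timeWeight t s * ‖F j s‖ ^ 4) / 4 := by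
    intro s hs
    rw [← Finset.mul_sum, mul_div_assoc]
    exact mul_le_mul_of_nonneg_left (norm_prod_four_le fun j => F j s)
      (timeWeight_nonneg (le_of_lt hs))
  have h_int : IntegrableOn (fun s => timeWeight t s * ‖∏ j, F j s‖) (Set.Ioi 0) := by
    refine hD4.mono' ?_ ?_
    · refine AEStronglyMeasurable.mul ?_
        (continuous_finsetProd _ fun j _ => hF j).norm.aestronglyMeasurable
      unfold timeWeight
      exact Measurable.aestronglyMeasurable (by fun_prop)
    · filter_upwards [ae_restrict_mem measurableSet_Ioi] with s hs
      rw [Real.norm_of_nonneg (mul_nonneg (timeWeight_nonneg (le_of_lt hs)) (norm_nonneg _))]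
      exact hle s hs
  refine ⟨h_int, (setIntegral_mono_on h_int hD4 measurableSet_Ioi hle).trans ?_⟩
  rw [integral_div, integral_finsetSum _ fun j _ => (h j).1, Fin.sum_univ_four]
  linarith [(h 0).2, (h 1).2, (h 2).2, (h 3).2]

/-- The time derivative of `schrKernel`. -/
noncomputable def schrKernelDeriv (κ : ℂ) (n : ℤ) (s : ℝ) : ℂ :=
  -κ * (2 * schrKernel κ n s - schrKernel κ (n + 1) s - schrKernel κ (n - 1) s)

theorem continuous_schrKernelDeriv (κ : ℂ) (n : ℤ) : Continuous (schrKernelDeriv κ n) := by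
  unfold schrKernelDeriv
  have := continuous_schrKernel κ n
  have := continuous_schrKernel κ (n + 1)
  have := continuous_schrKernel κ (n - 1)
  fun_prop

theorem norm_schrKernelDeriv_pow_four_le {κ : ℂ} (hκ : ‖κ‖ ≤ 2) (n : ℤ) (s : ℝ) :
    ‖schrKernelDeriv κ n s‖ ^ 4 ≤ 1024 * (2 * ‖schrKernel κ n s‖ ^ 4 +
      ‖schrKernel κ (n + 1) s‖ ^ 4 + ‖schrKernel κ (n - 1) s‖ ^ 4) := by
  set a := schrKernel κ n s
  set b := schrKernel κ (n + 1) s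
  set c := schrKernel κ (n - 1) s
  have h1 : ‖schrKernelDeriv κ n s‖ ≤ 2 * (2 * ‖a‖ + ‖b‖ + ‖c‖) := by
    rw [schrKernelDeriv, norm_mul, norm_neg]
    gcongr
    refine (norm_sub_le _ _).trans ?_
    gcongr
    refine (norm_sub_le _ _).trans ?_
    rw [norm_mul]; norm_num
    exact le_rfl
  have h2 : (2 * ‖a‖ + ‖b‖ + ‖c‖) ^ 2 ≤ 4 * (2 * ‖a‖ ^ 2 + ‖b‖ ^ 2 + ‖c‖ ^ 2) := by
    nlinarith [sq_nonneg (‖a‖ - ‖b‖), sq_nonneg (‖a‖ - ‖c‖), sq_nonneg (‖b‖ - ‖c‖)]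
  have h3 : (2 * ‖a‖ ^ 2 + ‖b‖ ^ 2 + ‖c‖ ^ 2) ^ 2 ≤ 4 * (2 * ‖a‖ ^ 4 + ‖b‖ ^ 4 + ‖c‖ ^ 4) := by
    nlinarith [sq_nonneg (‖a‖ ^ 2 - ‖b‖ ^ 2), sq_nonneg (‖a‖ ^ 2 - ‖c‖ ^ 2),
      sq_nonneg (‖b‖ ^ 2 - ‖c‖ ^ 2)]
  calc _ ≤ (2 * (2 * ‖a‖ + ‖b‖ + ‖c‖)) ^ 4 := by gcongr
    _ = 16 * ((2 * ‖a‖ + ‖b‖ + ‖c‖) ^ 2) ^ 2 := by ring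
    _ ≤ 16 * (4 * (2 * ‖a‖ ^ 2 + ‖b‖ ^ 2 + ‖c‖ ^ 2)) ^ 2 := by gcongr
    _ = 256 * (2 * ‖a‖ ^ 2 + ‖b‖ ^ 2 + ‖c‖ ^ 2) ^ 2 := by ring
    _ ≤ 256 * (4 * (2 * ‖a‖ ^ 4 + ‖b‖ ^ 4 + ‖c‖ ^ 4)) := by gcongr
    _ = _ := by ring

theorem integral_timeWeight_schrKernelDeriv_le {κ : ℂ} {t B : ℝ} (hκ : ‖κ‖ ≤ 2)
    (h : ∀ n, IntegrableOn (fun s => timeWeight t s * ‖schrKernel κ n s‖ ^ 4) (Set.Ioi 0) ∧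
      ∫ s in Set.Ioi 0, timeWeight t s * ‖schrKernel κ n s‖ ^ 4 ≤ B) (n : ℤ) :
    IntegrableOn (fun s => timeWeight t s * ‖schrKernelDeriv κ n s‖ ^ 4) (Set.Ioi 0) ∧
      ∫ s in Set.Ioi 0, timeWeight t s * ‖schrKernelDeriv κ n s‖ ^ 4 ≤ 4096 * B := by
  have i1 : IntegrableOn (fun s => 2 * (timeWeight t s * ‖schrKernel κ n s‖ ^ 4))
    (Set.Ioi 0) := (h n).1.const_mul 2
  have i2 : IntegrableOn (fun s => 2 * (timeWeight t s * ‖schrKernel κ n s‖ ^ 4) +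
    timeWeight t s * ‖schrKernel κ (n + 1) s‖ ^ 4) (Set.Ioi 0) := i1.add (h (n + 1)).1
  have i3 : IntegrableOn (fun s => 2 * (timeWeight t s * ‖schrKernel κ n s‖ ^ 4) +
    timeWeight t s * ‖schrKernel κ (n + 1) s‖ ^ 4 +
    timeWeight t s * ‖schrKernel κ (n - 1) s‖ ^ 4) (Set.Ioi 0) := i2.add (h (n - 1)).1
  have i4 := i3.const_mul 1024
  have hle : ∀ s ∈ Set.Ioi (0 : ℝ), timeWeight t s * ‖schrKernelDeriv κ n s‖ ^ 4 ≤
      1024 * (2 * (timeWeight t s * ‖schrKernel κ n s‖ ^ 4) +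
    timeWeight t s * ‖schrKernel κ (n + 1) s‖ ^ 4 +
    timeWeight t s * ‖schrKernel κ (n - 1) s‖ ^ 4) := by
    intro s hs
    refine (mul_le_mul_of_nonneg_left (norm_schrKernelDeriv_pow_four_le hκ n s)
      (timeWeight_nonneg (le_of_lt hs))).trans (le_of_eq (by ring))
  have h_int : IntegrableOn (fun s => timeWeight t s * ‖schrKernelDeriv κ n s‖ ^ 4)
      (Set.Ioi 0) := by
    refine i4.mono' ?_ ?_
    · refine AEStronglyMeasurable.mul ?_
        ((continuous_schrKernelDeriv κ n).norm.pow 4).aestronglyMeasurable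
      unfold timeWeight
      exact Measurable.aestronglyMeasurable (by fun_prop)
    · filter_upwards [ae_restrict_mem measurableSet_Ioi] with s hs
      rw [Real.norm_of_nonneg (mul_nonneg (timeWeight_nonneg (le_of_lt hs)) (by positivity))]
      exact hle s hs
  refine ⟨h_int, (setIntegral_mono_on h_int i4 measurableSet_Ioi hle).trans ?_⟩
  rw [integral_const_mul, integral_add i2 (h (n - 1)).1, integral_add i1 (h (n + 1)).1,
    integral_const_mul]
  linarith [(h n).2, (h (n + 1)).2, (h (n - 1)).2]

/-- The four-dimensional damped Schrödinger kernel. -/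
noncomputable def boxKernel (κ : ℂ) (x : Fin 4 → ℤ) (s : ℝ) : ℂ := ∏ j, schrKernel κ (x j) s

/-- The time derivative of `boxKernel`. -/
noncomputable def boxKernelDeriv (κ : ℂ) (x : Fin 4 → ℤ) (s : ℝ) : ℂ :=
  ∑ j, ∏ i, if i = j then schrKernelDeriv κ (x i) s else schrKernel κ (x i) s

theorem hasDerivAt_boxKernel (κ : ℂ) (x : Fin 4 → ℤ) (s : ℝ) :
    HasDerivAt (boxKernel κ x) (boxKernelDeriv κ x s) s := by
  have := HasDerivAt.fun_finsetProd (u := Finset.univ) (x := s)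
    (f := fun j => schrKernel κ (x j)) (f' := fun j => schrKernelDeriv κ (x j) s)
    fun j _ => hasDerivAt_schrKernel κ (x j) s
  refine this.congr_deriv (Eq.symm ?_)
  unfold boxKernelDeriv
  refine Finset.sum_congr rfl fun j _ => ?_
  rw [← Finset.mul_prod_erase Finset.univ _ (Finset.mem_univ j), smul_eq_mul, mul_comm, if_pos rfl]
  congr 1
  refine Finset.prod_congr rfl fun i hi => ?_
  rw [if_neg (Finset.ne_of_mem_erase hi)]

theorem integral_timeWeight_boxKernel_le {κ : ℂ} {t B : ℝ}
    (h : ∀ n, IntegrableOn (fun s => timeWeight t s * ‖schrKernel κ n s‖ ^ 4) (Set.Ioi 0) ∧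
      ∫ s in Set.Ioi 0, timeWeight t s * ‖schrKernel κ n s‖ ^ 4 ≤ B) (x : Fin 4 → ℤ) :
    IntegrableOn (fun s => timeWeight t s * ‖boxKernel κ x s‖) (Set.Ioi 0) ∧
      ∫ s in Set.Ioi 0, timeWeight t s * ‖boxKernel κ x s‖ ≤ B :=
  integral_timeWeight_prod_le (fun j => continuous_schrKernel κ (x j)) fun j => h (x j)

theorem integral_timeWeight_boxKernelDeriv_le {κ : ℂ} {t B : ℝ} (hκ : ‖κ‖ ≤ 2)
    (h : ∀ n, IntegrableOn (fun s => timeWeight t s * ‖schrKernel κ n s‖ ^ 4) (Set.Ioi 0) ∧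
      ∫ s in Set.Ioi 0, timeWeight t s * ‖schrKernel κ n s‖ ^ 4 ≤ B) (hB : 0 ≤ B)
    (x : Fin 4 → ℤ) :
    IntegrableOn (fun s => timeWeight t s * ‖boxKernelDeriv κ x s‖) (Set.Ioi 0) ∧
      ∫ s in Set.Ioi 0, timeWeight t s * ‖boxKernelDeriv κ x s‖ ≤ 16384 * B := by
  have hc : ∀ j i, Continuous fun s =>
      if i = j then schrKernelDeriv κ (x i) s else schrKernel κ (x i) s := by
    intro j i
    split_ifs
    exacts [continuous_schrKernelDeriv _ _, continuous_schrKernel _ _]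
  have key := fun j : Fin 4 => integral_timeWeight_prod_le (t := t) (B := 4096 * B)
    (F := fun i s => if i = j then schrKernelDeriv κ (x i) s else schrKernel κ (x i) s)
    (hc j) (by
      intro i
      split_ifs
      · exact integral_timeWeight_schrKernelDeriv_le hκ h (x i)
      · exact ⟨(h (x i)).1, (h (x i)).2.trans (by linarith)⟩)
  have hD : IntegrableOn (fun s => ∑ j, timeWeight t s *
      ‖∏ i, if i = j then schrKernelDeriv κ (x i) s else schrKernel κ (x i) s‖) (Set.Ioi 0) :=
    integrable_finsetSum _ fun j _ => (key j).1
  have hle : ∀ s ∈ Set.Ioi (0 : ℝ), timeWeight t s * ‖boxKernelDeriv κ x s‖ ≤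
      ∑ j, timeWeight t s *
      ‖∏ i, if i = j then schrKernelDeriv κ (x i) s else schrKernel κ (x i) s‖ := by
    intro s hs
    rw [← Finset.mul_sum]
    exact mul_le_mul_of_nonneg_left (norm_sum_le _ _) (timeWeight_nonneg (le_of_lt hs))
  have h_int : IntegrableOn (fun s => timeWeight t s * ‖boxKernelDeriv κ x s‖) (Set.Ioi 0) := by
    refine hD.mono' ?_ ?_
    · refine AEStronglyMeasurable.mul ?_ (Continuous.aestronglyMeasurable ?_)
      · unfold timeWeight
        exact Measurable.aestronglyMeasurable (by fun_prop)
      · exact (continuous_finsetSum _ fun j _ => continuous_finsetProd _ fun i _ => hc j i).norm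
    · filter_upwards [ae_restrict_mem measurableSet_Ioi] with s hs
      rw [Real.norm_of_nonneg (mul_nonneg (timeWeight_nonneg (le_of_lt hs)) (norm_nonneg _))]
      exact hle s hs
  refine ⟨h_int, (setIntegral_mono_on h_int hD measurableSet_Ioi hle).trans ?_⟩
  rw [integral_finsetSum _ fun j _ => (key j).1, Fin.sum_univ_four]
  linarith [(key 0).2, (key 1).2, (key 2).2, (key 3).2]

theorem one_le_norm_ofReal_sub_I (η : ℝ) : 1 ≤ ‖(η - I : ℂ)‖ := by
  have := abs_im_le_norm (η - I : ℂ)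
  simpa using this

theorem norm_ofReal_sub_I_le {η : ℝ} (hη : 0 ≤ η) (hη1 : η ≤ 1) : ‖(η - I : ℂ)‖ ≤ 2 := by
  refine (norm_sub_le _ _).trans ?_
  rw [norm_real, Real.norm_of_nonneg hη, norm_I]
  linarith

theorem norm_boxKernel_le {η s : ℝ} (hη : 0 ≤ η) (hs : 0 ≤ s) (x : Fin 4 → ℤ) :
    ‖boxKernel (η - I) x s‖ ≤ (2 * Real.pi) ^ 4 := by
  rw [boxKernel, norm_prod]
  refine (Finset.prod_le_prod (fun _ _ => norm_nonneg _)
    fun j _ => norm_schrKernel_le_two_pi hη hs).trans ?_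
  simp

theorem norm_cexp_neg_div_le {η a s : ℝ} (hη : 0 ≤ η) (ha : 0 ≤ a) (hs : 0 ≤ s) :
    ‖cexp (-((η - I) * a / s))‖ ≤ 1 := by
  have : (-((η - I) * a / s) : ℂ) = ((-(η * a / s) : ℝ) : ℂ) + ((a / s : ℝ) : ℂ) * I := by
    push_cast; ring
  rw [this, Complex.exp_add, norm_mul, norm_exp_ofReal_mul_I, mul_one, norm_exp, ofReal_re,
    Real.exp_le_one_iff, neg_nonpos]
  positivity

theorem hasDerivAt_rpow_div {t s : ℝ} (hs : 0 < s) :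
    HasDerivAt (fun s : ℝ => s ^ (3 / 2 : ℝ) / (s ^ 2 + t ^ 2))
      ((3 / 2 * s ^ (1 / 2 : ℝ) * (s ^ 2 + t ^ 2) - s ^ (3 / 2 : ℝ) * (2 * s)) /
        (s ^ 2 + t ^ 2) ^ 2) s := by
  have h1 : HasDerivAt (fun s : ℝ => s ^ (3 / 2 : ℝ)) (3 / 2 * s ^ (1 / 2 : ℝ)) s := by
    have := Real.hasDerivAt_rpow_const (x := s) (p := 3 / 2) (Or.inl hs.ne')
    norm_num at this ⊢
    exact this
  have h2 : HasDerivAt (fun s : ℝ => s ^ 2 + t ^ 2) (2 * s) s := by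
    simpa using (hasDerivAt_pow 2 s).add_const (t ^ 2)
  exact h1.div h2 (by positivity)

theorem abs_deriv_rpow_div_le {t s : ℝ} (hs : 0 < s) :
    |(3 / 2 * s ^ (1 / 2 : ℝ) * (s ^ 2 + t ^ 2) - s ^ (3 / 2 : ℝ) * (2 * s)) /
        (s ^ 2 + t ^ 2) ^ 2| ≤ 2 * timeWeight t s := by
  have e : s ^ (3 / 2 : ℝ) = s ^ (1 / 2 : ℝ) * s := by
    nth_rw 3 [← Real.rpow_one s]
    rw [← Real.rpow_add hs]; norm_num
  have h0 : 0 < s ^ (1 / 2 : ℝ) := by positivity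
  have h1 : 0 < s ^ 2 + t ^ 2 := by positivity
  rw [timeWeight, e, abs_div, abs_of_pos (pow_pos h1 2), div_le_iff₀ (by positivity)]
  have e2 : 2 * ((s ^ (1 / 2 : ℝ) + s ^ (1 / 2 : ℝ) * s) / (s ^ 2 + t ^ 2)) * (s ^ 2 + t ^ 2) ^ 2
      = s ^ (1 / 2 : ℝ) * (2 * (1 + s) * (s ^ 2 + t ^ 2)) := by field_simp
  have e3 : 3 / 2 * s ^ (1 / 2 : ℝ) * (s ^ 2 + t ^ 2) - s ^ (1 / 2 : ℝ) * s * (2 * s) =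
      s ^ (1 / 2 : ℝ) * (3 / 2 * t ^ 2 - s ^ 2 / 2) := by ring
  rw [e2, e3, abs_mul, abs_of_pos h0]
  gcongr
  rw [abs_le]
  constructor <;> nlinarith [sq_nonneg t, sq_nonneg s, mul_pos hs h1]

theorem norm_integral_subordination_le {η t B : ℝ} (hη : 0 ≤ η) (hη1 : η ≤ 1) (ht : 1 ≤ t)
    (hB : 0 ≤ B) (h : ∀ n, IntegrableOn (fun s => timeWeight t s * ‖schrKernel (η - I) n s‖ ^ 4)
      (Set.Ioi 0) ∧ ∫ s in Set.Ioi 0, timeWeight t s * ‖schrKernel (η - I) n s‖ ^ 4 ≤ B)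
    (x : Fin 4 → ℤ)
    (h_int : IntegrableOn (fun s : ℝ => ((s ^ (-(1 / 2) : ℝ) : ℝ) : ℂ) *
      cexp (-((η - I) * (t ^ 2 / 4 : ℝ) / s)) * boxKernel (η - I) x s) (Set.Ioi 0)) :
    ‖∫ s in Set.Ioi (0 : ℝ), ((s ^ (-(1 / 2) : ℝ) : ℝ) : ℂ) *
      cexp (-((η - I) * (t ^ 2 / 4 : ℝ) / s)) * boxKernel (η - I) x s‖ ≤ 70000 * B := by
  set κ : ℂ := η - I with hκ
  have hκ1 : 1 ≤ ‖κ‖ := one_le_norm_ofReal_sub_I η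
  have hκ2 : ‖κ‖ ≤ 2 := norm_ofReal_sub_I_le hη hη1
  have hκ0 : κ ≠ 0 := norm_pos_iff.1 (by linarith)
  have ht0 : 0 < t := by linarith
  obtain ⟨iA, bA⟩ := integral_timeWeight_boxKernel_le h x
  obtain ⟨iA', bA'⟩ := integral_timeWeight_boxKernelDeriv_le hκ2 h hB x
  set A := boxKernel κ x with hA
  set A' := boxKernelDeriv κ x with hA'
  have cA : Continuous A :=
    continuous_iff_continuousAt.2 fun s => (hasDerivAt_boxKernel κ x s).continuousAt
  have cA' : Continuous A' := by
    refine continuous_finsetSum _ fun j _ => continuous_finsetProd _ fun i _ => ?_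
    split_ifs
    exacts [continuous_schrKernelDeriv _ _, continuous_schrKernel _ _]
  set E : ℝ → ℂ := fun s => cexp (-(κ * (t ^ 2 / 4 : ℝ) / s)) with hE
  have mE : Measurable E := by fun_prop
  have nE : ∀ s, 0 ≤ s → ‖E s‖ ≤ 1 := fun s hs => norm_cexp_neg_div_le hη (by positivity) hs
  have dE : ∀ s : ℝ, 0 < s → HasDerivAt E (E s * (κ * (t ^ 2 / 4 : ℝ) / s ^ 2)) s := by
    intro s hs
    have hs' : (s : ℂ) ≠ 0 := ofReal_ne_zero.2 hs.ne'
    have h1 : HasDerivAt (fun s : ℝ => (s : ℂ)) 1 s := (hasDerivAt_id s).ofReal_comp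
    have h2 := ((h1.inv hs').const_mul (κ * (t ^ 2 / 4 : ℝ))).neg.cexp
    refine (h2.congr_deriv ?_).congr_of_eventuallyEq (Filter.Eventually.of_forall fun u => ?_)
    · simp only [hE, Pi.neg_apply, Pi.inv_apply, div_eq_mul_inv]
      ring_nf
    · simp only [hE, Pi.neg_apply, Pi.inv_apply, div_eq_mul_inv]
  set w : ℝ → ℝ := fun s => s ^ (3 / 2 : ℝ) / (s ^ 2 + t ^ 2) with hw
  set w' : ℝ → ℝ := fun s => (3 / 2 * s ^ (1 / 2 : ℝ) * (s ^ 2 + t ^ 2) -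
    s ^ (3 / 2 : ℝ) * (2 * s)) / (s ^ 2 + t ^ 2) ^ 2 with hw'
  have mw : Measurable w := by fun_prop
  have mw' : Measurable w' := by fun_prop
  have w0 : ∀ s, 0 ≤ s → 0 ≤ w s := fun s hs => by simp only [hw]; positivity
  have w1 : ∀ s, 0 ≤ s → w s ≤ timeWeight t s := fun s hs => by
    simp only [hw, timeWeight]
    gcongr
    have : 0 ≤ s ^ (1 / 2 : ℝ) := by positivity
    linarith
  -- the two error terms
  set Q0 : ℝ → ℂ := fun s => w s * E s * A s with hQ0
  set Q : ℝ → ℂ := fun s => (w' s * A s + w s * A' s) * E s with hQ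
  have bQ0 : ∀ s ∈ Set.Ioi (0 : ℝ), ‖Q0 s‖ ≤ timeWeight t s * ‖A s‖ := by
    intro s hs
    have hs' : 0 ≤ s := le_of_lt hs
    rw [hQ0, norm_mul, norm_mul, norm_real, Real.norm_of_nonneg (w0 s hs')]
    have := mul_le_mul (w1 s hs') (nE s hs') (norm_nonneg _) (timeWeight_nonneg hs')
    rw [mul_one] at this
    gcongr
  have bQ : ∀ s ∈ Set.Ioi (0 : ℝ), ‖Q s‖ ≤
      2 * (timeWeight t s * ‖A s‖) + timeWeight t s * ‖A' s‖ := by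
    intro s hs
    have hs' : 0 ≤ s := le_of_lt hs
    rw [hQ, norm_mul]
    refine (mul_le_of_le_one_right (norm_nonneg _) (nE s hs')).trans ((norm_add_le _ _).trans ?_)
    rw [norm_mul, norm_mul, norm_real, norm_real, Real.norm_of_nonneg (w0 s hs'),
      Real.norm_eq_abs, ← mul_assoc]
    gcongr
    · exact abs_deriv_rpow_div_le hs
    · exact w1 s hs'
  have iD : IntegrableOn (fun s => 2 * (timeWeight t s * ‖A s‖) + timeWeight t s * ‖A' s‖)
      (Set.Ioi 0) := (iA.const_mul 2).add iA'
  have iQ0 : IntegrableOn Q0 (Set.Ioi 0) := by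
    refine iA.mono' ?_ ((ae_restrict_mem measurableSet_Ioi).mono bQ0)
    exact ((mw.complex_ofReal.mul mE).mul cA.measurable).aestronglyMeasurable
  have iQ : IntegrableOn Q (Set.Ioi 0) := by
    refine iD.mono' ?_ ((ae_restrict_mem measurableSet_Ioi).mono bQ)
    exact (((mw'.complex_ofReal.mul cA.measurable).add
      (mw.complex_ofReal.mul cA'.measurable)).mul mE).aestronglyMeasurable
  have vQ0 : ‖∫ s in Set.Ioi 0, Q0 s‖ ≤ B :=
    (norm_integral_le_of_norm_le iA ((ae_restrict_mem measurableSet_Ioi).mono bQ0)).trans bA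
  have vQ : ‖∫ s in Set.Ioi 0, Q s‖ ≤ 16386 * B := by
    refine (norm_integral_le_of_norm_le iD
      ((ae_restrict_mem measurableSet_Ioi).mono bQ)).trans ?_
    rw [integral_add (iA.const_mul 2) iA', integral_const_mul]
    linarith
  set S : ℝ → ℂ := fun s => ((s ^ (-(1 / 2) : ℝ) : ℝ) : ℂ) * E s * A s with hS
  have iS : IntegrableOn S (Set.Ioi 0) := h_int
  set P : ℝ → ℂ := fun s => w s * A s * E s with hP
  have dP : ∀ s ∈ Set.Ioi (0 : ℝ), HasDerivAt P (Q s + κ / 4 * (S s - Q0 s)) s := by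
    intro s hs
    have hs0 : 0 < s := hs
    have h1 : HasDerivAt P ((w' s * A s + w s * A' s) * E s +
        (w s * A s) * (E s * (κ * (t ^ 2 / 4 : ℝ) / s ^ 2))) s :=
      (((hasDerivAt_rpow_div (t := t) hs0).ofReal_comp.mul
      (hasDerivAt_boxKernel κ x s)).mul (dE s hs0))
    refine h1.congr_deriv ?_
    have e1 : ((s ^ (-(1 / 2) : ℝ) : ℝ) : ℂ) - w s = w s * t ^ 2 / s ^ 2 := by
      have : s ^ (-(1 / 2) : ℝ) - w s = w s * t ^ 2 / s ^ 2 := by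
        have e : s ^ (3 / 2 : ℝ) = s ^ (-(1 / 2) : ℝ) * s ^ 2 := by
          rw [← Real.rpow_two, ← Real.rpow_add hs0]; norm_num
        simp only [hw]
        rw [e]; field_simp; ring
      exact_mod_cast this
    have e2 : S s - Q0 s = (w s * t ^ 2 / s ^ 2) * (E s * A s) := by
      rw [← e1]; simp only [hS, hQ0]; ring
    rw [e2]
    simp only [hQ]
    push_cast
    ring
  have iR : IntegrableOn (fun s => κ / 4 * (S s - Q0 s)) (Set.Ioi 0) :=
    (iS.sub iQ0).const_mul _
  have iP : IntegrableOn (fun s => Q s + κ / 4 * (S s - Q0 s)) (Set.Ioi 0) :=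
    iQ.add iR
  have bP : ∀ s, 0 ≤ s → ‖P s‖ ≤ w s * (2 * Real.pi) ^ 4 := by
    intro s hs
    rw [hP, norm_mul]
    refine (mul_le_of_le_one_right (norm_nonneg _) (nE s hs)).trans ?_
    rw [norm_mul, norm_real, Real.norm_of_nonneg (w0 s hs)]
    have := w0 s hs
    gcongr
    exact norm_boxKernel_le hη hs x
  have P0 : P 0 = 0 := by simp [hP, hw]
  have hcont : ContinuousWithinAt P (Set.Ici 0) 0 := by
    rw [ContinuousWithinAt, P0]
    refine squeeze_zero_norm' (a := fun s => w s * (2 * Real.pi) ^ 4)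
      (Filter.eventually_of_mem self_mem_nhdsWithin fun s hs => bP s hs) ?_
    have : ContinuousAt w 0 := by
      refine ContinuousAt.div ?_ (by fun_prop) (by positivity)
      exact Real.continuousAt_rpow_const _ _ (Or.inr (by norm_num))
    have h2 := (this.tendsto.mul_const ((2 * Real.pi) ^ 4)).mono_left
      (nhdsWithin_le_nhds (s := Set.Ici 0))
    simpa [hw] using h2
  have htop : Filter.Tendsto P Filter.atTop (nhds 0) := by
    have hz : Filter.Tendsto (fun s : ℝ => s ^ (-(1 / 2) : ℝ) * (2 * Real.pi) ^ 4)
        Filter.atTop (nhds 0) := by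
      have := (tendsto_rpow_neg_atTop (y := 1 / 2) (by norm_num)).mul_const ((2 * Real.pi) ^ 4)
      simpa using this
    refine squeeze_zero_norm' ?_ hz
    filter_upwards [Filter.eventually_gt_atTop 0] with s hs
    refine (bP s hs.le).trans ?_
    gcongr
    simp only [hw]
    rw [div_le_iff₀ (by positivity)]
    have e : s ^ (3 / 2 : ℝ) = s ^ (-(1 / 2) : ℝ) * s ^ 2 := by
      rw [← Real.rpow_two, ← Real.rpow_add hs]; norm_num
    rw [e]
    gcongr
    nlinarith [sq_nonneg t]
  have hz := integral_Ioi_of_hasDerivAt_of_tendsto hcont dP iP htop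
  rw [P0, sub_zero, integral_add iQ iR, integral_const_mul,
    integral_sub iS iQ0] at hz
  have key : ∫ s in Set.Ioi 0, S s = (∫ s in Set.Ioi 0, Q0 s) - 4 / κ * ∫ s in Set.Ioi 0, Q s := by
    have := congrArg (fun z => 4 / κ * z) hz
    simp only [mul_add, mul_zero] at this
    have e : 4 / κ * (κ / 4 * ((∫ s in Set.Ioi 0, S s) - ∫ s in Set.Ioi 0, Q0 s)) =
      (∫ s in Set.Ioi 0, S s) - ∫ s in Set.Ioi 0, Q0 s := by field_simp
    rw [e] at this
    linear_combination this
  change ‖∫ s in Set.Ioi 0, S s‖ ≤ _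
  rw [key]
  refine (norm_sub_le _ _).trans ?_
  rw [norm_mul, norm_div]
  have h4 : ‖(4 : ℂ)‖ / ‖κ‖ ≤ 4 := by
    rw [div_le_iff₀ (by linarith)]
    norm_num
    linarith
  have := mul_le_mul h4 vQ (norm_nonneg _) (by norm_num)
  linarith

theorem integral_comp_const_div {c : ℝ} (hc : 0 < c) (f : ℝ → ℂ) :
    ∫ s in Set.Ioi 0, f s = ∫ u in Set.Ioi (0 : ℝ), (c / u ^ 2) • f (c / u) := by
  have himg : (fun u : ℝ => c / u) '' Set.Ioi 0 = Set.Ioi 0 := by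
    ext v
    constructor
    · rintro ⟨u, hu, rfl⟩
      exact div_pos hc hu
    · intro hv
      have hv0 : (0 : ℝ) < v := hv
      exact ⟨c / v, div_pos hc hv, by field_simp⟩
  have h := integral_image_eq_integral_abs_deriv_smul (s := Set.Ioi 0) (f := fun u : ℝ => c / u)
    (f' := fun u => -(c / u ^ 2)) measurableSet_Ioi (fun u hu => by
      have hu0 : u ≠ 0 := ne_of_gt hu
      have := (hasDerivAt_inv hu0).const_mul c
      refine (this.congr_deriv ?_).hasDerivWithinAt
      field_simp) (by
      intro u hu v hv h
      have hu0 : (0 : ℝ) < u := hu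
      have hv0 : (0 : ℝ) < v := hv
      simp only at h
      field_simp at h
      exact h.symm) f
  rw [himg] at h
  rw [h]
  refine setIntegral_congr_fun measurableSet_Ioi fun u _ => ?_
  simp only [abs_neg]
  rw [abs_of_nonneg (by positivity)]

/-- The subordination identity writing the half-wave symbol as a superposition of Gaussian
symbols (an instance of the Cauchy–Schlömilch substitution). -/
theorem integral_subordination {κ : ℂ} {ω b : ℝ} (hκ : 0 < κ.re) (hω : 0 < ω) (hb : 0 < b) :
    IntegrableOn (fun s : ℝ => ((s ^ (-(1 / 2) : ℝ) : ℝ) : ℂ) *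
      (cexp (-(κ * s * (ω ^ 2 : ℝ))) * cexp (-(κ * (b ^ 2 : ℝ) / s)))) (Set.Ioi 0) ∧
    ∫ s in Set.Ioi (0 : ℝ), ((s ^ (-(1 / 2) : ℝ) : ℝ) : ℂ) *
      (cexp (-(κ * s * (ω ^ 2 : ℝ))) * cexp (-(κ * (b ^ 2 : ℝ) / s))) =
      (Real.pi / κ) ^ (1 / 2 : ℂ) * (cexp (-(2 * κ * b * ω)) / ω) := by
  set q : ℝ → ℂ := fun s => cexp (-(κ * s * (ω ^ 2 : ℝ))) * cexp (-(κ * (b ^ 2 : ℝ) / s)) with hq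
  have mq : Measurable q := by fun_prop
  set φ : ℝ → ℝ := fun s => ω * s ^ (1 / 2 : ℝ) - b * s ^ (-(1 / 2) : ℝ) with hφ
  set φ' : ℝ → ℝ := fun s => ω / 2 * s ^ (-(1 / 2) : ℝ) + b / 2 * s ^ (-(3 / 2) : ℝ) with hφ'
  have dφ : ∀ s ∈ Set.Ioi (0 : ℝ), HasDerivWithinAt φ (φ' s) (Set.Ioi 0) s := by
    intro s hs
    have hs0 : s ≠ 0 := ne_of_gt hs
    have h1 := ((Real.hasDerivAt_rpow_const (x := s) (p := 1 / 2) (Or.inl hs0)).const_mul ω).sub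
      ((Real.hasDerivAt_rpow_const (x := s) (p := -(1 / 2)) (Or.inl hs0)).const_mul b)
    refine (h1.congr_deriv ?_).hasDerivWithinAt
    simp only [hφ']
    norm_num
    ring
  have inj : Set.InjOn φ (Set.Ioi 0) := by
    have : StrictMonoOn φ (Set.Ioi 0) := by
      intro u hu v hv huv
      have h1 : u ^ (1 / 2 : ℝ) < v ^ (1 / 2 : ℝ) :=
        Real.rpow_lt_rpow (le_of_lt hu) huv (by norm_num)
      have h2 : v ^ (-(1 / 2) : ℝ) < u ^ (-(1 / 2) : ℝ) :=
        Real.rpow_lt_rpow_of_neg hu huv (by norm_num)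
      simp only [hφ]
      have := mul_lt_mul_of_pos_left h1 hω
      have := mul_lt_mul_of_pos_left h2 hb
      linarith
    exact this.injOn
  have img : φ '' Set.Ioi 0 = Set.univ := by
    refine Set.eq_univ_of_forall fun v => ?_
    have hd : 0 ≤ v ^ 2 + 4 * ω * b := by positivity
    set r := (v + √(v ^ 2 + 4 * ω * b)) / (2 * ω) with hr
    have hr0 : 0 < r := by
      refine div_pos ?_ (by positivity)
      have : |v| < √(v ^ 2 + 4 * ω * b) := by
        rw [← Real.sqrt_sq_eq_abs]
        exact Real.sqrt_lt_sqrt (sq_nonneg v) (by nlinarith [mul_pos hω hb])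
      linarith [neg_abs_le v]
    have hq : ω * r - b * r⁻¹ = v := by
      have h1 := Real.sq_sqrt hd
      have h2 : 2 * ω * r = v + √(v ^ 2 + 4 * ω * b) := by rw [hr]; field_simp
      have h3 : ω * r ^ 2 - v * r - b = 0 := by
        have : (2 * ω * r - v) ^ 2 = v ^ 2 + 4 * ω * b := by rw [h2, add_sub_cancel_left, h1]
        have h4 : 4 * ω * (ω * r ^ 2 - v * r - b) = 0 := by linear_combination this
        rcases mul_eq_zero.1 h4 with h | h
        · linarith
        · exact h
      field_simp
      linear_combination h3
    refine ⟨r ^ 2, pow_pos hr0 2, ?_⟩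
    simp only [hφ]
    rw [← Real.rpow_natCast r 2, ← Real.rpow_mul hr0.le, ← Real.rpow_mul hr0.le]
    norm_num
    rw [Real.rpow_neg_one, hq]
  have sq : ∀ s ∈ Set.Ioi (0 : ℝ), cexp (-κ * (φ s : ℂ) ^ 2) = cexp (2 * κ * b * ω) * q s := by
    intro s hs
    have hs0 : (0 : ℝ) < s := hs
    have e : (φ s) ^ 2 = ω ^ 2 * s + b ^ 2 / s - 2 * ω * b := by
      have e1 : (s ^ (1 / 2 : ℝ)) ^ 2 = s := by
        rw [← Real.rpow_natCast, ← Real.rpow_mul hs0.le]; norm_num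
      have e2 : (s ^ (-(1 / 2) : ℝ)) ^ 2 = s⁻¹ := by
        rw [← Real.rpow_natCast, ← Real.rpow_mul hs0.le]; norm_num [Real.rpow_neg_one]
      have e3 : s ^ (1 / 2 : ℝ) * s ^ (-(1 / 2) : ℝ) = 1 := by
        rw [← Real.rpow_add hs0]; norm_num
      simp only [hφ]
      calc _ = ω ^ 2 * (s ^ (1 / 2 : ℝ)) ^ 2 + b ^ 2 * (s ^ (-(1 / 2) : ℝ)) ^ 2 -
            2 * ω * b * (s ^ (1 / 2 : ℝ) * s ^ (-(1 / 2) : ℝ)) := by ring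
        _ = _ := by rw [e1, e2, e3]; ring
    rw [← Complex.ofReal_pow, e]
    simp only [hq]
    rw [← Complex.exp_add, ← Complex.exp_add]
    congr 1
    push_cast
    ring
  have pφ' : ∀ s ∈ Set.Ioi (0 : ℝ), |φ' s| = φ' s := fun s hs => by
    have hs0 : (0 : ℝ) < s := hs
    refine abs_of_nonneg ?_
    simp only [hφ']
    positivity
  have hI : IntegrableOn (fun s => φ' s • q s) (Set.Ioi 0) := by
    have h := (integrableOn_image_iff_integrableOn_abs_deriv_smul measurableSet_Ioi dφ inj
      (fun v : ℝ => cexp (-κ * (v : ℂ) ^ 2))).1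
      (by rw [img]; exact (integrable_cexp_neg_mul_sq hκ).integrableOn)
    have h2 : IntegrableOn _ _ volume := h.const_mul (cexp (-(2 * κ * b * ω)))
    refine h2.congr_fun (fun s hs => ?_) measurableSet_Ioi
    simp only
    rw [sq s hs, pφ' s hs, mul_smul_comm, ← mul_assoc, ← Complex.exp_add, neg_add_cancel,
      Complex.exp_zero, one_mul]
  have hV : ∫ s in Set.Ioi 0, φ' s • q s = (Real.pi / κ) ^ (1 / 2 : ℂ) * cexp (-(2 * κ * b * ω)) := by
    have h := integral_image_eq_integral_abs_deriv_smul measurableSet_Ioi dφ inj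
      (fun v : ℝ => cexp (-κ * (v : ℂ) ^ 2))
    rw [img, setIntegral_univ, integral_gaussian_complex hκ] at h
    rw [h, ← integral_mul_const]
    refine setIntegral_congr_fun measurableSet_Ioi fun s hs => ?_
    rw [sq s hs, pφ' s hs, smul_mul_assoc, mul_right_comm, ← Complex.exp_add, add_neg_cancel,
      Complex.exp_zero, one_mul]
  have hI1 : IntegrableOn (fun s => (ω / 2 * s ^ (-(1 / 2) : ℝ)) • q s) (Set.Ioi 0) := by
    have hm : Measurable fun s => (ω / 2 * s ^ (-(1 / 2) : ℝ)) • q s := by fun_prop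
    refine Integrable.mono hI hm.aestronglyMeasurable ?_
    filter_upwards [ae_restrict_mem measurableSet_Ioi] with s hs
    have hs0 : (0 : ℝ) < s := hs
    rw [norm_smul, norm_smul, Real.norm_of_nonneg (by positivity), Real.norm_eq_abs, pφ' s hs]
    simp only [hφ']
    gcongr
    have : 0 ≤ b / 2 * s ^ (-(3 / 2) : ℝ) := by positivity
    linarith
  have hI2 : IntegrableOn (fun s => (b / 2 * s ^ (-(3 / 2) : ℝ)) • q s) (Set.Ioi 0) := by
    refine (hI.sub hI1).congr_fun (fun s _ => ?_) measurableSet_Ioi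
    simp only [hφ', Pi.sub_apply]
    rw [← sub_smul, add_sub_cancel_left]
  have hI3 : IntegrableOn (fun s : ℝ => ((s ^ (-(1 / 2) : ℝ) : ℝ) : ℂ) * q s) (Set.Ioi 0) := by
    have h2 : IntegrableOn _ _ volume := hI1.const_mul (2 / ω : ℂ)
    refine h2.congr_fun (fun s _ => ?_) measurableSet_Ioi
    have : (ω : ℂ) ≠ 0 := ofReal_ne_zero.2 hω.ne'
    simp only [real_smul]
    push_cast
    field_simp
  refine ⟨hI3, ?_⟩
  have hswap : ∫ s in Set.Ioi 0, (b / 2 * s ^ (-(3 / 2) : ℝ)) • q s =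
      ∫ s in Set.Ioi 0, (ω / 2 * s ^ (-(1 / 2) : ℝ)) • q s := by
    have hc : 0 < b ^ 2 / ω ^ 2 := by positivity
    rw [integral_comp_const_div hc]
    refine setIntegral_congr_fun measurableSet_Ioi fun u hu => ?_
    have hu0 : (0 : ℝ) < u := hu
    have e1 : q (b ^ 2 / ω ^ 2 / u) = q u := by
      have : (ω : ℂ) ≠ 0 := ofReal_ne_zero.2 hω.ne'
      have : (b : ℂ) ≠ 0 := ofReal_ne_zero.2 hb.ne'
      have : (u : ℂ) ≠ 0 := ofReal_ne_zero.2 hu0.ne'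
      simp only [hq]
      rw [mul_comm]
      congr 2
      · push_cast; field_simp
      · push_cast; field_simp
    rw [e1, smul_smul]
    congr 1
    rw [Real.div_rpow hc.le hu0.le, ← div_pow, ← Real.rpow_natCast (b / ω) 2,
      ← Real.rpow_mul (by positivity)]
    have e2 : u ^ (-(1 / 2) : ℝ) = u ^ (3 / 2 : ℝ) / u ^ 2 := by
      rw [← Real.rpow_two, ← Real.rpow_sub hu0]; norm_num
    have e3 : (b / ω) ^ (((2 : ℕ) : ℝ) * -(3 / 2)) = ((b / ω) ^ 3)⁻¹ := by
      rw [show (((2 : ℕ) : ℝ) * -(3 / 2)) = -((3 : ℕ) : ℝ) by norm_num,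
        Real.rpow_neg (by positivity), Real.rpow_natCast]
    rw [e3, e2, Real.rpow_neg hu0.le, Real.rpow_natCast]
    have : 0 < u ^ (3 / 2 : ℝ) := by positivity
    field_simp
  have hsum : ∫ s in Set.Ioi 0, φ' s • q s =
      2 * ∫ s in Set.Ioi 0, (ω / 2 * s ^ (-(1 / 2) : ℝ)) • q s := by
    rw [two_mul]
    nth_rw 2 [← hswap]
    rw [← integral_add hI1 hI2]
    refine setIntegral_congr_fun measurableSet_Ioi fun s _ => ?_
    simp only [hφ', add_smul]
  have hlast : ∫ s in Set.Ioi 0, (ω / 2 * s ^ (-(1 / 2) : ℝ)) • q s =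
      ω / 2 * ∫ s in Set.Ioi (0 : ℝ), ((s ^ (-(1 / 2) : ℝ) : ℝ) : ℂ) * q s := by
    rw [← integral_const_mul]
    refine setIntegral_congr_fun measurableSet_Ioi fun s _ => ?_
    simp only [real_smul]
    push_cast
    ring
  have h0 : (ω : ℂ) ≠ 0 := ofReal_ne_zero.2 hω.ne'
  have key : (ω : ℂ) * ∫ s in Set.Ioi (0 : ℝ), ((s ^ (-(1 / 2) : ℝ) : ℝ) : ℂ) * q s =
      (Real.pi / κ) ^ (1 / 2 : ℂ) * cexp (-(2 * κ * b * ω)) := by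
    rw [← hV, hsum, hlast]; ring
  rw [mul_div_assoc', ← key, mul_div_cancel_left₀ _ h0]

theorem discOmega_sq (d : ℕ) (ξ : Fin d → ℝ) :
    discOmega d ξ ^ 2 = ∑ j, (2 - 2 * Real.cos (ξ j)) :=
  Real.sq_sqrt (Finset.sum_nonneg fun j _ => by linarith [Real.cos_le_one (ξ j)])

theorem discOmega_nonneg (d : ℕ) (ξ : Fin d → ℝ) : 0 ≤ discOmega d ξ := Real.sqrt_nonneg _

theorem continuous_discOmega (d : ℕ) : Continuous (discOmega d) := by
  unfold discOmega; fun_prop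

theorem measurable_discOmega (d : ℕ) : Measurable (discOmega d) := (continuous_discOmega d).measurable

theorem measurableSet_torusBox (d : ℕ) : MeasurableSet (torusBox d) :=
  MeasurableSet.univ_pi fun _ => measurableSet_Icc

theorem isCompact_torusBox (d : ℕ) : IsCompact (torusBox d) :=
  isCompact_univ_pi fun _ => isCompact_Icc

/-- The measure on the torus box is the product of the one-dimensional ones. -/
theorem volume_restrict_torusBox (d : ℕ) : (volume : Measure (Fin d → ℝ)).restrict (torusBox d) =
    Measure.pi fun _ => volume.restrict (Set.Icc (-Real.pi) Real.pi) := by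
  rw [torusBox, volume_pi, Measure.restrict_pi_pi]

/-- The character `ξ ↦ exp(i x·ξ)`. -/
noncomputable def torusChar {d : ℕ} (x : Fin d → ℤ) (ξ : Fin d → ℝ) : ℂ :=
  cexp (I * ((∑ j, (x j : ℝ) * ξ j : ℝ) : ℂ))

theorem norm_torusChar {d : ℕ} (x : Fin d → ℤ) (ξ : Fin d → ℝ) : ‖torusChar x ξ‖ = 1 := by
  rw [torusChar, mul_comm, norm_exp_ofReal_mul_I]

theorem continuous_torusChar {d : ℕ} (x : Fin d → ℤ) : Continuous (torusChar x) := by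
  unfold torusChar; fun_prop

theorem torusChar_eq_prod {d : ℕ} (x : Fin d → ℤ) (ξ : Fin d → ℝ) :
    torusChar x ξ = ∏ j, cexp (I * (x j * ξ j : ℝ)) := by
  rw [torusChar, ← Complex.exp_sum, ← Finset.mul_sum]
  push_cast
  rfl

theorem integral_torusChar_mul_cexp (κ : ℂ) (x : Fin 4 → ℤ) (s : ℝ) :
    ∫ ξ in torusBox 4, torusChar x ξ * cexp (-(κ * s * (discOmega 4 ξ ^ 2 : ℝ))) =
      boxKernel κ x s := by
  rw [volume_restrict_torusBox]
  have : ∀ ξ : Fin 4 → ℝ, torusChar x ξ * cexp (-(κ * s * (discOmega 4 ξ ^ 2 : ℝ))) =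
      ∏ j, (cexp (I * (x j * ξ j : ℝ)) * cexp (-(κ * s * (2 - 2 * Real.cos (ξ j) : ℝ)))) := by
    intro ξ
    rw [Finset.prod_mul_distrib, ← torusChar_eq_prod, ← Complex.exp_sum, discOmega_sq,
      Finset.sum_neg_distrib, ← Finset.mul_sum, ofReal_sum]
  simp_rw [this]
  rw [integral_fintype_prod_eq_prod (fun j θ => cexp (I * (x j * θ : ℝ)) *
    cexp (-(κ * s * (2 - 2 * Real.cos θ : ℝ))))]
  rfl

theorem integrableOn_abs_rpow_Icc {r a : ℝ} (hr : -1 < r) (ha : 0 ≤ a) :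
    IntegrableOn (fun x : ℝ => |x| ^ r) (Set.Icc (-a) a) := by
  have h1 : IntervalIntegrable (fun x : ℝ => |x| ^ r) volume 0 a := by
    refine (intervalIntegral.intervalIntegrable_rpow' hr).congr fun x hx => ?_
    rw [Set.uIoc_of_le ha] at hx
    simp only [abs_of_pos hx.1]
  have h2 : IntervalIntegrable (fun x : ℝ => |x| ^ r) volume (-a) 0 := by
    have := (IntervalIntegrable.iff_comp_neg).1 h1
    simpa using this.symm
  have h3 := h2.trans h1
  rwa [intervalIntegrable_iff_integrableOn_Icc_of_le (by linarith)] at h3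

theorem integrableOn_inv_discOmega :
    IntegrableOn (fun ξ => (discOmega 4 ξ)⁻¹) (torusBox 4) := by
  have h1 : IntegrableOn (fun ξ : Fin 4 → ℝ => ∏ j, |ξ j| ^ (-(1 / 4) : ℝ)) (torusBox 4) := by
    rw [IntegrableOn, volume_restrict_torusBox]
    exact Integrable.fintype_prod fun j =>
      integrableOn_abs_rpow_Icc (by norm_num) Real.pi_pos.le
  refine h1.mono' (measurable_discOmega 4).inv.aestronglyMeasurable ?_
  have h0 : ∀ᵐ ξ : Fin 4 → ℝ ∂volume.restrict (torusBox 4), ∀ j, ξ j ≠ 0 := by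
    refine ae_restrict_of_ae ?_
    rw [ae_all_iff]
    exact fun j => Measure.ae_eval_ne (μ := fun _ : Fin 4 => (volume : Measure ℝ)) j 0
  filter_upwards [h0, ae_restrict_mem (measurableSet_torusBox 4)] with ξ hξ hb
  rw [Real.norm_of_nonneg (inv_nonneg.2 (discOmega_nonneg _ _))]
  have hpos : ∀ j, 0 < |ξ j| ^ (1 / 4 : ℝ) := fun j => Real.rpow_pos_of_pos (abs_pos.2 (hξ j)) _
  have e1 : ∏ j, |ξ j| ^ (-(1 / 4) : ℝ) = (∏ j, |ξ j| ^ (1 / 4 : ℝ))⁻¹ := by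
    rw [← Finset.prod_inv_distrib]
    exact Finset.prod_congr rfl fun j _ => Real.rpow_neg (abs_nonneg _) _
  rw [e1]
  refine inv_anti₀ (Finset.prod_pos fun j _ => hpos j) ?_
  refine le_of_sq_le_sq ?_ (discOmega_nonneg _ _)
  rw [discOmega_sq]
  have h2 : ∀ j, 4 / Real.pi ^ 2 * (|ξ j| ^ (1 / 4 : ℝ)) ^ 8 ≤ 2 - 2 * Real.cos (ξ j) := by
    intro j
    have hj := hb j (Set.mem_univ j)
    have := Real.cos_le_one_sub_mul_cos_sq (x := ξ j) (abs_le.2 ⟨hj.1, hj.2⟩)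
    have e : (|ξ j| ^ (1 / 4 : ℝ)) ^ 8 = ξ j ^ 2 := by
      rw [← Real.rpow_natCast, ← Real.rpow_mul (abs_nonneg _), ← sq_abs]
      norm_num
    rw [e]
    linear_combination 2 * this
  have h3 := norm_prod_four_le fun j => (((|ξ j| ^ (1 / 4 : ℝ)) ^ 2 : ℝ) : ℂ)
  rw [norm_prod] at h3
  simp only [norm_real, Real.norm_of_nonneg (sq_nonneg _), ← pow_mul] at h3
  have h4 : 1 / 4 ≤ 4 / Real.pi ^ 2 := by
    rw [div_le_div_iff₀ (by norm_num) (by positivity)]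
    nlinarith [Real.pi_pos, Real.pi_lt_four]
  calc (∏ j, |ξ j| ^ (1 / 4 : ℝ)) ^ 2 = ∏ j, (|ξ j| ^ (1 / 4 : ℝ)) ^ 2 := by
        rw [Finset.prod_pow]
    _ ≤ (∑ j, (|ξ j| ^ (1 / 4 : ℝ)) ^ 8) / 4 := h3
    _ = 1 / 4 * ∑ j, (|ξ j| ^ (1 / 4 : ℝ)) ^ 8 := by ring
    _ ≤ 4 / Real.pi ^ 2 * ∑ j, (|ξ j| ^ (1 / 4 : ℝ)) ^ 8 := by
        gcongr
    _ ≤ _ := by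
        rw [Finset.mul_sum]
        exact Finset.sum_le_sum fun j _ => h2 j

theorem ae_discOmega_pos : ∀ᵐ ξ ∂volume.restrict (torusBox 4), 0 < discOmega 4 ξ := by
  have h0 : ∀ᵐ ξ : Fin 4 → ℝ ∂volume.restrict (torusBox 4), ξ 0 ≠ 0 :=
    ae_restrict_of_ae (Measure.ae_eval_ne (μ := fun _ : Fin 4 => (volume : Measure ℝ)) 0 0)
  filter_upwards [h0, ae_restrict_mem (measurableSet_torusBox 4)] with ξ hξ hb
  have hj := hb 0 (Set.mem_univ 0)
  have := Real.cos_le_one_sub_mul_cos_sq (x := ξ 0) (abs_le.2 ⟨hj.1, hj.2⟩)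
  refine Real.sqrt_pos.2 (lt_of_lt_of_le ?_ (Finset.single_le_sum
    (f := fun j => 2 - 2 * Real.cos (ξ j))
    (fun j _ => by linarith [Real.cos_le_one (ξ j)]) (Finset.mem_univ 0)))
  have : 0 < 2 / Real.pi ^ 2 * ξ 0 ^ 2 := by positivity
  linarith

/-- The Fourier integral of the damped half-wave multiplier `exp(-κtω)/ω`. -/
noncomputable def dampedHalfWave (κ : ℂ) (t : ℝ) (x : Fin 4 → ℤ) : ℂ :=
  ∫ ξ in torusBox 4, torusChar x ξ * (cexp (-(κ * t * discOmega 4 ξ)) / discOmega 4 ξ)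

theorem norm_subordination_integrand {η a b s : ℝ} (hs : 0 < s) :
    ((‖((s ^ (-(1 / 2) : ℝ) : ℝ) : ℂ) * (cexp (-((η - I) * s * (a : ℝ))) *
      cexp (-((η - I) * (b : ℝ) / s)))‖ : ℝ) : ℂ) =
    ((s ^ (-(1 / 2) : ℝ) : ℝ) : ℂ) * (cexp (-((η : ℂ) * s * (a : ℝ))) *
      cexp (-((η : ℂ) * (b : ℝ) / s))) := by
  rw [norm_mul, norm_mul, norm_exp, norm_exp, norm_real,
    Real.norm_of_nonneg (Real.rpow_nonneg hs.le _)]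
  have e1 : (-((η - I : ℂ) * s * (a : ℝ))).re = -(η * s * a) := by simp
  have e2 : (-((η - I : ℂ) * (b : ℝ) / s)).re = -(η * b / s) := by
    rw [neg_re, div_ofReal_re]; simp
  rw [e1, e2]
  push_cast
  rfl

theorem norm_dampedHalfWave_le {η t B : ℝ} (hη : 0 < η) (hη1 : η ≤ 1) (ht : 1 ≤ t) (hB : 0 ≤ B)
    (h : ∀ n : ℤ, IntegrableOn (fun s => timeWeight t s * ‖schrKernel (η - I) n s‖ ^ 4) (Set.Ioi 0) ∧
      ∫ s in Set.Ioi 0, timeWeight t s * ‖schrKernel (η - I) n s‖ ^ 4 ≤ B) (x : Fin 4 → ℤ) :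
    ‖dampedHalfWave (η - I) t x‖ ≤ 70000 * B := by
  have hb : 0 < t / 2 := by linarith
  have hκ : 0 < (η - I : ℂ).re := by simpa using hη
  have hκ' : 0 < (η : ℂ).re := by simpa using hη
  set μ := (volume : Measure (Fin 4 → ℝ)).restrict (torusBox 4) with hμ
  set ν := (volume : Measure ℝ).restrict (Set.Ioi 0) with hν
  let g : ℂ → (Fin 4 → ℝ) → ℝ → ℂ := fun κ ξ s => ((s ^ (-(1 / 2) : ℝ) : ℝ) : ℂ) *
    (cexp (-(κ * s * (discOmega 4 ξ ^ 2 : ℝ))) * cexp (-(κ * ((t / 2) ^ 2 : ℝ) / s)))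
  have hg : ∀ {κ : ℂ}, 0 < κ.re → ∀ {ξ}, 0 < discOmega 4 ξ → Integrable (g κ ξ) ν ∧
      ∫ s, g κ ξ s ∂ν = (Real.pi / κ) ^ (1 / 2 : ℂ) *
        (cexp (-(2 * κ * (t / 2 : ℝ) * discOmega 4 ξ)) / discOmega 4 ξ) :=
    fun hκ _ hω => integral_subordination hκ hω hb
  have hm : Measurable (fun z : (Fin 4 → ℝ) × ℝ => torusChar x z.1 * g (η - I) z.1 z.2) := by
    have h1 := (measurable_discOmega 4)
    have h2 := (continuous_torusChar x).measurable
    simp only [g]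
    fun_prop
  have hF : Integrable (fun z : (Fin 4 → ℝ) × ℝ => torusChar x z.1 * g (η - I) z.1 z.2)
      (μ.prod ν) := by
    rw [integrable_prod_iff hm.aestronglyMeasurable]
    refine ⟨?_, ?_⟩
    · filter_upwards [ae_discOmega_pos] with ξ hξ
      exact (hg hκ hξ).1.const_mul _
    · have hi : Integrable (fun ξ => ‖((Real.pi / η : ℂ)) ^ (1 / 2 : ℂ)‖ * (discOmega 4 ξ)⁻¹) μ :=
        integrableOn_inv_discOmega.const_mul _
      refine hi.mono' hm.aestronglyMeasurable.norm.integral_prod_right' ?_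
      filter_upwards [ae_discOmega_pos] with ξ hξ
      rw [← norm_real, ← integral_complex_ofReal]
      have e : ∫ s, ((‖torusChar x ξ * g (η - I) ξ s‖ : ℝ) : ℂ) ∂ν = ∫ s, g η ξ s ∂ν := by
        refine setIntegral_congr_fun measurableSet_Ioi fun s hs => ?_
        simp only [norm_mul (torusChar x ξ), norm_torusChar, one_mul]
        exact norm_subordination_integrand hs
      simp only [e, (hg hκ' hξ).2]
      rw [norm_mul, norm_div, norm_real, Real.norm_of_nonneg hξ.le, div_eq_mul_inv ‖cexp _‖]
      gcongr
      refine mul_le_of_le_one_left (by positivity) ?_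
      rw [norm_exp, Real.exp_le_one_iff]
      have : (-(2 * (η : ℂ) * (t / 2 : ℝ) * discOmega 4 ξ)).re = -(2 * η * (t / 2) * discOmega 4 ξ) := by
        norm_cast
      rw [this]
      have : 0 ≤ 2 * η * (t / 2) * discOmega 4 ξ := by positivity
      linarith
  have hsw := integral_integral_swap (f := fun ξ s => torusChar x ξ * g (η - I) ξ s) hF
  have hl : ∫ ξ, ∫ s, torusChar x ξ * g (η - I) ξ s ∂ν ∂μ =
      (Real.pi / (η - I)) ^ (1 / 2 : ℂ) * dampedHalfWave (η - I) t x := by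
    rw [dampedHalfWave, ← integral_const_mul]
    refine integral_congr_ae ?_
    filter_upwards [ae_discOmega_pos] with ξ hξ
    simp only [integral_const_mul, (hg hκ hξ).2]
    push_cast
    ring_nf
  have hr : ∀ s, ∫ ξ, torusChar x ξ * g (η - I) ξ s ∂μ = ((s ^ (-(1 / 2) : ℝ) : ℝ) : ℂ) *
      cexp (-((η - I) * (t ^ 2 / 4 : ℝ) / s)) * boxKernel (η - I) x s := by
    intro s
    rw [← integral_torusChar_mul_cexp, ← integral_const_mul]
    refine integral_congr_ae (Filter.Eventually.of_forall fun ξ => ?_)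
    simp only [g]
    rw [show (t / 2) ^ 2 = t ^ 2 / 4 by ring]
    ring
  have h_int := hF.integral_prod_right
  simp only [hr] at h_int hsw
  have key := norm_integral_subordination_le hη.le hη1 ht hB h x h_int
  rw [← hsw, hl, norm_mul] at key
  refine le_trans (le_mul_of_one_le_left (norm_nonneg _) ?_) key
  have h2 : (((Real.pi / (η - I)) ^ (1 / 2 : ℂ)) ^ 2 : ℂ) = Real.pi / (η - I) := by
    simp
  have h3 : ‖(Real.pi / (η - I) : ℂ) ^ (1 / 2 : ℂ)‖ ^ 2 = Real.pi / ‖(η - I : ℂ)‖ := by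
    rw [← norm_pow, h2, norm_div, norm_real, Real.norm_of_nonneg Real.pi_pos.le]
  have h4 := norm_ofReal_sub_I_le hη.le hη1
  have h5 := one_le_norm_ofReal_sub_I η
  refine le_of_sq_le_sq ?_ (norm_nonneg _)
  rw [h3, one_pow, one_le_div (by linarith)]
  linarith [Real.pi_gt_three]

theorem norm_dampedHalfWave_integrand_le {η t : ℝ} (hη : 0 ≤ η) (ht : 0 ≤ t) (x : Fin 4 → ℤ)
    (ξ : Fin 4 → ℝ) :
    ‖torusChar x ξ * (cexp (-((η - I) * t * discOmega 4 ξ)) / discOmega 4 ξ)‖ ≤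
      (discOmega 4 ξ)⁻¹ := by
  have h0 := discOmega_nonneg 4 ξ
  rw [norm_mul, norm_torusChar, one_mul, norm_div, norm_exp, norm_real,
    Real.norm_of_nonneg h0, div_eq_mul_inv]
  refine mul_le_of_le_one_left (by positivity) ?_
  rw [Real.exp_le_one_iff]
  have : (-((η - I : ℂ) * t * discOmega 4 ξ)).re = -(η * t * discOmega 4 ξ) := by simp
  rw [this]
  have : 0 ≤ η * t * discOmega 4 ξ := by positivity
  linarith

theorem measurable_dampedHalfWave_integrand (κ : ℂ) (t : ℝ) (x : Fin 4 → ℤ) :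
    Measurable fun ξ =>
      torusChar x ξ * (cexp (-(κ * t * discOmega 4 ξ)) / discOmega 4 ξ) := by
  have h1 := (measurable_discOmega 4)
  have h2 := (continuous_torusChar x).measurable
  fun_prop

theorem integrableOn_dampedHalfWave {η t : ℝ} (hη : 0 ≤ η) (ht : 0 ≤ t) (x : Fin 4 → ℤ) :
    IntegrableOn (fun ξ => torusChar x ξ * (cexp (-((η - I) * t * discOmega 4 ξ)) / discOmega 4 ξ))
      (torusBox 4) :=
  Integrable.mono' integrableOn_inv_discOmega
    (measurable_dampedHalfWave_integrand _ t x).aestronglyMeasurable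
    (Filter.Eventually.of_forall fun ξ => norm_dampedHalfWave_integrand_le hη ht x ξ)

theorem conj_torusChar_neg {d : ℕ} (x : Fin d → ℤ) (ξ : Fin d → ℝ) :
    (starRingEnd ℂ) (torusChar (-x) ξ) = torusChar x ξ := by
  rw [torusChar, torusChar, ← exp_conj]
  congr 1
  simp

theorem integrable_conj {α : Type*} [MeasurableSpace α] {μ : Measure α} {f : α → ℂ}
    (hf : Integrable f μ) : Integrable (fun a => (starRingEnd ℂ) (f a)) μ :=
  (LinearIsometryEquiv.integrable_comp_iff conjLIE).2 hf

theorem integral_damped_sin {η t : ℝ} (hη : 0 ≤ η) (ht : 0 ≤ t) (x : Fin 4 → ℤ) :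
    ∫ ξ in torusBox 4, torusChar x ξ * ((Real.exp (-(η * t * discOmega 4 ξ)) *
      (Real.sin (t * discOmega 4 ξ) / discOmega 4 ξ) : ℝ) : ℂ) =
    (dampedHalfWave (η - I) t x -
      (starRingEnd ℂ) (dampedHalfWave (η - I) t (-x))) / (2 * I) := by
  rw [dampedHalfWave, dampedHalfWave, ← integral_conj, ← integral_sub
    (integrableOn_dampedHalfWave hη ht x) (integrable_conj (integrableOn_dampedHalfWave hη ht (-x))),
    ← integral_div]
  refine integral_congr_ae (Filter.Eventually.of_forall fun ξ => ?_)
  simp only [map_mul, conj_torusChar_neg, map_div₀, conj_ofReal, ← exp_conj, map_neg, map_sub,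
    conj_I]
  rw [show -(((η : ℂ) - I) * t * discOmega 4 ξ) =
      -(η * t * discOmega 4 ξ : ℂ) + (t * discOmega 4 ξ) * I by ring,
    show -(((η : ℂ) - -I) * t * discOmega 4 ξ) =
      -(η * t * discOmega 4 ξ : ℂ) + -(t * discOmega 4 ξ) * I by ring, Complex.exp_add, Complex.exp_add]
  push_cast
  rw [Complex.sin]
  field_simp
  ring_nf
  rw [I_sq]
  ring

theorem norm_greenG_le_of_moment {t B : ℝ} (ht : 1 ≤ t) (hB : 0 ≤ B)
    (h : ∀ (η : ℝ), 0 < η → ∀ n : ℤ,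
      IntegrableOn (fun s => timeWeight t s * ‖schrKernel (η - I) n s‖ ^ 4) (Set.Ioi 0) ∧
      ∫ s in Set.Ioi 0, timeWeight t s * ‖schrKernel (η - I) n s‖ ^ 4 ≤ B) (x : Fin 4 → ℤ) :
    ‖greenG 4 x t‖ ≤ 70000 * B := by
  have ht0 : 0 ≤ t := by linarith
  set W : ℝ → ℂ := fun η => ∫ ξ in torusBox 4, torusChar x ξ *
    ((Real.exp (-(η * t * discOmega 4 ξ)) *
      (Real.sin (t * discOmega 4 ξ) / discOmega 4 ξ) : ℝ) : ℂ) with hW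
  have hb : ∀ n : ℕ, ‖W (1 / ((n : ℝ) + 1))‖ ≤ 70000 * B := by
    intro n
    have hη : (0 : ℝ) < 1 / ((n : ℝ) + 1) := by positivity
    have hη1 : 1 / ((n : ℝ) + 1) ≤ 1 := by
      rw [div_le_one (by positivity)]; linarith [(Nat.cast_nonneg n : (0 : ℝ) ≤ n)]
    simp only [hW]
    rw [integral_damped_sin hη.le ht0, norm_div]
    have e : ‖(2 * I : ℂ)‖ = 2 := by simp
    rw [e, div_le_iff₀ two_pos]
    refine (norm_sub_le _ _).trans ?_
    rw [norm_conj]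
    have h1 := norm_dampedHalfWave_le hη hη1 ht hB (h _ hη) x
    have h2 := norm_dampedHalfWave_le hη hη1 ht hB (h _ hη) (-x)
    linarith
  have hlim : Filter.Tendsto (fun n : ℕ => W (1 / ((n : ℝ) + 1))) Filter.atTop (nhds (W 0)) := by
    refine tendsto_integral_of_dominated_convergence (fun ξ => (discOmega 4 ξ)⁻¹) (fun n => ?_)
      integrableOn_inv_discOmega (fun n => ?_) ?_
    · have h1 := (measurable_discOmega 4)
      have h2 := (continuous_torusChar x).measurable
      refine Measurable.aestronglyMeasurable ?_
      fun_prop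
    · refine Filter.Eventually.of_forall fun ξ => ?_
      have h0 := discOmega_nonneg 4 ξ
      rw [norm_mul, norm_torusChar, one_mul, norm_real, norm_mul, norm_div, Real.norm_of_nonneg h0,
        Real.norm_of_nonneg (Real.exp_pos _).le, div_eq_mul_inv (‖Real.sin _‖), ← mul_assoc]
      refine mul_le_of_le_one_left (by positivity) (mul_le_one₀ ?_ (norm_nonneg _) ?_)
      · rw [Real.exp_le_one_iff, neg_nonpos]
        positivity
      · exact Real.abs_sin_le_one _
    · refine Filter.Eventually.of_forall fun ξ => ?_
      have hc : Continuous fun η : ℝ => torusChar x ξ *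
        ((Real.exp (-(η * t * discOmega 4 ξ)) *
          (Real.sin (t * discOmega 4 ξ) / discOmega 4 ξ) : ℝ) : ℂ) := by fun_prop
      exact (hc.tendsto 0).comp tendsto_one_div_add_atTop_nhds_zero_nat
  have h0 : ‖W 0‖ ≤ 70000 * B := le_of_tendsto hlim.norm (Filter.Eventually.of_forall hb)
  have e : greenG 4 x t = ((2 * Real.pi : ℂ) ^ 4)⁻¹ * W 0 := by
    simp only [greenG, hW, torusChar, zero_mul, neg_zero, Real.exp_zero, one_mul]
  rw [e, norm_mul]
  refine le_trans (mul_le_of_le_one_left (norm_nonneg _) ?_) h0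
  rw [norm_inv, norm_pow, norm_mul, norm_real, Real.norm_of_nonneg Real.pi_pos.le, norm_ofNat]
  refine inv_le_one_of_one_le₀ (one_le_pow₀ ?_)
  linarith [Real.pi_gt_three]

theorem volume_real_torusBox (d : ℕ) : (volume : Measure (Fin d → ℝ)).real (torusBox d) =
    (2 * Real.pi) ^ d := by
  rw [Measure.real, torusBox, volume_pi_pi]
  simp only [Real.volume_Icc, Finset.prod_const, Finset.card_univ, Fintype.card_fin]
  rw [toReal_pow, toReal_ofReal (by linarith [Real.pi_pos])]
  ring

theorem abs_sin_mul_div_le (t ω : ℝ) : |Real.sin (t * ω) / ω| ≤ |t| := by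
  rcases eq_or_ne ω 0 with rfl | h
  · simp
  rw [abs_div, div_le_iff₀ (abs_pos.2 h), ← abs_mul]
  exact Real.abs_sin_le_abs

theorem norm_greenG_le_abs (d : ℕ) (x : Fin d → ℤ) (t : ℝ) : ‖greenG d x t‖ ≤ |t| := by
  have h : ‖∫ ξ in torusBox d, torusChar x ξ *
      ((Real.sin (t * discOmega d ξ) / discOmega d ξ : ℝ) : ℂ)‖ ≤ |t| * (2 * Real.pi) ^ d := by
    rw [← volume_real_torusBox]
    refine norm_setIntegral_le_of_norm_le_const (isCompact_torusBox d).measure_lt_top fun ξ _ => ?_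
    rw [norm_mul, norm_torusChar, one_mul, norm_real]
    exact abs_sin_mul_div_le _ _
  rw [greenG, norm_mul, norm_inv, norm_pow, norm_mul, norm_real, Real.norm_of_nonneg Real.pi_pos.le,
    norm_ofNat, inv_mul_le_iff₀ (by positivity), mul_comm]
  exact h

theorem greenG_neg_time (d : ℕ) (x : Fin d → ℤ) (t : ℝ) : greenG d x (-t) = -greenG d x t := by
  rw [greenG, greenG, ← mul_neg, ← integral_neg]
  congr 2
  ext ξ
  rw [neg_mul, Real.sin_neg]
  push_cast
  ring

/-- Uniform pointwise decay of the four-dimensional Green function. -/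
theorem exists_norm_greenG_le {δ : ℝ} (hδ : 0 < δ) (hδ1 : δ < 1 / 2) :
    ∃ C : ℝ, 0 < C ∧ ∀ (t : ℝ) (x : Fin 4 → ℤ),
      ‖greenG 4 x t‖ ≤ C * (1 + |t|) ^ (-(3 / 2) + 2 * δ) := by
  have hA : 0 < 2 * 48 ^ 4 * (2 + 2 / δ + 1 / (1 / 2 - δ)) := by
    have : 0 < 1 / 2 - δ := by linarith
    positivity
  set A : ℝ := 2 * 48 ^ 4 * (2 + 2 / δ + 1 / (1 / 2 - δ))
  set r : ℝ := -(3 / 2) + 2 * δ with hr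
  have h2r : (1 / 4 : ℝ) ≤ 2 ^ r := by
    calc (1 / 4 : ℝ) = 2 ^ (-2 : ℝ) := by rw [Real.rpow_neg two_pos.le]; norm_num
      _ ≤ 2 ^ r := Real.rpow_le_rpow_of_exponent_le one_le_two (by linarith)
  have hpos : ∀ {t : ℝ}, 1 ≤ t → ∀ x, ‖greenG 4 x t‖ ≤ 4 * (70000 * A + 1) * (1 + t) ^ r := by
    intro t ht x
    have h0 : (0 : ℝ) ≤ t ^ r := by positivity
    have h1 := norm_greenG_le_of_moment ht (mul_nonneg hA.le h0)
      (fun η hη n => integral_timeWeight_mul_le hη.le hδ hδ1 ht n) x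
    have h3 : t ^ r * 2 ^ r ≤ (1 + t) ^ r := by
      rw [← Real.mul_rpow (by linarith) two_pos.le]
      exact Real.rpow_le_rpow_of_nonpos (by linarith) (by linarith) (by linarith)
    have h4 : t ^ r ≤ 4 * (1 + t) ^ r := by nlinarith
    have h5 : (0 : ℝ) ≤ (1 + t) ^ r := by positivity
    nlinarith
  refine ⟨4 * (70000 * A + 1), by positivity, fun t x => ?_⟩
  rcases le_total |t| 1 with h | h
  · have h1 : 2 ^ r ≤ (1 + |t|) ^ r :=
      Real.rpow_le_rpow_of_nonpos (by positivity) (by linarith) (by linarith)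
    have h2 := norm_greenG_le_abs 4 x t
    nlinarith
  · rcases le_total 0 t with h0 | h0
    · rw [abs_of_nonneg h0] at h ⊢
      exact hpos h x
    · rw [abs_of_nonpos h0] at h ⊢
      have := hpos h x
      rwa [greenG_neg_time, norm_neg] at this

theorem pi_count_eq_count {ι : Type*} [Fintype ι] {α : ι → Type*} [∀ i, MeasurableSpace (α i)]
    [∀ i, Countable (α i)] [∀ i, MeasurableSingletonClass (α i)] :
    Measure.pi (fun i => (Measure.count : Measure (α i))) = Measure.count := by
  refine Measure.ext_of_singleton fun x => ?_
  rw [Measure.pi_singleton, Measure.count_singleton]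
  simp

/-- Discrete Gagliardo–Nirenberg (Loomis–Whitney) inequality on `ℤ⁴`. -/
theorem tsum_rpow_le_of_le_line (w F : (Fin 4 → ℤ) → ℝ≥0∞)
    (h : ∀ i x, w x ≤ ∑' k, F (Function.update x i k)) :
    ∑' x, w x ^ (4 / 3 : ℝ) ≤ (∑' x, F x) ^ (4 / 3 : ℝ) := by
  have key := lintegral_prod_lintegral_pow_le (fun _ : Fin 4 => (Measure.count : Measure ℤ))
    (p := 4 / 3) (by rw [Real.holderConjugate_iff]; simp; norm_num)
    (f := F) (measurable_of_countable _)
  rw [pi_count_eq_count] at key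
  simp only [lintegral_count, Fintype.card_fin] at key
  refine le_trans (ENNReal.tsum_le_tsum fun x => ?_) key
  calc w x ^ (4 / 3 : ℝ) = ∏ _i : Fin 4, w x ^ (1 / 3 : ℝ) := by
        rw [Finset.prod_const, Finset.card_univ, Fintype.card_fin, ← ENNReal.rpow_natCast,
          ← ENNReal.rpow_mul]
        norm_num
    _ ≤ _ := by
        refine Finset.prod_le_prod' fun i _ => ?_
        norm_num
        exact ENNReal.rpow_le_rpow (h i x) (by norm_num)

theorem enorm_le_tsum_edist {a : ℤ → ℝ} (ha : Filter.Tendsto a Filter.cofinite (nhds 0)) (n : ℤ) :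
    ‖a n‖ₑ ≤ ∑' k, edist (a k) (a (k - 1)) := by
  have hinj : Function.Injective fun m : ℕ => n - (m : ℤ) := fun m m' h => by
    simp only at h; omega
  have h1 : Filter.Tendsto (fun m : ℕ => a (n - m)) Filter.atTop (nhds 0) := by
    rw [← Nat.cofinite_eq_atTop]
    exact ha.comp hinj.tendsto_cofinite
  have h2 := edist_le_tsum_of_edist_le_of_tendsto₀ (f := fun m : ℕ => a (n - m))
    (fun m : ℕ => edist (a (n - m)) (a (n - m - 1))) (fun m => by
      simp only [Nat.succ_eq_add_one]; push_cast; rw [sub_sub]) h1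
  simp only [Nat.cast_zero, sub_zero, edist_zero_right] at h2
  exact h2.trans (ENNReal.tsum_comp_le_tsum_of_injective hinj fun k => edist (a k) (a (k - 1)))

theorem edist_norm_cube_le (a b : ℂ) :
    edist (‖a‖ ^ 3) (‖b‖ ^ 3) ≤ 3 / 2 * (‖a - b‖ₑ * (‖a‖ₑ ^ 2 + ‖b‖ₑ ^ 2)) := by
  have h : |‖a‖ ^ 3 - ‖b‖ ^ 3| ≤ 3 / 2 * (‖a - b‖ * (‖a‖ ^ 2 + ‖b‖ ^ 2)) := by
    have h1 := abs_norm_sub_norm_le a b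
    rw [show ‖a‖ ^ 3 - ‖b‖ ^ 3 = (‖a‖ - ‖b‖) * (‖a‖ ^ 2 + ‖a‖ * ‖b‖ + ‖b‖ ^ 2) by ring, abs_mul,
      abs_of_nonneg (by positivity : 0 ≤ ‖a‖ ^ 2 + ‖a‖ * ‖b‖ + ‖b‖ ^ 2)]
    calc _ ≤ ‖a - b‖ * (3 / 2 * (‖a‖ ^ 2 + ‖b‖ ^ 2)) := by
          gcongr
          nlinarith [sq_nonneg (‖a‖ - ‖b‖)]
      _ = _ := by ring
  rw [edist_dist, Real.dist_eq]
  refine (ENNReal.ofReal_le_ofReal h).trans_eq ?_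
  rw [ENNReal.ofReal_mul (by norm_num), ENNReal.ofReal_mul (norm_nonneg _),
    ENNReal.ofReal_add (by positivity) (by positivity), ENNReal.ofReal_pow (norm_nonneg _),
    ENNReal.ofReal_pow (norm_nonneg _), ofReal_norm, ofReal_norm, ofReal_norm,
    ENNReal.ofReal_div_of_pos two_pos]
  norm_num

theorem tsum_mul_le_sqrt {α : Type*} (f g : α → ℝ≥0∞) :
    ∑' x, f x * g x ≤ (∑' x, f x ^ 2) ^ (1 / 2 : ℝ) * (∑' x, g x ^ 2) ^ (1 / 2 : ℝ) := by
  let _ : MeasurableSpace α := ⊤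
  have := ENNReal.lintegral_mul_le_Lp_mul_Lq (Measure.count : Measure α)
    (p := 2) (q := 2) (by rw [Real.holderConjugate_iff]; norm_num) (f := f) (g := g)
    measurable_from_top.aemeasurable measurable_from_top.aemeasurable
  simpa [lintegral_count] using this

/-- Discrete Sobolev inequality on `ℤ⁴`. -/
theorem sobolev_four (u : (Fin 4 → ℤ) → ℂ) (hu : ∑' x, ‖u x‖ₑ ^ 4 ≠ ∞) :
    (∑' x, ‖u x‖ₑ ^ 4) ^ (1 / 4 : ℝ) ≤
      3 * ∑ i, (∑' x, ‖u x - u (x - Pi.single i 1)‖ₑ ^ 2) ^ (1 / 2 : ℝ) := by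
  set X := ∑' x, ‖u x‖ₑ ^ 4 with hX
  rcases eq_or_ne X 0 with h0 | h0
  · rw [h0, ENNReal.zero_rpow_of_pos (by norm_num)]; exact zero_le
  have hlim : Filter.Tendsto (fun x => ‖u x‖ ^ 3) Filter.cofinite (nhds 0) := by
    have h1 := ENNReal.tendsto_cofinite_zero_of_tsum_ne_top hu
    have h2 := (ENNReal.tendsto_toReal zero_ne_top).comp h1
    have h3 : Filter.Tendsto (fun x => (‖u x‖ ^ 4) ^ (3 / 4 : ℝ)) Filter.cofinite
        (nhds ((0 : ℝ) ^ (3 / 4 : ℝ))) := by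
      refine Filter.Tendsto.rpow_const ?_ (Or.inr (by norm_num))
      simpa [Function.comp_def] using h2
    rw [Real.zero_rpow (by norm_num)] at h3
    refine h3.congr fun x => ?_
    rw [← Real.rpow_natCast, ← Real.rpow_mul (norm_nonneg _)]
    norm_num
  set F : (Fin 4 → ℤ) → ℝ≥0∞ := fun x => ∑ i, 3 / 2 * (‖u x - u (x - Pi.single i 1)‖ₑ *
    (‖u x‖ₑ ^ 2 + ‖u (x - Pi.single i 1)‖ₑ ^ 2)) with hF
  have hline : ∀ i x, ‖u x‖ₑ ^ 3 ≤ ∑' k, F (Function.update x i k) := by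
    intro i x
    have hinj := Function.update_injective x i
    have h1 := enorm_le_tsum_edist (a := fun k => ‖u (Function.update x i k)‖ ^ 3)
      (hlim.comp hinj.tendsto_cofinite) (x i)
    simp only [Function.update_eq_self, enorm_pow, enorm_norm] at h1
    refine h1.trans (ENNReal.tsum_le_tsum fun k => ?_)
    have e : Function.update x i (k - 1) = Function.update x i k - Pi.single i 1 := by
      ext j
      rcases eq_or_ne j i with rfl | hj <;> simp [*]
    rw [e]
    refine (edist_norm_cube_le _ _).trans ?_
    exact Finset.single_le_sum (f := fun i' => 3 / 2 * (‖u (Function.update x i k) -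
      u (Function.update x i k - Pi.single i' 1)‖ₑ * (‖u (Function.update x i k)‖ₑ ^ 2 +
        ‖u (Function.update x i k - Pi.single i' 1)‖ₑ ^ 2))) (fun _ _ => zero_le) (Finset.mem_univ i)
  have h1 := tsum_rpow_le_of_le_line (fun x => ‖u x‖ₑ ^ 3) F hline
  have e1 : ∀ x, (‖u x‖ₑ ^ 3) ^ (4 / 3 : ℝ) = ‖u x‖ₑ ^ 4 := by
    intro x
    rw [← ENNReal.rpow_natCast, ← ENNReal.rpow_mul, ← ENNReal.rpow_natCast]
    norm_num
  simp only [e1] at h1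
  have h2 : ∑' x, F x ≤ X ^ (1 / 2 : ℝ) *
      (3 * ∑ i, (∑' x, ‖u x - u (x - Pi.single i 1)‖ₑ ^ 2) ^ (1 / 2 : ℝ)) := by
    simp only [hF]
    rw [Summable.tsum_finsetSum fun _ _ => ENNReal.summable, Finset.mul_sum, Finset.mul_sum]
    refine Finset.sum_le_sum fun i _ => ?_
    rw [ENNReal.tsum_mul_left]
    simp only [mul_add]
    rw [ENNReal.tsum_add]
    have a1 := tsum_mul_le_sqrt (fun x => ‖u x - u (x - Pi.single i 1)‖ₑ) (fun x => ‖u x‖ₑ ^ 2)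
    have a2 := tsum_mul_le_sqrt (fun x => ‖u x - u (x - Pi.single i 1)‖ₑ)
      (fun x => ‖u (x - Pi.single i 1)‖ₑ ^ 2)
    have a3 : ∑' x : Fin 4 → ℤ, ‖u (x - Pi.single i 1)‖ₑ ^ 4 = X := by
      rw [hX, ← (Equiv.subRight (Pi.single i 1 : Fin 4 → ℤ)).tsum_eq fun x => ‖u x‖ₑ ^ 4]
      simp only [Equiv.subRight_apply]
    simp only [← pow_mul] at a1 a2
    norm_num at a1 a2
    rw [a3] at a2
    set D := (∑' x, ‖u x - u (x - Pi.single i 1)‖ₑ ^ 2) ^ (1 / 2 : ℝ)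
    norm_num
    calc _ ≤ 3 / 2 * (D * X ^ (1 / 2 : ℝ) + D * X ^ (1 / 2 : ℝ)) := by
          gcongr
      _ = (3 / 2 * 2) * (D * X ^ (1 / 2 : ℝ)) := by ring
      _ = _ := by
        rw [ENNReal.div_mul_cancel two_ne_zero ofNat_ne_top]; ring
  set S := 3 * ∑ i, (∑' x, ‖u x - u (x - Pi.single i 1)‖ₑ ^ 2) ^ (1 / 2 : ℝ)
  have h3 : X ^ (3 / 4 : ℝ) ≤ X ^ (1 / 2 : ℝ) * S := by
    calc X ^ (3 / 4 : ℝ) ≤ ((∑' x, F x) ^ (4 / 3 : ℝ)) ^ (3 / 4 : ℝ) :=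
          ENNReal.rpow_le_rpow h1 (by norm_num)
      _ = ∑' x, F x := by rw [← ENNReal.rpow_mul]; norm_num
      _ ≤ _ := h2
  have h4 : X ^ (3 / 4 : ℝ) = X ^ (1 / 2 : ℝ) * X ^ (1 / 4 : ℝ) := by
    rw [← ENNReal.rpow_add _ _ h0 hu]; norm_num
  rw [h4] at h3
  exact (ENNReal.mul_le_mul_iff_right (by simp [h0, hu]) (by simp [h0, hu])).1 h3

theorem integral_Icc_cexp (n : ℤ) :
    ∫ θ in Set.Icc (-Real.pi) Real.pi, cexp (I * (n * θ : ℝ)) =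
      if n = 0 then (2 * Real.pi : ℂ) else 0 := by
  rw [integral_Icc_eq_integral_Ioc, ← intervalIntegral.integral_of_le (by linarith [Real.pi_pos])]
  split_ifs with h
  · subst h
    simp
    ring
  · have hn : (I * n : ℂ) ≠ 0 := mul_ne_zero I_ne_zero (Int.cast_ne_zero.2 h)
    have e : ∀ θ : ℝ, cexp (I * (n * θ : ℝ)) = cexp (I * n * θ) := fun θ => by
      push_cast; rw [mul_assoc]
    simp_rw [e]
    rw [integral_exp_mul_complex hn, _root_.div_eq_zero_iff]
    left
    rw [sub_eq_zero, Complex.exp_eq_exp_iff_exists_int]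
    exact ⟨n, by push_cast; ring⟩

theorem integral_torusChar {d : ℕ} (x : Fin d → ℤ) :
    ∫ ξ in torusBox d, torusChar x ξ = if x = 0 then (2 * Real.pi : ℂ) ^ d else 0 := by
  rw [volume_restrict_torusBox]
  simp_rw [torusChar_eq_prod]
  rw [integral_fintype_prod_eq_prod (fun j θ => cexp (I * (x j * θ : ℝ)))]
  simp_rw [integral_Icc_cexp]
  split_ifs with h
  · subst h
    simp
  · obtain ⟨j, hj⟩ := Function.ne_iff.1 h
    exact Finset.prod_eq_zero (Finset.mem_univ j) (if_neg hj)

theorem torusChar_add {d : ℕ} (x y : Fin d → ℤ) (ξ : Fin d → ℝ) :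
    torusChar (x + y) ξ = torusChar x ξ * torusChar y ξ := by
  rw [torusChar, torusChar, torusChar, ← Complex.exp_add, ← mul_add, ← Complex.ofReal_add,
    ← Finset.sum_add_distrib]
  simp [add_mul]

/-- Bessel's inequality on the torus. -/
theorem torus_bessel {d : ℕ} (R : Finset (Fin d → ℤ)) {φ : (Fin d → ℝ) → ℂ}
    (hφ : MemLp φ 2 (volume.restrict (torusBox d))) :
    ∑ x ∈ R, ‖∫ ξ in torusBox d, torusChar x ξ * φ ξ‖ ^ 2 ≤
      (2 * Real.pi) ^ d * ∫ ξ in torusBox d, ‖φ ξ‖ ^ 2 := by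
  set μ := (volume : Measure (Fin d → ℝ)).restrict (torusBox d) with hμ
  have : IsFiniteMeasure μ := ⟨by
    rw [hμ, Measure.restrict_apply_univ]; exact (isCompact_torusBox d).measure_lt_top⟩
  have hm : ∀ x : Fin d → ℤ, MemLp (torusChar (-x)) 2 μ := fun x =>
    MemLp.of_bound (continuous_torusChar _).aestronglyMeasurable 1
      (Filter.Eventually.of_forall fun ξ => (norm_torusChar _ ξ).le)
  set c : ℝ := (2 * Real.pi) ^ d with hc
  have hc0 : 0 < c := by positivity
  have hinner : ∀ {x : Fin d → ℤ} {ψ : (Fin d → ℝ) → ℂ} (hψ : MemLp ψ 2 μ),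
      inner ℂ ((hm x).toLp _) (hψ.toLp ψ) = ∫ ξ, torusChar x ξ * ψ ξ ∂μ := by
    intro x ψ hψ
    rw [L2.inner_def]
    refine integral_congr_ae ?_
    filter_upwards [(hm x).coeFn_toLp, hψ.coeFn_toLp] with ξ h1 h2
    rw [h1, h2, RCLike.inner_apply, conj_torusChar_neg, mul_comm]
  set v : (Fin d → ℤ) → Lp ℂ 2 μ := fun x => ((Real.sqrt c)⁻¹ : ℂ) • (hm x).toLp _ with hv
  have hsq : ((Real.sqrt c : ℂ))⁻¹ * (Real.sqrt c : ℂ)⁻¹ = (c : ℂ)⁻¹ := by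
    rw [← mul_inv, ← Complex.ofReal_mul, Real.mul_self_sqrt hc0.le]
  have hort : Orthonormal ℂ v := by
    rw [orthonormal_iff_ite]
    intro x y
    simp only [hv]
    rw [inner_smul_left, inner_smul_right, hinner (hm y), map_inv₀, conj_ofReal, ← mul_assoc, hsq]
    have : ∀ ξ, torusChar x ξ * torusChar (-y) ξ = torusChar (x - y) ξ := fun ξ => by
      rw [sub_eq_add_neg, torusChar_add]
    simp_rw [this]
    rw [hμ, integral_torusChar]
    simp only [sub_eq_zero]
    split_ifs with h
    · rw [hc]
      push_cast
      exact inv_mul_cancel₀ (by simp [Real.pi_ne_zero])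
    · simp
  have key := hort.sum_inner_products_le (x := hφ.toLp φ) (s := R)
  have e1 : ∀ x, ‖inner ℂ (v x) (hφ.toLp φ)‖ ^ 2 = c⁻¹ * ‖∫ ξ, torusChar x ξ * φ ξ ∂μ‖ ^ 2 := by
    intro x
    simp only [hv]
    rw [inner_smul_left, hinner hφ, norm_mul, mul_pow, norm_conj, norm_inv, norm_real,
      Real.norm_of_nonneg (Real.sqrt_nonneg _), inv_pow, Real.sq_sqrt hc0.le]
  have e2 : ‖hφ.toLp φ‖ ^ 2 = ∫ ξ, ‖φ ξ‖ ^ 2 ∂μ := by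
    have h1 : (inner ℂ (hφ.toLp φ) (hφ.toLp φ) : ℂ) = ((∫ ξ, ‖φ ξ‖ ^ 2 ∂μ : ℝ) : ℂ) := by
      rw [L2.inner_def, ← integral_complex_ofReal]
      refine integral_congr_ae ?_
      filter_upwards [hφ.coeFn_toLp] with ξ h
      rw [h, inner_self_eq_norm_sq_to_K]
      simp
    rw [inner_self_eq_norm_sq_to_K] at h1
    refine Complex.ofReal_injective ?_
    rw [← h1, Complex.ofReal_pow]
    rfl
  simp only [e1, e2] at key
  rw [← Finset.mul_sum, inv_mul_le_iff₀ hc0] at key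
  exact key

instance isFiniteMeasure_torusBox (d : ℕ) :
    IsFiniteMeasure ((volume : Measure (Fin d → ℝ)).restrict (torusBox d)) :=
  ⟨by rw [Measure.restrict_apply_univ]; exact (isCompact_torusBox d).measure_lt_top⟩

theorem torus_bessel_tsum {d : ℕ} {φ : (Fin d → ℝ) → ℂ} {b : ℝ}
    (hφ : MemLp φ 2 (volume.restrict (torusBox d)))
    (hb : ∫ ξ in torusBox d, ‖φ ξ‖ ^ 2 ≤ b) :
    ∑' x, ‖((2 * Real.pi : ℂ) ^ d)⁻¹ * ∫ ξ in torusBox d, torusChar x ξ * φ ξ‖ₑ ^ 2 ≤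
      ENNReal.ofReal (((2 * Real.pi) ^ d)⁻¹ * b) := by
  have hc : (0 : ℝ) < (2 * Real.pi) ^ d := by positivity
  rw [ENNReal.tsum_eq_iSup_sum]
  refine iSup_le fun R => ?_
  have e : ∀ z : ℂ, ‖((2 * Real.pi : ℂ) ^ d)⁻¹ * z‖ₑ ^ 2 =
      ENNReal.ofReal ((((2 * Real.pi) ^ d)⁻¹) ^ 2 * ‖z‖ ^ 2) := by
    intro z
    rw [← ofReal_norm, ← ENNReal.ofReal_pow (norm_nonneg _), norm_mul, mul_pow, norm_inv, norm_pow,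
      norm_mul, norm_real, Real.norm_of_nonneg Real.pi_pos.le, norm_ofNat]
  simp_rw [e]
  rw [← ENNReal.ofReal_sum_of_nonneg fun _ _ => by positivity, ← Finset.mul_sum]
  refine ENNReal.ofReal_le_ofReal ?_
  calc _ ≤ ((2 * Real.pi) ^ d)⁻¹ ^ 2 * ((2 * Real.pi) ^ d * b) := by
        gcongr
        exact (torus_bessel R hφ).trans (by gcongr)
    _ = _ := by field_simp

/-- The trigonometric polynomial with coefficients `f` on `S`. -/
noncomputable def trigPoly (S : Finset (Fin 4 → ℤ)) (f : (Fin 4 → ℤ) → ℂ) (ξ : Fin 4 → ℝ) : ℂ :=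
  ∑ y ∈ S, f y * torusChar (-y) ξ

theorem continuous_trigPoly (S : Finset (Fin 4 → ℤ)) (f : (Fin 4 → ℤ) → ℂ) :
    Continuous (trigPoly S f) := by
  have := fun y : Fin 4 → ℤ => continuous_torusChar (-y)
  unfold trigPoly
  fun_prop

theorem norm_trigPoly_le (S : Finset (Fin 4 → ℤ)) (f : (Fin 4 → ℤ) → ℂ) (ξ : Fin 4 → ℝ) :
    ‖trigPoly S f ξ‖ ≤ ∑ y ∈ S, ‖f y‖ := by
  refine (norm_sum_le _ _).trans_eq ?_
  simp [norm_torusChar]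

theorem norm_one_sub_torusChar_sq_le (i : Fin 4) (ξ : Fin 4 → ℝ) :
    ‖1 - torusChar (-Pi.single i 1) ξ‖ ^ 2 ≤ discOmega 4 ξ ^ 2 := by
  have e : torusChar (-Pi.single i 1) ξ = cexp ((-ξ i : ℝ) * I) := by
    rw [torusChar, mul_comm]
    congr 3
    rw [Finset.sum_eq_single i]
    · simp
    · intro j _ hj; simp [hj]
    · simp
  rw [e, discOmega_sq, exp_mul_I, ← normSq_eq_norm_sq, normSq_apply, ← ofReal_cos, ← ofReal_sin]
  simp only [sub_re, sub_im, add_re, add_im, one_re, one_im, mul_re, mul_im, ofReal_re, ofReal_im,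
    I_re, I_im, Real.cos_neg, Real.sin_neg]
  refine le_trans (le_of_eq ?_) (Finset.single_le_sum (f := fun j => 2 - 2 * Real.cos (ξ j))
    (fun j _ => by linarith [Real.cos_le_one (ξ j)]) (Finset.mem_univ i))
  linear_combination Real.sin_sq_add_cos_sq (ξ i)

theorem abs_sin_div_sq_le {t ω : ℝ} (ht : t ≠ 0) (hω : 0 ≤ ω) :
    (Real.sin (t * ω) / ω) ^ 2 ≤ 2 / (ω ^ 2 + 1 / t ^ 2) := by
  have h2 : 0 < t ^ 2 := by positivity
  rw [le_div_iff₀ (by positivity)]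
  have h1 := abs_sin_mul_div_le t ω
  have h3 : (Real.sin (t * ω) / ω) ^ 2 ≤ t ^ 2 := sq_le_sq.2 h1
  have h4 : (Real.sin (t * ω) / ω) ^ 2 * ω ^ 2 ≤ 1 := by
    rcases hω.eq_or_lt with rfl | h
    · simp
    rw [div_pow, div_mul_cancel₀ _ (by positivity)]
    exact Real.sin_sq_le_one _
  have h5 : (Real.sin (t * ω) / ω) ^ 2 * (1 / t ^ 2) ≤ 1 := by
    rw [mul_one_div, div_le_one h2]; exact h3
  linarith

section Energy

variable (S : Finset (Fin 4 → ℤ)) (f : (Fin 4 → ℤ) → ℂ) {η : ℝ}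

/-- The weighted energy of a trigonometric polynomial is controlled by the `ℓ^{4/3}` norm
of its coefficients. -/
theorem energy_le (hη : 0 < η) :
    ((2 * Real.pi) ^ 4)⁻¹ * ∫ ξ in torusBox 4, ‖trigPoly S f ξ‖ ^ 2 / (discOmega 4 ξ ^ 2 + η) ≤
      144 * ((∑ y ∈ S, ‖f y‖ ^ (4 / 3 : ℝ)) ^ (3 / 4 : ℝ)) ^ 2 := by
  set c : ℝ := (2 * Real.pi) ^ 4 with hc
  have hc0 : 0 < c := by positivity
  have hcc : (2 * Real.pi : ℂ) ^ 4 = (c : ℂ) := by rw [hc]; push_cast; rfl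
  set μ := (volume : Measure (Fin 4 → ℝ)).restrict (torusBox 4) with hμ
  set P := trigPoly S f with hP
  have hPc : Continuous P := continuous_trigPoly S f
  set D : (Fin 4 → ℝ) → ℝ := fun ξ => discOmega 4 ξ ^ 2 + η with hD
  have hDc : Continuous D := ((continuous_discOmega 4).pow 2).add continuous_const
  have hD0 : ∀ ξ, 0 < D ξ := fun ξ => by have := sq_nonneg (discOmega 4 ξ); simp only [hD]; linarith
  have h_int : ∀ {E : Type} [NormedAddCommGroup E] {φ : (Fin 4 → ℝ) → E}, Continuous φ →
      Integrable φ μ := fun h => h.continuousOn.integrableOn_compact (isCompact_torusBox 4)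
  have hmem : ∀ {φ : (Fin 4 → ℝ) → ℂ}, Continuous φ → MemLp φ 2 μ := by
    intro φ h
    obtain ⟨C, hC⟩ := (isCompact_torusBox 4).exists_bound_of_continuousOn h.continuousOn
    refine MemLp.of_bound h.aestronglyMeasurable C ?_
    filter_upwards [ae_restrict_mem (measurableSet_torusBox 4)] with ξ hξ using hC ξ hξ
  set ψ : (Fin 4 → ℝ) → ℂ := fun ξ => P ξ / D ξ with hψ
  have hDC0 : ∀ ξ, (D ξ : ℂ) ≠ 0 := fun ξ => ofReal_ne_zero.2 (hD0 ξ).ne'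
  have hψc : Continuous ψ := hPc.div (continuous_ofReal.comp hDc) hDC0
  set u : (Fin 4 → ℤ) → ℂ := fun x => ((2 * Real.pi : ℂ) ^ 4)⁻¹ * ∫ ξ, torusChar x ξ * ψ ξ ∂μ with hu
  set M := c⁻¹ * ∫ ξ, ‖P ξ‖ ^ 2 / D ξ ∂μ with hM
  have hNc : Continuous fun ξ => ‖P ξ‖ ^ 2 / D ξ := (hPc.norm.pow 2).div hDc fun ξ => (hD0 ξ).ne'
  have hM0 : 0 ≤ M := mul_nonneg (by positivity)
    (integral_nonneg fun ξ => div_nonneg (by positivity) (hD0 ξ).le)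
  have hX : ∑' x, ‖u x‖ₑ ^ 4 ≠ ∞ := by
    have h1 := torus_bessel_tsum (hmem hψc) le_rfl
    refine ne_top_of_le_ne_top (ENNReal.mul_ne_top ofReal_ne_top ofReal_ne_top)
      (le_trans ?_ (mul_le_mul' h1 h1))
    rw [← ENNReal.tsum_mul_left]
    refine ENNReal.tsum_le_tsum fun x => ?_
    rw [show ‖u x‖ₑ ^ 4 = ‖u x‖ₑ ^ 2 * ‖u x‖ₑ ^ 2 by ring]
    exact mul_le_mul_left (ENNReal.le_tsum x) _
  have hgrad : ∀ i, ∑' x, ‖u x - u (x - Pi.single i 1)‖ₑ ^ 2 ≤ ENNReal.ofReal M := by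
    intro i
    have hφc : Continuous fun ξ => (1 - torusChar (-Pi.single i 1) ξ) * ψ ξ :=
      (continuous_const.sub (continuous_torusChar _)).mul hψc
    have h1 := torus_bessel_tsum (b := ∫ ξ, ‖P ξ‖ ^ 2 / D ξ ∂μ) (hmem hφc) (by
      refine integral_mono (h_int (hφc.norm.pow 2)) (h_int hNc) fun ξ => ?_
      simp only [norm_mul, mul_pow, hψ, norm_div, norm_real, Real.norm_of_nonneg (hD0 ξ).le, div_pow]
      have := norm_one_sub_torusChar_sq_le i ξ
      have h2 : ‖1 - torusChar (-Pi.single i 1) ξ‖ ^ 2 ≤ D ξ := by simp only [hD]; linarith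
      calc _ ≤ D ξ * (‖P ξ‖ ^ 2 / D ξ ^ 2) := by gcongr
        _ = _ := by have := (hD0 ξ).ne'; field_simp)
    refine le_trans (le_of_eq ?_) h1
    congr 1
    ext x
    congr 2
    have hi : ∀ y : Fin 4 → ℤ, Integrable (fun ξ => torusChar y ξ * ψ ξ) μ := fun y =>
      h_int ((continuous_torusChar y).mul hψc)
    simp only [hu]
    rw [← mul_sub, ← integral_sub (hi _) (hi _)]
    congr 2
    ext ξ
    rw [sub_eq_add_neg x, torusChar_add]
    ring
  have hpair : ∑ y ∈ S, (starRingEnd ℂ) (f y) * u y = (M : ℂ) := by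
    simp only [hu, hM, hcc]
    rw [Complex.ofReal_mul, ← integral_complex_ofReal, Complex.ofReal_inv]
    have : ∀ y, (starRingEnd ℂ) (f y) * ((c : ℂ)⁻¹ * ∫ ξ, torusChar y ξ * ψ ξ ∂μ) =
        (c : ℂ)⁻¹ * ∫ ξ, (starRingEnd ℂ) (f y) * (torusChar y ξ * ψ ξ) ∂μ := fun y => by
      rw [integral_const_mul]; ring
    simp_rw [this]
    have hi : ∀ y, Integrable (fun ξ => (starRingEnd ℂ) (f y) * (torusChar y ξ * ψ ξ)) μ := fun y =>
      h_int (continuous_const.mul ((continuous_torusChar y).mul hψc))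
    rw [← Finset.mul_sum, ← integral_finsetSum _ fun y _ => hi y]
    congr 2
    ext ξ
    have h1 : (starRingEnd ℂ) (P ξ) = ∑ y ∈ S, (starRingEnd ℂ) (f y) * torusChar y ξ := by
      simp only [hP, trigPoly, map_sum, map_mul, conj_torusChar_neg]
    simp_rw [← mul_assoc]
    rw [← Finset.sum_mul, ← h1, hψ]
    push_cast
    rw [mul_div_assoc', conj_mul']
  set A := (∑ y ∈ S, ‖f y‖ ^ (4 / 3 : ℝ)) ^ (3 / 4 : ℝ) with hA
  have hA0 : 0 ≤ A := by positivity
  set U := (∑ y ∈ S, ‖u y‖ ^ (4 : ℝ)) ^ (1 / 4 : ℝ) with hU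
  have h1 : M ≤ A * U := by
    calc M = ‖(M : ℂ)‖ := by rw [norm_real, Real.norm_of_nonneg hM0]
      _ ≤ ∑ y ∈ S, ‖f y‖ * ‖u y‖ := by
          rw [← hpair]
          refine (norm_sum_le _ _).trans_eq ?_
          simp only [norm_mul, norm_conj]
      _ ≤ _ := by
          have := Real.inner_le_Lp_mul_Lq_of_nonneg S (p := 4 / 3) (q := 4)
            (by rw [Real.holderConjugate_iff]; norm_num) (f := fun y => ‖f y‖) (g := fun y => ‖u y‖)
            (fun _ _ => norm_nonneg _) (fun _ _ => norm_nonneg _)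
          simpa [hA, hU] using this
  have h2 : U ≤ 12 * Real.sqrt M := by
    rw [← ENNReal.ofReal_le_ofReal_iff (by positivity)]
    calc ENNReal.ofReal U = (∑ y ∈ S, ‖u y‖ₑ ^ 4) ^ (1 / 4 : ℝ) := by
          rw [hU, ← ENNReal.ofReal_rpow_of_nonneg (by positivity) (by norm_num),
            ENNReal.ofReal_sum_of_nonneg (fun _ _ => by positivity)]
          congr 1
          refine Finset.sum_congr rfl fun y _ => ?_
          rw [← ENNReal.ofReal_rpow_of_nonneg (norm_nonneg _) (by norm_num), ofReal_norm]
          exact_mod_cast ENNReal.rpow_natCast _ 4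
      _ ≤ (∑' x, ‖u x‖ₑ ^ 4) ^ (1 / 4 : ℝ) :=
          ENNReal.rpow_le_rpow (ENNReal.sum_le_tsum S) (by norm_num)
      _ ≤ 3 * ∑ i, (∑' x, ‖u x - u (x - Pi.single i 1)‖ₑ ^ 2) ^ (1 / 2 : ℝ) := sobolev_four u hX
      _ ≤ 3 * ∑ _i : Fin 4, ENNReal.ofReal M ^ (1 / 2 : ℝ) := by
          gcongr with i
          exact hgrad i
      _ = ENNReal.ofReal (12 * Real.sqrt M) := by
          rw [Finset.sum_const, Finset.card_univ, Fintype.card_fin,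
            ENNReal.ofReal_rpow_of_nonneg hM0 (by norm_num), ← Real.sqrt_eq_rpow,
            ENNReal.ofReal_mul (by norm_num), nsmul_eq_mul, ← mul_assoc]
          norm_num
  have h3 : Real.sqrt M ^ 2 = M := Real.sq_sqrt hM0
  have h4 : M ≤ 12 * A * Real.sqrt M := by nlinarith
  have h5 : Real.sqrt M ≤ 12 * A := by
    rcases (Real.sqrt_nonneg M).eq_or_lt with h | h
    · rw [← h]; positivity
    · refine le_of_mul_le_mul_right ?_ h
      nlinarith
  nlinarith [Real.sqrt_nonneg M]

end Energy

/-- The `ℓ^{4/3} → ℓ²` bound for the discrete wave propagator, uniform in time. -/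
theorem sum_norm_greenG_sq_le (R S : Finset (Fin 4 → ℤ)) (f : (Fin 4 → ℤ) → ℂ) (t : ℝ) :
    ∑ x ∈ R, ‖∑ y ∈ S, greenG 4 (x - y) t * f y‖ ^ 2 ≤
      288 * ((∑ y ∈ S, ‖f y‖ ^ (4 / 3 : ℝ)) ^ (3 / 4 : ℝ)) ^ 2 := by
  rcases eq_or_ne t 0 with rfl | ht
  · have : ∀ x, greenG 4 x 0 = 0 := fun x => by simpa using norm_greenG_le_abs 4 x 0
    simp only [this, zero_mul, Finset.sum_const_zero, norm_zero, ne_eq, OfNat.ofNat_ne_zero,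
      not_false_eq_true, zero_pow]
    positivity
  set c : ℝ := (2 * Real.pi) ^ 4 with hc
  have hc0 : 0 < c := by positivity
  have hcc : (2 * Real.pi : ℂ) ^ 4 = (c : ℂ) := by rw [hc]; push_cast; rfl
  set μ := (volume : Measure (Fin 4 → ℝ)).restrict (torusBox 4) with hμ
  set m : (Fin 4 → ℝ) → ℂ := fun ξ => ((Real.sin (t * discOmega 4 ξ) / discOmega 4 ξ : ℝ) : ℂ) with hm
  have hmm : Measurable m := by
    have h1 := measurable_discOmega 4
    fun_prop
  have hmb : ∀ ξ, ‖m ξ‖ ≤ |t| := fun ξ => by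
    rw [hm, norm_real]; exact abs_sin_mul_div_le _ _
  set P := trigPoly S f with hP
  have hPc : Continuous P := continuous_trigPoly S f
  have hφ : MemLp (fun ξ => P ξ * m ξ) 2 μ := by
    refine MemLp.of_bound (hPc.measurable.mul hmm).aestronglyMeasurable ((∑ y ∈ S, ‖f y‖) * |t|)
      (Filter.Eventually.of_forall fun ξ => ?_)
    rw [norm_mul]
    exact mul_le_mul (norm_trigPoly_le S f ξ) (hmb ξ) (norm_nonneg _)
      (Finset.sum_nonneg fun _ _ => norm_nonneg _)
  have hrep : ∀ x, ∑ y ∈ S, greenG 4 (x - y) t * f y =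
      (c : ℂ)⁻¹ * ∫ ξ, torusChar x ξ * (P ξ * m ξ) ∂μ := by
    intro x
    have hi : ∀ y, Integrable (fun ξ => torusChar (x - y) ξ * m ξ * f y) μ := by
      intro y
      refine Integrable.of_bound (((continuous_torusChar _).measurable.mul hmm).mul_const _
        |>.aestronglyMeasurable) (|t| * ‖f y‖) (Filter.Eventually.of_forall fun ξ => ?_)
      rw [norm_mul, norm_mul, norm_torusChar, one_mul]
      exact mul_le_mul_of_nonneg_right (hmb ξ) (norm_nonneg _)
    have h1 : ∀ y, greenG 4 (x - y) t * f y = (c : ℂ)⁻¹ * ∫ ξ, torusChar (x - y) ξ * m ξ * f y ∂μ := by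
      intro y
      rw [integral_mul_const, greenG, hcc, mul_assoc]
      rfl
    simp_rw [h1]
    rw [← Finset.mul_sum, ← integral_finsetSum _ fun y _ => hi y]
    congr 2
    ext ξ
    rw [hP, trigPoly, Finset.sum_mul, Finset.mul_sum]
    refine Finset.sum_congr rfl fun y _ => ?_
    rw [sub_eq_add_neg, torusChar_add]
    ring
  simp_rw [hrep, norm_mul, mul_pow]
  rw [← Finset.mul_sum]
  have h1 := torus_bessel R hφ
  have hη : 0 < 1 / t ^ 2 := by positivity
  have h2 := energy_le S f hη
  have h3 : ∫ ξ, ‖P ξ * m ξ‖ ^ 2 ∂μ ≤ 2 * ∫ ξ, ‖P ξ‖ ^ 2 / (discOmega 4 ξ ^ 2 + 1 / t ^ 2) ∂μ := by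
    rw [← integral_const_mul]
    have hDc : Continuous fun ξ => ‖P ξ‖ ^ 2 / (discOmega 4 ξ ^ 2 + 1 / t ^ 2) :=
      (hPc.norm.pow 2).div (((continuous_discOmega 4).pow 2).add continuous_const)
        fun ξ => by positivity
    refine integral_mono ((memLp_two_iff_integrable_sq_norm hφ.1).1 hφ)
      ((hDc.const_mul 2).continuousOn.integrableOn_compact (isCompact_torusBox 4)) fun ξ => ?_
    have h := abs_sin_div_sq_le ht (discOmega_nonneg 4 ξ)
    simp only [hm, norm_mul, mul_pow, norm_real, Real.norm_eq_abs, sq_abs]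
    calc ‖P ξ‖ ^ 2 * (Real.sin (t * discOmega 4 ξ) / discOmega 4 ξ) ^ 2 ≤
        ‖P ξ‖ ^ 2 * (2 / (discOmega 4 ξ ^ 2 + 1 / t ^ 2)) := by gcongr
      _ = _ := by ring
  rw [norm_inv, norm_real, Real.norm_of_nonneg hc0.le]
  calc c⁻¹ ^ 2 * ∑ x ∈ R, ‖∫ ξ, torusChar x ξ * (P ξ * m ξ) ∂μ‖ ^ 2 ≤
      c⁻¹ ^ 2 * (c * (2 * ∫ ξ, ‖P ξ‖ ^ 2 / (discOmega 4 ξ ^ 2 + 1 / t ^ 2) ∂μ)) := by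
        gcongr
        exact h1.trans (by gcongr)
    _ = 2 * (c⁻¹ * ∫ ξ, ‖P ξ‖ ^ 2 / (discOmega 4 ξ ^ 2 + 1 / t ^ 2) ∂μ) := by
        rw [sq, mul_assoc, inv_mul_cancel_left₀ hc0.ne']; ring
    _ ≤ 2 * (144 * ((∑ y ∈ S, ‖f y‖ ^ (4 / 3 : ℝ)) ^ (3 / 4 : ℝ)) ^ 2) := by gcongr
    _ = _ := by ring

/-- The number with the phase of `w` and modulus `‖w‖ ^ c`, for complex `c`. -/
noncomputable def phasePow (w c : ℂ) : ℂ := w / ‖w‖ * exp (Real.log ‖w‖ * c)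

lemma norm_phasePow (w c : ℂ) (hc : c.re ≠ 0) : ‖phasePow w c‖ = ‖w‖ ^ c.re := by
  rcases eq_or_ne w 0 with rfl | hw
  · simp [phasePow, Real.zero_rpow hc]
  · have hp : 0 < ‖w‖ := norm_pos_iff.2 hw
    rw [phasePow, norm_mul, norm_div, norm_exp, norm_real, norm_norm, div_self hp.ne', one_mul,
      re_ofReal_mul, Real.rpow_def_of_pos hp]

lemma phasePow_one (w : ℂ) : phasePow w 1 = w := by
  rcases eq_or_ne w 0 with rfl | hw
  · simp [phasePow]
  · have hp : 0 < ‖w‖ := norm_pos_iff.2 hw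
    have hp' : (‖w‖ : ℂ) ≠ 0 := by exact_mod_cast hp.ne'
    rw [phasePow, mul_one, ← ofReal_exp, Real.exp_log hp, div_mul_cancel₀ _ hp']

lemma norm_phasePow_le {w c : ℂ} {s : ℝ} (hc : 0 < c.re) (hs : c.re ≤ s) :
    ‖phasePow w c‖ ≤ (1 + ‖w‖) ^ s := by
  rw [norm_phasePow w c hc.ne']
  have h0 := norm_nonneg w
  calc ‖w‖ ^ c.re ≤ (1 + ‖w‖) ^ c.re := by gcongr; linarith
    _ ≤ _ := Real.rpow_le_rpow_of_exponent_le (by linarith) hs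

/-- Riesz–Thorin interpolation of a finite kernel between `l^{4/3} → l²` and `l¹ → l^∞`,
in bilinear form. -/
lemma norm_bilinear_le_interp {ι κ : Type*} (R : Finset ι) (S : Finset κ) (K : ι → κ → ℂ)
    {N₀ N₁ θ : ℝ} (hN₀ : 0 ≤ N₀) (hN₁ : 0 ≤ N₁) (hθ0 : 0 < θ) (hθ1 : θ < 1)
    (hK : ∀ x y, ‖K x y‖ ≤ N₁)
    (hL : ∀ f : κ → ℂ, ∑ x ∈ R, ‖∑ y ∈ S, K x y * f y‖ ^ 2 ≤
      (N₀ * (∑ y ∈ S, ‖f y‖ ^ (4 / 3 : ℝ)) ^ (3 / 4 : ℝ)) ^ 2) (f : κ → ℂ) (g : ι → ℂ) :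
    ‖∑ x ∈ R, g x * ∑ y ∈ S, K x y * f y‖ ≤
      N₀ ^ (1 - θ) * N₁ ^ θ * (∑ y ∈ S, ‖f y‖ ^ (4 / (3 + θ))) ^ ((3 + θ) / 4) *
        (∑ x ∈ R, ‖g x‖ ^ (2 / (1 + θ))) ^ ((1 + θ) / 2) := by
  set p : ℝ := 4 / (3 + θ) with hp
  set q : ℝ := 2 / (1 + θ) with hq
  have hp0 : 0 < p := by positivity
  have hq0 : 0 < q := by positivity
  set A := ∑ y ∈ S, ‖f y‖ ^ p
  set B := ∑ x ∈ R, ‖g x‖ ^ q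
  have hA : 0 ≤ A := Finset.sum_nonneg fun _ _ => by positivity
  have hB : 0 ≤ B := Finset.sum_nonneg fun _ _ => by positivity
  let cf : ℂ → ℂ := fun z => (p / 4 : ℝ) * (3 + z)
  let cg : ℂ → ℂ := fun z => (q / 2 : ℝ) * (1 + z)
  have cf_re (z : ℂ) : (cf z).re = p / 4 * (3 + z.re) := by
    simp only [cf]; rw [re_ofReal_mul]; simp
  have cg_re (z : ℂ) : (cg z).re = q / 2 * (1 + z.re) := by
    simp only [cg]; rw [re_ofReal_mul]; simp
  let F : ℂ → ℂ := fun z => ∑ x ∈ R, phasePow (g x) (cg z) *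
    ∑ y ∈ S, K x y * phasePow (f y) (cf z)
  have hF : Differentiable ℂ F := by
    simp only [F, phasePow, cf, cg]
    fun_prop
  have key := HadamardThreeLines.norm_le_interp_of_mem_verticalClosedStrip₀₁' F (z := (θ : ℂ))
    (a := N₀ * A ^ (3 / 4 : ℝ) * B ^ (1 / 2 : ℝ)) (b := N₁ * A * B)
    (by simp [HadamardThreeLines.verticalClosedStrip, hθ0.le, hθ1.le]) hF.diffContOnCl ?_ ?_ ?_
  · have h1 : cf θ = 1 := by
      simp only [cf, hp]
      have : (3 + θ : ℂ) ≠ 0 := by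
        have : (3 + θ : ℝ) ≠ 0 := by positivity
        exact_mod_cast this
      push_cast
      field_simp
    have h2 : cg θ = 1 := by
      simp only [cg, hq]
      have : (1 + θ : ℂ) ≠ 0 := by
        have : (1 + θ : ℝ) ≠ 0 := by positivity
        exact_mod_cast this
      push_cast
      field_simp
    simp only [F, h1, h2, phasePow_one, ofReal_re] at key
    refine key.trans_eq ?_
    rw [Real.mul_rpow (by positivity) (by positivity), Real.mul_rpow hN₀ (by positivity),
      Real.mul_rpow (by positivity) hB, Real.mul_rpow hN₁ hA, ← Real.rpow_mul hA,
      ← Real.rpow_mul hB]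
    have e1 : A ^ ((3 + θ) / 4) = A ^ (3 / 4 * (1 - θ)) * A ^ θ := by
      rw [← Real.rpow_add_of_nonneg hA (by nlinarith) hθ0.le]; ring_nf
    have e2 : B ^ ((1 + θ) / 2) = B ^ (1 / 2 * (1 - θ)) * B ^ θ := by
      rw [← Real.rpow_add_of_nonneg hB (by nlinarith) hθ0.le]; ring_nf
    rw [e1, e2]
    ring
  · refine ⟨∑ x ∈ R, (1 + ‖g x‖) ^ q * ∑ y ∈ S, N₁ * (1 + ‖f y‖) ^ p, ?_⟩
    rintro _ ⟨z, ⟨hz0, hz1⟩, rfl⟩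
    refine (norm_sum_le _ _).trans (Finset.sum_le_sum fun x _ => ?_)
    rw [norm_mul]
    refine mul_le_mul (norm_phasePow_le ?_ ?_) ((norm_sum_le _ _).trans
      (Finset.sum_le_sum fun y _ => ?_)) (norm_nonneg _) (by positivity)
    · rw [cg_re]; positivity
    · rw [cg_re]; nlinarith
    · rw [norm_mul]
      refine mul_le_mul (hK _ _) (norm_phasePow_le ?_ ?_) (norm_nonneg _) hN₁
      · rw [cf_re]; positivity
      · rw [cf_re]; nlinarith
  · intro z hz
    have hz : z.re = 0 := hz
    calc ‖F z‖ ≤ ∑ x ∈ R, ‖phasePow (g x) (cg z)‖ * ‖∑ y ∈ S, K x y * phasePow (f y) (cf z)‖ :=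
          (norm_sum_le _ _).trans_eq (by simp only [norm_mul])
      _ ≤ √(∑ x ∈ R, ‖phasePow (g x) (cg z)‖ ^ 2) *
          √(∑ x ∈ R, ‖∑ y ∈ S, K x y * phasePow (f y) (cf z)‖ ^ 2) :=
          Real.sum_mul_le_sqrt_mul_sqrt _ _ _
      _ ≤ √B * (N₀ * A ^ (3 / 4 : ℝ)) := by
        have e1 (x : ι) : ‖phasePow (g x) (cg z)‖ ^ 2 = ‖g x‖ ^ q := by
          rw [norm_phasePow _ _ (by rw [cg_re, hz]; positivity), cg_re, hz,
            ← Real.rpow_mul_natCast (norm_nonneg _)]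
          congr 1; push_cast; ring
        have e2 (y : κ) : ‖phasePow (f y) (cf z)‖ ^ (4 / 3 : ℝ) = ‖f y‖ ^ p := by
          rw [norm_phasePow _ _ (by rw [cf_re, hz]; positivity), cf_re, hz,
            ← Real.rpow_mul (norm_nonneg _)]
          congr 1; ring
        simp only [e1]
        refine mul_le_mul_of_nonneg_left (Real.sqrt_le_iff.2 ⟨by positivity, ?_⟩)
          (Real.sqrt_nonneg _)
        refine (hL _).trans_eq ?_
        simp only [e2]
        rfl
      _ = _ := by rw [Real.sqrt_eq_rpow]; ring
  · intro z hz
    have hz : z.re = 1 := hz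
    calc ‖F z‖ ≤ ∑ x ∈ R, ‖phasePow (g x) (cg z)‖ * ∑ y ∈ S, N₁ * ‖phasePow (f y) (cf z)‖ := by
          refine (norm_sum_le _ _).trans (Finset.sum_le_sum fun x _ => ?_)
          rw [norm_mul]
          gcongr
          refine (norm_sum_le _ _).trans (Finset.sum_le_sum fun y _ => ?_)
          rw [norm_mul]
          gcongr
          exact hK x y
      _ = _ := by
        have e1 (x : ι) : ‖phasePow (g x) (cg z)‖ = ‖g x‖ ^ q := by
          rw [norm_phasePow _ _ (by rw [cg_re, hz]; positivity), cg_re, hz]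
          congr 1; ring
        have e2 (y : κ) : ‖phasePow (f y) (cf z)‖ = ‖f y‖ ^ p := by
          rw [norm_phasePow _ _ (by rw [cf_re, hz]; positivity), cf_re, hz]
          congr 1; ring
        simp only [e1, e2, ← Finset.mul_sum, ← Finset.sum_mul]
        ring

lemma sum_norm_rpow_le_interp {ι κ : Type*} (R : Finset ι) (S : Finset κ) (K : ι → κ → ℂ)
    {N₀ N₁ θ : ℝ} (hN₀ : 0 ≤ N₀) (hN₁ : 0 ≤ N₁) (hθ0 : 0 ≤ θ) (hθ1 : θ < 1)
    (hK : ∀ x y, ‖K x y‖ ≤ N₁)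
    (hL : ∀ f : κ → ℂ, ∑ x ∈ R, ‖∑ y ∈ S, K x y * f y‖ ^ 2 ≤
      (N₀ * (∑ y ∈ S, ‖f y‖ ^ (4 / 3 : ℝ)) ^ (3 / 4 : ℝ)) ^ 2) (f : κ → ℂ) :
    (∑ x ∈ R, ‖∑ y ∈ S, K x y * f y‖ ^ (2 / (1 - θ))) ^ ((1 - θ) / 2) ≤
      N₀ ^ (1 - θ) * N₁ ^ θ * (∑ y ∈ S, ‖f y‖ ^ (4 / (3 + θ))) ^ ((3 + θ) / 4) := by
  rcases hθ0.eq_or_lt with rfl | hθ0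
  · have h0 : 0 ≤ ∑ y ∈ S, ‖f y‖ ^ (4 / 3 : ℝ) := Finset.sum_nonneg fun _ _ => by positivity
    simpa [Real.sqrt_eq_rpow] using Real.sqrt_le_iff.2 ⟨by positivity, hL f⟩
  set h : ι → ℂ := fun x => ∑ y ∈ S, K x y * f y
  have h1 : 0 < 1 - θ := by linarith
  set q : ℝ := 2 / (1 - θ) with hq
  have hq2 : 2 < q := by rw [hq, lt_div_iff₀ h1]; linarith
  set H := ∑ x ∈ R, ‖h x‖ ^ q
  have hH : 0 ≤ H := Finset.sum_nonneg fun _ _ => by positivity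
  rcases hH.eq_or_lt with h0 | hpos
  · change H ^ _ ≤ _
    rw [← h0, Real.zero_rpow (by positivity)]
    have : 0 ≤ ∑ y ∈ S, ‖f y‖ ^ (4 / (3 + θ)) := Finset.sum_nonneg fun _ _ => by positivity
    positivity
  have key := norm_bilinear_le_interp R S K hN₀ hN₁ hθ0 hθ1 hK hL f
    (fun x => (starRingEnd ℂ) (h x) * ((‖h x‖ ^ (q - 2) : ℝ) : ℂ))
  have e1 (x : ι) : (starRingEnd ℂ) (h x) * ((‖h x‖ ^ (q - 2) : ℝ) : ℂ) * h x
      = ((‖h x‖ ^ q : ℝ) : ℂ) := by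
    rw [mul_right_comm, mul_comm ((starRingEnd ℂ) (h x)), mul_conj, normSq_eq_norm_sq,
      ← Complex.ofReal_mul, ← Real.rpow_natCast, ← Real.rpow_add_of_nonneg (norm_nonneg _)
        (by positivity) (by linarith)]
    congr 2; push_cast; ring
  have e2 (x : ι) : ‖(starRingEnd ℂ) (h x) * ((‖h x‖ ^ (q - 2) : ℝ) : ℂ)‖ ^ (2 / (1 + θ))
      = ‖h x‖ ^ q := by
    have hn : ‖(starRingEnd ℂ) (h x) * ((‖h x‖ ^ (q - 2) : ℝ) : ℂ)‖ = ‖h x‖ ^ (q - 1) := by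
      rw [norm_mul, RCLike.norm_conj, norm_real, Real.norm_of_nonneg (by positivity)]
      nth_rewrite 1 [← Real.rpow_one ‖h x‖]
      rw [← Real.rpow_add_of_nonneg (norm_nonneg _) (by positivity) (by linarith)]
      congr 1; ring
    rw [hn, ← Real.rpow_mul (norm_nonneg _)]
    congr 1
    rw [hq]; field_simp; ring
  simp only [e2] at key
  have e3 : (∑ x ∈ R, (starRingEnd ℂ) (h x) * ((‖h x‖ ^ (q - 2) : ℝ) : ℂ) * ∑ y ∈ S, K x y * f y)
      = (H : ℂ) := by
    rw [ofReal_sum]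
    exact Finset.sum_congr rfl fun x _ => e1 x
  rw [e3, norm_real, Real.norm_of_nonneg hH] at key
  have e4 : H ^ ((1 - θ) / 2) * H ^ ((1 + θ) / 2) = H := by
    rw [← Real.rpow_add hpos]
    ring_nf
    rw [Real.rpow_one]
  exact le_of_mul_le_mul_right (e4.trans_le key) (by positivity : 0 < H ^ ((1 + θ) / 2))

lemma ofReal_sum_norm_rpow {ι : Type*} (S : Finset ι) (f : ι → ℂ) {p : ℝ} (hp : 0 < p) :
    ENNReal.ofReal ((∑ y ∈ S, ‖f y‖ ^ p) ^ (1 / p)) = (∑ y ∈ S, ‖f y‖ₑ ^ p) ^ (1 / p) := by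
  rw [← ENNReal.ofReal_rpow_of_nonneg (Finset.sum_nonneg fun _ _ => by positivity)
    (by positivity), ENNReal.ofReal_sum_of_nonneg fun _ _ => by positivity]
  congr 1
  refine Finset.sum_congr rfl fun y _ => ?_
  rw [← ENNReal.ofReal_rpow_of_nonneg (norm_nonneg _) hp.le, ofReal_norm]

lemma eLpNorm_count_ofReal {ι : Type*} [MeasurableSpace ι] [MeasurableSingletonClass ι]
    (f : ι → ℂ) {p : ℝ} (hp : 0 < p) :
    eLpNorm f (ENNReal.ofReal p) Measure.count = (∑' y, ‖f y‖ₑ ^ p) ^ (1 / p) := by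
  rw [eLpNorm_eq_lintegral_rpow_enorm_toReal (by simpa using hp) ofReal_ne_top,
    ENNReal.toReal_ofReal hp.le, lintegral_count]

lemma ofReal_sum_norm_rpow_le_eLpNorm {ι : Type*} [MeasurableSpace ι]
    [MeasurableSingletonClass ι] (S : Finset ι) (f : ι → ℂ) {p : ℝ} (hp : 0 < p) :
    ENNReal.ofReal ((∑ y ∈ S, ‖f y‖ ^ p) ^ (1 / p)) ≤
      eLpNorm f (ENNReal.ofReal p) Measure.count := by
  rw [ofReal_sum_norm_rpow S f hp, eLpNorm_count_ofReal f hp]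
  exact ENNReal.rpow_le_rpow (ENNReal.sum_le_tsum S) (by positivity)

lemma eLpNorm_count_le_of_finset {ι : Type*} [MeasurableSpace ι] [MeasurableSingletonClass ι]
    (f : ι → ℂ) {p : ℝ} (hp : 0 < p) {B : ℝ≥0∞}
    (h : ∀ S : Finset ι, ENNReal.ofReal ((∑ y ∈ S, ‖f y‖ ^ p) ^ (1 / p)) ≤ B) :
    eLpNorm f (ENNReal.ofReal p) Measure.count ≤ B := by
  rw [eLpNorm_count_ofReal f hp, ENNReal.tsum_eq_iSup_sum, one_div,
    ENNReal.rpow_inv_le_iff hp]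
  refine iSup_le fun S => ?_
  rw [← ENNReal.rpow_inv_le_iff hp, ← one_div, ← ofReal_sum_norm_rpow S f hp]
  exact h S

/-- Bounds for truncated sums pass to the full sum; non-summable series contribute `0`. -/
lemma eLpNorm_tsum_le_of_finset {ι κ : Type*} [Countable ι] [Countable κ] [MeasurableSpace ι]
    [MeasurableSingletonClass ι] (F : ι → κ → ℂ) (q : ℝ≥0∞) {B : ℝ≥0∞}
    (h : ∀ S : Finset κ, eLpNorm (fun x => ∑ y ∈ S, F x y) q Measure.count ≤ B) :
    eLpNorm (fun x => ∑' y, F x y) q Measure.count ≤ B := by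
  classical
  obtain ⟨S, hS⟩ := Filter.exists_seq_tendsto (Filter.atTop : Filter (Finset κ))
  let u : ℕ → ι → ℂ := fun n x => if Summable (F x) then ∑ y ∈ S n, F x y else 0
  have hu (n : ℕ) : eLpNorm (u n) q Measure.count ≤ B := by
    refine (eLpNorm_mono fun x => ?_).trans (h (S n))
    by_cases hx : Summable (F x) <;> simp [u, hx]
  have hlim (x : ι) : Filter.Tendsto (fun n => u n x) Filter.atTop (nhds (∑' y, F x y)) := by
    by_cases hx : Summable (F x)
    · simpa [u, hx, Function.comp_def] using Filter.Tendsto.comp hx.hasSum hS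
    · simp [u, hx, tsum_eq_zero_of_not_summable hx]
  refine (Lp.eLpNorm_lim_le_liminf_eLpNorm (fun n => (measurable_of_countable
    (u n)).aestronglyMeasurable) _ (Filter.Eventually.of_forall hlim)).trans ?_
  exact Filter.liminf_le_of_le (by isBoundedDefault) fun b hb =>
    let ⟨n, hn⟩ := hb.exists
    hn.trans (hu n)

/-- Interpolated bound for the evolution at one time, given a pointwise bound on the kernel. -/
lemma eLpNorm_greenG_conv_le {θ N t : ℝ} (hθ0 : 0 ≤ θ) (hθ1 : θ < 1) (hN : 0 ≤ N)
    (hG : ∀ x, ‖greenG 4 x t‖ ≤ N) (f : (Fin 4 → ℤ) → ℂ) :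
    eLpNorm (fun x => ∑' y, greenG 4 (x - y) t * f y) (ENNReal.ofReal (2 / (1 - θ)))
      Measure.count ≤ ENNReal.ofReal (√288 ^ (1 - θ) * N ^ θ) *
        eLpNorm f (ENNReal.ofReal (4 / (3 + θ))) Measure.count := by
  have h1 : 0 < 1 - θ := by linarith
  refine eLpNorm_tsum_le_of_finset _ _ fun S =>
    eLpNorm_count_le_of_finset _ (by positivity) fun R => ?_
  have key := sum_norm_rpow_le_interp R S (fun x y => greenG 4 (x - y) t)
    (Real.sqrt_nonneg 288) hN hθ0 hθ1 (fun x y => hG _) (fun f => by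
      refine (sum_norm_greenG_sq_le R S f t).trans_eq ?_
      rw [mul_pow, Real.sq_sqrt (by norm_num)]) f
  rw [one_div_div]
  refine (ENNReal.ofReal_le_ofReal key).trans ?_
  rw [ENNReal.ofReal_mul (by positivity)]
  gcongr
  simpa only [one_div_div] using ofReal_sum_norm_rpow_le_eLpNorm S f
    (show 0 < 4 / (3 + θ) by positivity)

lemma eLpNorm_top_greenG_conv_le {N t : ℝ}
    (hG : ∀ x, ‖greenG 4 x t‖ ≤ N) (f : (Fin 4 → ℤ) → ℂ) :
    eLpNorm (fun x => ∑' y, greenG 4 (x - y) t * f y) ∞ Measure.count ≤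
      ENNReal.ofReal N * eLpNorm f 1 Measure.count := by
  refine eLpNorm_tsum_le_of_finset _ _ fun S => ?_
  rw [eLpNorm_exponent_top]
  refine eLpNormEssSup_le_of_ae_enorm_bound (Filter.Eventually.of_forall fun x => ?_)
  rw [eLpNorm_one_eq_lintegral_enorm, lintegral_count]
  calc ‖∑ y ∈ S, greenG 4 (x - y) t * f y‖ₑ ≤ ∑ y ∈ S, ‖greenG 4 (x - y) t * f y‖ₑ :=
        enorm_sum_le _ _
    _ ≤ ∑ y ∈ S, ENNReal.ofReal N * ‖f y‖ₑ := by
        refine Finset.sum_le_sum fun y _ => ?_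
        rw [enorm_mul, ← ofReal_norm (greenG 4 (x - y) t)]
        gcongr
        exact hG _
    _ ≤ _ := by
        rw [← Finset.mul_sum]
        gcongr
        exact ENNReal.sum_le_tsum S

/-- In the range of the segment, the exponents are `p = 4 / (3 + θ)` and `q = 2 / (1 - θ)`. -/
lemma exists_interp_parameter {p q : ℝ≥0∞} (hp1 : 1 ≤ p) (hpq : p ≤ q) (hq : q ≠ ∞)
    (h : 1 / q + 2 * (1 / p) = 2) (hp : 3 / 4 ≤ 1 / p) :
    ∃ θ : ℝ, 0 ≤ θ ∧ θ < 1 ∧ p = ENNReal.ofReal (4 / (3 + θ)) ∧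
      q = ENNReal.ofReal (2 / (1 - θ)) := by
  have hpt : p ≠ ∞ := ne_top_of_le_ne_top hq hpq
  have hp0 : 1 ≤ p.toReal := by simpa using ENNReal.toReal_mono hpt hp1
  have hq0 : 1 ≤ q.toReal := by simpa using ENNReal.toReal_mono hq (hp1.trans hpq)
  have hip : 1 / p ≠ ∞ := by
    rw [one_div]; exact ENNReal.inv_ne_top.2 (zero_lt_one.trans_le hp1).ne'
  have hiq : 1 / q ≠ ∞ := by
    rw [one_div]; exact ENNReal.inv_ne_top.2 (zero_lt_one.trans_le (hp1.trans hpq)).ne'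
  have h' := congrArg ENNReal.toReal h
  rw [ENNReal.toReal_add hiq (ENNReal.mul_ne_top (by simp) hip)] at h'
  simp only [ENNReal.toReal_mul, ENNReal.toReal_div, ENNReal.toReal_one,
    ENNReal.toReal_ofNat] at h'
  have hp' := ENNReal.toReal_mono hip hp
  simp only [ENNReal.toReal_div, ENNReal.toReal_one, ENNReal.toReal_ofNat] at hp'
  have hqpos : 0 < 1 / q.toReal := by positivity
  have e1 : p.toReal = 1 / (1 / p.toReal) := (one_div_one_div _).symm
  have e2 : q.toReal = 1 / (1 / q.toReal) := (one_div_one_div _).symm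
  refine ⟨1 - 2 * (1 / q.toReal), by linarith, by linarith, ?_, ?_⟩
  · rw [← ENNReal.ofReal_toReal hpt]
    congr 1
    rw [show 3 + (1 - 2 * (1 / q.toReal)) = 4 * (1 / p.toReal) by linarith]
    field_simp
  · rw [← ENNReal.ofReal_toReal hq, ENNReal.toReal_ofReal (by positivity)]
    congr 1
    field_simp
    ring

/-- improved `l^p → l^q` estimates on the segment joining
`(3/4, 1/2)` and `(1, 0)`, i.e. `1/q = -2(1/p) + 2` with `3/4 ≤ 1/p ≤ 1`. -/
theorem lp_lq_estimate_segment_dim4 :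
    ∀ p q : ℝ≥0∞, 1 ≤ p → p ≤ q →
      1 / q + 2 * (1 / p) = 2 →
      3 / 4 ≤ 1 / p → 1 / p ≤ 1 →
      ∀ ε : ℝ, 0 < ε →
        ∃ C : ℝ, 0 < C ∧
          ∀ (t : ℝ) (f : (Fin 4 → ℤ) → ℂ),
            lpNorm 4 q (fun x => ∑' y : Fin 4 → ℤ, greenG 4 (x - y) t * f y)
              ≤ ENNReal.ofReal
                  (C * (1 + |t|) ^ (-(3 / 2 - ε) * (1 - 2 / q.toReal)))
                * lpNorm 4 p f := by
  intro p q hp1 hpq hline hp _ ε hε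
  have hδ : 0 < min ε (1 / 2) := by positivity
  obtain ⟨C, hC, hG⟩ := exists_norm_greenG_le (δ := min ε (1 / 2) / 2) (by linarith)
    (by linarith [min_le_right ε (1 / 2)])
  have hG' (t : ℝ) (x) : ‖greenG 4 x t‖ ≤ C * (1 + |t|) ^ (-(3 / 2 - ε)) := by
    refine (hG t x).trans ?_
    have := min_le_left ε (1 / 2)
    have := abs_nonneg t
    gcongr <;> linarith
  simp only [_root_.lpNorm]
  rcases eq_or_ne q ∞ with rfl | hq
  · have hp' : p = 1 := by
      have h : 2 * (1 / p) = 2 * 1 := by simpa using hline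
      have h2 := (ENNReal.mul_right_inj (by simp) (by simp)).1 h
      simpa using h2
    subst hp'
    refine ⟨C, hC, fun t f => ?_⟩
    simpa using eLpNorm_top_greenG_conv_le (hG' t) f
  · obtain ⟨θ, hθ0, hθ1, rfl, rfl⟩ := exists_interp_parameter hp1 hpq hq hline hp
    have h1 : 0 < 1 - θ := by linarith
    refine ⟨√288 ^ (1 - θ) * C ^ θ, by positivity, fun t f => ?_⟩
    refine (eLpNorm_greenG_conv_le hθ0 hθ1 (by positivity) (hG' t) f).trans_eq ?_
    rw [Real.mul_rpow hC.le (by positivity), ← Real.rpow_mul (by positivity),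
      ENNReal.toReal_ofReal (by positivity), div_div_cancel₀ two_ne_zero, _root_.sub_sub_cancel,
      mul_assoc]
end

section
/- Let d ≥ 2 and let ξ ∈ [0,π]^d \ {0}. Let H(ξ) denote the d×d Hessian matrix of ω at ξ (ω is smooth near every such ξ since ω(ξ) > 0), and let corank H(ξ) = d − rank H(ξ). Then: (i) corank H(ξ) ≤ d − 1, i.e. H(ξ) is never the zero map; (ii) corank H(ξ) = 1 if and only if either exactly two of the coordinates ξ_1,…,ξ_d equal π/2, or no coordinate equals π/2 and ∑_{j=1}^d ( cos ξ_j + 1/cos ξ_j ) = 2d; (iii) if d ≥ 3, then for each integer j with 2 ≤ j ≤ d − 1, corank H(ξ) = j if and only if exactly j + 1 of the coordinates ξ_1,…,ξ_d equal π/2. -/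
open MeasureTheory

/-- the Hessian matrix of `ω` at `ξ`: `H(ξ)_{ij} = ∂_j ∂_i ω(ξ)`. -/
noncomputable def hessOmega (d : ℕ) (ξ : Fin d → ℝ) : Matrix (Fin d) (Fin d) ℝ :=
  Matrix.of fun i j =>
    fderiv ℝ (fun x => fderiv ℝ (discOmega d) x (Pi.single i 1)) ξ (Pi.single j 1)

open Module

lemma hasFDerivAt_discOmega {d : ℕ} {x : Fin d → ℝ}
    (hx : ∑ j, (2 - 2 * Real.cos (x j)) ≠ 0) :
    HasFDerivAt (discOmega d)
      ((discOmega d x)⁻¹ • ∑ j, Real.sin (x j) • ContinuousLinearMap.proj (R := ℝ) j) x := by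
  have h : HasFDerivAt (fun y : Fin d → ℝ => ∑ j, (2 - 2 * Real.cos (y j)))
      (∑ j, (2 * Real.sin (x j)) •
        ContinuousLinearMap.proj (R := ℝ) (φ := fun _ : Fin d => ℝ) j) x := by
    refine HasFDerivAt.fun_sum fun j _ => ?_
    have h1 := (((hasFDerivAt_apply (𝕜 := ℝ) (F' := fun _ : Fin d => ℝ) j x).cos.const_mul
      2).const_sub 2)
    refine h1.congr_fderiv ?_
    ext v
    simp [mul_assoc]
  refine (h.sqrt hx).congr_fderiv ?_
  ext v
  simp only [discOmega, smul_apply, sum_apply,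
    smul_eq_mul, Finset.mul_sum]
  refine Finset.sum_congr rfl fun j _ => ?_
  ring

lemma fderiv_discOmega_single {d : ℕ} {x : Fin d → ℝ}
    (hx : ∑ j, (2 - 2 * Real.cos (x j)) ≠ 0) (i : Fin d) :
    fderiv ℝ (discOmega d) x (Pi.single i 1) = Real.sin (x i) * (discOmega d x)⁻¹ := by
  rw [(hasFDerivAt_discOmega hx).fderiv]
  simp [Pi.single_apply, mul_comm]

/-- A diagonal matrix perturbed by a rank-one symmetric matrix. -/
def diagSubRankOne {ι : Type*} [DecidableEq ι] (c s : ι → ℝ) (k : ℝ) : Matrix ι ι ℝ :=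
  Matrix.diagonal c - k • Matrix.vecMulVec s s

lemma hessOmega_eq {d : ℕ} {ξ : Fin d → ℝ} (hξ : 0 < ∑ j, (2 - 2 * Real.cos (ξ j))) :
    hessOmega d ξ = (discOmega d ξ)⁻¹ • diagSubRankOne (fun j => Real.cos (ξ j))
      (fun j => Real.sin (ξ j)) (∑ j, (2 - 2 * Real.cos (ξ j)))⁻¹ := by
  have hω : 0 < discOmega d ξ := Real.sqrt_pos.2 hξ
  have hsq : discOmega d ξ ^ 2 = ∑ j, (2 - 2 * Real.cos (ξ j)) := Real.sq_sqrt hξ.le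
  ext i j
  have hev : (fun x => fderiv ℝ (discOmega d) x (Pi.single i 1)) =ᶠ[nhds ξ]
      fun x => Real.sin (x i) * (discOmega d x)⁻¹ := by
    have hc : Continuous fun x : Fin d → ℝ => ∑ j, (2 - 2 * Real.cos (x j)) := by fun_prop
    filter_upwards [hc.continuousAt.eventually_ne hξ.ne'] with x hx
    exact fderiv_discOmega_single hx i
  have hd := (hasFDerivAt_apply (𝕜 := ℝ) (F' := fun _ : Fin d => ℝ) i ξ).sin.mul
    ((hasDerivAt_inv hω.ne').comp_hasFDerivAt ξ (hasFDerivAt_discOmega hξ.ne'))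
  have hd' : fderiv ℝ (fun x : Fin d → ℝ => Real.sin (x i) * (discOmega d x)⁻¹) ξ = _ :=
    hd.fderiv
  rw [hessOmega, Matrix.of_apply, hev.fderiv_eq, hd', ← hsq]
  by_cases hij : i = j
  · subst hij
    simp [diagSubRankOne, Matrix.vecMulVec_apply, Pi.single_apply]
    field_simp
    ring
  · simp [diagSubRankOne, Matrix.vecMulVec_apply, Pi.single_apply, hij]
    field_simp

section Rank

variable {ι : Type*} [Fintype ι] [DecidableEq ι] {c s : ι → ℝ} {k : ℝ}

lemma mem_ker_diagSubRankOne {v : ι → ℝ} :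
    v ∈ LinearMap.ker (diagSubRankOne c s k).mulVecLin ↔
      ∀ i, c i * v i = k * s i * ∑ j, s j * v j := by
  rw [LinearMap.mem_ker, Matrix.mulVecLin_apply, funext_iff]
  refine forall_congr' fun i => ?_
  simp only [diagSubRankOne, Matrix.sub_mulVec, Matrix.smul_mulVec, Pi.sub_apply,
    Matrix.mulVec_diagonal, Matrix.vecMulVec_mulVec, Pi.smul_apply, Pi.zero_apply, sub_eq_zero,
    dotProduct, smul_eq_mul, MulOpposite.smul_eq_mul_unop, MulOpposite.unop_op, mul_assoc]

omit [DecidableEq ι] in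
lemma rank_add_finrank_ker (M : Matrix ι ι ℝ) :
    M.rank + finrank ℝ (LinearMap.ker M.mulVecLin) = Fintype.card ι := by
  simpa [Matrix.rank] using M.mulVecLin.finrank_range_add_finrank_ker

lemma finrank_ker_diagSubRankOne_of_zero (hk : k ≠ 0) (hs : ∀ i, c i = 0 → s i ≠ 0)
    (h0 : ∃ i, c i = 0) :
    finrank ℝ (LinearMap.ker (diagSubRankOne c s k).mulVecLin) + 1 =
      (Finset.univ.filter fun i => c i = 0).card := by
  obtain ⟨i₀, hi₀⟩ := h0
  let f : Dual ℝ ({i // c i = 0} → ℝ) := ∑ i, s i.1 • LinearMap.proj i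
  have hf (w) : f w = ∑ i, s i.1 * w i := by simp [f]
  have hf0 : f ≠ 0 := by
    intro h
    have h1 := hf (Pi.single ⟨i₀, hi₀⟩ 1)
    rw [h] at h1
    simp [Pi.single_apply, eq_comm, hs i₀ hi₀] at h1
  let E := Function.ExtendByZero.linearMap ℝ (Subtype.val : {i // c i = 0} → ι)
  have hE (w) (i : {i // c i = 0}) : E w i.1 = w i :=
    Subtype.val_injective.extend_apply w 0 i
  have hE0 (w) (i : ι) (hi : c i ≠ 0) : E w i = 0 :=
    Function.extend_apply' (f := Subtype.val) w 0 i fun ⟨a, ha⟩ => hi (ha ▸ a.2)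
  have hinj : Function.Injective E := fun w w' h => by
    ext i
    rw [← hE w, h, hE]
  have hsum (w) : ∑ j, s j * E w j = f w := by
    rw [hf, ← Fintype.sum_subtype_add_sum_subtype (fun i => c i = 0)]
    rw [add_eq_left.2 (Finset.sum_eq_zero fun i _ => by rw [hE0 w i i.2, mul_zero])]
    simp only [hE]
  have hker : LinearMap.ker (diagSubRankOne c s k).mulVecLin = (LinearMap.ker f).map E := by
    ext v
    rw [mem_ker_diagSubRankOne, Submodule.mem_map]
    constructor
    · intro h
      have hz : ∑ j, s j * v j = 0 := by
        have := h i₀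
        rw [hi₀, zero_mul, eq_comm, mul_assoc] at this
        simpa [hk, hs i₀ hi₀] using this
      have hv : E (fun i => v i.1) = v := by
        ext i
        by_cases hi : c i = 0
        · exact hE _ ⟨i, hi⟩
        · rw [hE0 _ i hi]
          have := h i
          rw [hz, mul_zero] at this
          exact ((mul_eq_zero.1 this).resolve_left hi).symm
      refine ⟨fun i => v i.1, ?_, hv⟩
      rw [LinearMap.mem_ker, ← hsum, hv, hz]
    · rintro ⟨w, hw, rfl⟩ i
      rw [hsum, LinearMap.mem_ker.1 hw, mul_zero]
      by_cases hi : c i = 0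
      · rw [hi, zero_mul]
      · rw [hE0 w i hi, mul_zero]
  rw [hker, ← (Submodule.equivMapOfInjective E hinj _).finrank_eq,
    Module.Dual.finrank_ker_add_one_of_ne_zero hf0, Module.finrank_fintype_fun_eq_card,
    Fintype.card_subtype]

lemma finrank_ker_diagSubRankOne_of_ne_zero (hc : ∀ i, c i ≠ 0) :
    finrank ℝ (LinearMap.ker (diagSubRankOne c s k).mulVecLin) =
      if k * ∑ i, s i ^ 2 / c i = 1 then 1 else 0 := by
  have hsum (t : ℝ) : ∑ j, s j * (t * (s j / c j)) = t * ∑ i, s i ^ 2 / c i := by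
    rw [Finset.mul_sum]
    exact Finset.sum_congr rfl fun j _ => by ring
  have hform {v : ι → ℝ} (hv : v ∈ LinearMap.ker (diagSubRankOne c s k).mulVecLin) :
      v = fun i => (k * ∑ j, s j * v j) * (s i / c i) := by
    ext i
    have := mem_ker_diagSubRankOne.1 hv i
    have := hc i
    field_simp
    linarith
  split_ifs with h
  · have hne : (fun i => s i / c i) ≠ 0 := by
      intro h0
      have h1 := hsum 1
      have (i : ι) : s i / c i = 0 := congrFun h0 i
      simp only [this, mul_zero, Finset.sum_const_zero, one_mul] at h1
      simp [← h1] at h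
    rw [← finrank_span_singleton (K := ℝ) hne]
    refine congrArg (fun K : Submodule ℝ (ι → ℝ) => finrank ℝ K) ?_
    refine le_antisymm (fun v hv => Submodule.mem_span_singleton.2 ⟨_, (hform hv).symm⟩) ?_
    rw [Submodule.span_singleton_le_iff_mem, mem_ker_diagSubRankOne]
    intro i
    have h1 := hsum 1
    simp only [one_mul] at h1
    rw [h1, mul_div_cancel₀ _ (hc i), mul_right_comm, h, one_mul]
  · rw [Submodule.finrank_eq_zero, Submodule.eq_bot_iff]
    intro v hv
    have h1 := hform hv
    have h2 : ∑ j, s j * v j = (k * ∑ j, s j * v j) * ∑ i, s i ^ 2 / c i := by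
      rw [← hsum]
      exact Finset.sum_congr rfl fun j _ => by rw [← congrFun h1 j]
    have h3 : ∑ j, s j * v j = 0 := by
      have : (∑ j, s j * v j) * (k * ∑ i, s i ^ 2 / c i - 1) = 0 := by linear_combination -h2
      exact (mul_eq_zero.1 this).resolve_right (sub_ne_zero.2 h)
    rw [h1, h3]
    ext i
    simp

end Rank

lemma sum_two_sub_two_cos_pos {d : ℕ} {ξ : Fin d → ℝ}
    (hbox : ∀ j, ξ j ∈ Set.Icc 0 Real.pi) (hne : ξ ≠ 0) :
    0 < ∑ j, (2 - 2 * Real.cos (ξ j)) := by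
  obtain ⟨i, hi⟩ := Function.ne_iff.1 hne
  refine Finset.sum_pos' (fun j _ => by linarith [Real.cos_le_one (ξ j)])
    ⟨i, Finset.mem_univ i, ?_⟩
  have := Real.strictAntiOn_cos (Set.left_mem_Icc.2 Real.pi_pos.le) (hbox i)
    (lt_of_le_of_ne (hbox i).1 (Ne.symm hi))
  rw [Real.cos_zero] at this
  linarith

lemma cos_eq_zero_iff_of_mem_Icc {x : ℝ} (hx : x ∈ Set.Icc 0 Real.pi) :
    Real.cos x = 0 ↔ x = Real.pi / 2 := by
  rw [← Real.cos_pi_div_two]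
  exact Real.injOn_cos.eq_iff hx ⟨by positivity, by linarith [Real.pi_pos]⟩

lemma inv_mul_sum_sin_sq_div_cos_eq_one_iff {d : ℕ} {ξ : Fin d → ℝ}
    (hpos : 0 < ∑ j, (2 - 2 * Real.cos (ξ j))) (hc : ∀ j, Real.cos (ξ j) ≠ 0) :
    (∑ j, (2 - 2 * Real.cos (ξ j)))⁻¹ * ∑ j, Real.sin (ξ j) ^ 2 / Real.cos (ξ j) = 1 ↔
      ∑ j, (Real.cos (ξ j) + 1 / Real.cos (ξ j)) = 2 * d := by
  have h : ∑ j, Real.sin (ξ j) ^ 2 / Real.cos (ξ j) - ∑ j, (2 - 2 * Real.cos (ξ j)) =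
      ∑ j, (Real.cos (ξ j) + 1 / Real.cos (ξ j)) - 2 * d := by
    have h2 : (2 * d : ℝ) = ∑ _j : Fin d, (2 : ℝ) := by simp [mul_comm]
    rw [h2, ← Finset.sum_sub_distrib, ← Finset.sum_sub_distrib]
    refine Finset.sum_congr rfl fun j _ => ?_
    have := hc j
    rw [Real.sin_sq]
    field_simp
    ring
  rw [inv_mul_eq_one₀ hpos.ne', eq_comm, ← sub_eq_zero, h, sub_eq_zero]

/-- classification of the corank of `Hess ω` on `[0,π]^d \ {0}`. -/
theorem corank_classification (d : ℕ) (hd : 2 ≤ d) (ξ : Fin d → ℝ)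
    (hbox : ∀ j, ξ j ∈ Set.Icc 0 Real.pi) (hne : ξ ≠ 0) :
    (hessOmega d ξ ≠ 0 ∧ d - (hessOmega d ξ).rank ≤ d - 1) ∧
    (d - (hessOmega d ξ).rank = 1 ∧ (hessOmega d ξ).rank = d - 1 ↔
      (Finset.univ.filter fun j => ξ j = Real.pi / 2).card = 2 ∨
      ((∀ j, ξ j ≠ Real.pi / 2) ∧
        ∑ j, (Real.cos (ξ j) + 1 / Real.cos (ξ j)) = 2 * d)) ∧
    (3 ≤ d → ∀ j : ℕ, 2 ≤ j → j ≤ d - 1 →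
      (d - (hessOmega d ξ).rank = j ∧ (hessOmega d ξ).rank = d - j ↔
        (Finset.univ.filter fun i => ξ i = Real.pi / 2).card = j + 1)) := by
  have hpos := sum_two_sub_two_cos_pos hbox hne
  have hrank := rank_add_finrank_ker (hessOmega d ξ)
  have hker : LinearMap.ker (hessOmega d ξ).mulVecLin =
      LinearMap.ker (diagSubRankOne (fun j => Real.cos (ξ j)) (fun j => Real.sin (ξ j))
        (∑ j, (2 - 2 * Real.cos (ξ j)))⁻¹).mulVecLin := by
    ext v
    rw [hessOmega_eq hpos]
    have : discOmega d ξ ≠ 0 := (Real.sqrt_pos.2 hpos).ne'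
    simp [this]
  rw [hker, Fintype.card_fin] at hrank
  have hzero : hessOmega d ξ = 0 → (hessOmega d ξ).rank = 0 := fun h => by
    rw [h, Matrix.rank_zero]
  by_cases h0 : ∃ j, Real.cos (ξ j) = 0
  · have hfin := finrank_ker_diagSubRankOne_of_zero (s := fun j => Real.sin (ξ j))
      (inv_ne_zero hpos.ne') (fun i hi h => by
        have := Real.sin_sq_add_cos_sq (ξ i)
        simp_all) h0
    simp only [cos_eq_zero_iff_of_mem_Icc (hbox _)] at hfin h0
    have hle := Finset.card_filter_le Finset.univ fun j => ξ j = Real.pi / 2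
    rw [Finset.card_univ, Fintype.card_fin] at hle
    have hnot : ¬ ∀ j, ξ j ≠ Real.pi / 2 := by simpa using h0
    simp only [hnot, false_and, or_false]
    exact ⟨⟨fun h => by have := hzero h; omega, by omega⟩, by omega, by omega⟩
  · push Not at h0
    have hfin := finrank_ker_diagSubRankOne_of_ne_zero (s := fun j => Real.sin (ξ j))
      (k := (∑ j, (2 - 2 * Real.cos (ξ j)))⁻¹) h0
    rw [hfin] at hrank
    simp only [inv_mul_sum_sin_sq_div_cos_eq_one_iff hpos h0] at hrank
    have hall : ∀ j, ξ j ≠ Real.pi / 2 := fun j h =>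
      h0 j ((cos_eq_zero_iff_of_mem_Icc (hbox j)).2 h)
    have hcard : (Finset.univ.filter fun j => ξ j = Real.pi / 2).card = 0 := by simpa using hall
    rw [hcard]
    simp only [hall, ne_eq, not_false_eq_true, implies_true, true_and]
    split_ifs at hrank with hs
    · exact ⟨⟨fun h => by have := hzero h; omega, by omega⟩,
        ⟨fun _ => Or.inr hs, fun _ => by omega⟩, by omega⟩
    · refine ⟨⟨fun h => by have := hzero h; omega, by omega⟩, ?_, by omega⟩
      simp only [hs, or_false]
      omega
end
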